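/- Let Φ=(f_1,f_2,f_3) be a polynomial automorphism of K^3 with d_1 ≤ d_2 ≤ d_3, where deg_1 is the standard homogeneous degree, and assume the ideal of relations is principal, I = (R). Then there exists a deg_2-homogeneous polynomial h(x_1,x_2) (possibly zero, and of deg_2 equal to d_3 if nonzero) such that, setting x_3' = x_3 + h(x_1,x_2), R is a scalar multiple of one of the following polynomials: (0) 0; (1) x_3'; (2) x_1^{e_1} + c·x_2^{e_2} with c ∈ K*, gcd(e_1,e_2) = 1; (3) (x_2 + a·x_1^{e_1})·x_3' + c·x_1^k with c ∈ K*, a ∈ K, k ≥ 2, e_1 ≥ 1; (4) x_1^k·x_3' + P(x_1,x_2) with k ≥ 1 and P deg_2-homogeneous; (5) x_3'^2 + c·x_2^3 with c ∈ K*; (6) x_3'^2 + c·x_1·x_2^2 with c ∈ K*; (7) x_3'^2 + c·x_1^{r_1} with c ∈ K* and r_1 odd, r_1 ≥ 3; (8) x_3'^2 + c·x_1^{r_1}·x_2 with c ∈ K*, r_1 ≥ 1; (9) x_3'^2 + a·x_1^{e_1} + b·x_2^2 with a,b ∈ K* and e_1 odd, e_1 ≥ 3; (10) x_3'^2 + (a·x_1^{e_1}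 + b·x_2)·x_1^{r_1} with a,b ∈ K*, e_1 ≥ 1; (11) x_3'^2 + (a_1·x_1^{e_1} + b_1·x_2)(a_2·x_1^{e_1} + b_2·x_2) with a_1b_2 − b_1a_2 ≠ 0, e_1 ≥ 1; (12) x_3'^2 + (a_1·x_1 + b_1·x_2)(a_2·x_1 + b_2·x_2)^2 with (a_i,b_i) ≠ (0,0) for i = 1,2; (13) x_3'^2 + (a·x_1^{e_1} + b·x_2)^2·x_1 with ab ≠ 0, e_1 ≥ 2. -/

import Mathlib

open MvPolynomial

/-- Leading term of a polynomial with respect to the standard homogeneous degree. -/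
noncomputable def ltStd {K : Type*} [CommSemiring K] {n : ℕ}
    (p : MvPolynomial (Fin n) K) : MvPolynomial (Fin n) K :=
  homogeneousComponent p.totalDegree p

/-- The ideal of relations between the leading terms (for the standard degree) of the
components of an automorphism. -/
noncomputable def relIdealStd {K : Type*} [CommRing K] {n : ℕ}
    (f : Fin n → MvPolynomial (Fin n) K) : Ideal (MvPolynomial (Fin n) K) :=
  RingHom.ker
    (aeval (fun i => ltStd (f i)) : MvPolynomial (Fin n) K →ₐ[K] MvPolynomial (Fin n) K)

/-- A polynomial in the two variables `x₁, x₂`, viewed inside `K[x₁,x₂,x₃]`. -/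
noncomputable def inj12 {K : Type*} [CommSemiring K]
    (p : MvPolynomial (Fin 2) K) : MvPolynomial (Fin 3) K :=
  rename Fin.castSucc p


section Filt

variable {K : Type*} [Field K] {σ τ : Type*}

/-- All monomials of `P` have weight at most `n`. -/
def LEw (w : σ → ℤ) (n : ℤ) (P : MvPolynomial σ K) : Prop :=
  ∀ m, coeff m P ≠ 0 → Finsupp.weight w m ≤ n

/-- `P` has weight at most `n` and `H` is its component of weight `n`. -/
def Lead (w : σ → ℤ) (n : ℤ) (P H : MvPolynomial σ K) : Prop :=
  IsWeightedHomogeneous w H n ∧ LEw w (n - 1) (P - H)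

lemma LEw.mono {w : σ → ℤ} {n n' : ℤ} {P : MvPolynomial σ K} (h : LEw w n P) (hn : n ≤ n') :
    LEw w n' P := fun m hm => (h m hm).trans hn

lemma LEw.zero (w : σ → ℤ) (n : ℤ) : LEw w n (0 : MvPolynomial σ K) := by
  intro m hm; simp at hm

lemma LEw.add {w : σ → ℤ} {n : ℤ} {P Q : MvPolynomial σ K} (h : LEw w n P) (h' : LEw w n Q) :
    LEw w n (P + Q) := by
  intro m hm
  by_cases h1 : coeff m P = 0
  · apply h'; intro h2; apply hm; simp [h1, h2]
  · exact h m h1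

lemma LEw.neg {w : σ → ℤ} {n : ℤ} {P : MvPolynomial σ K} (h : LEw w n P) :
    LEw w n (-P) := by
  intro m hm; apply h; simpa using hm

lemma LEw.sub {w : σ → ℤ} {n : ℤ} {P Q : MvPolynomial σ K} (h : LEw w n P) (h' : LEw w n Q) :
    LEw w n (P - Q) := by rw [sub_eq_add_neg]; exact h.add h'.neg

lemma LEw.sum {ι : Type*} {w : σ → ℤ} {n : ℤ} {s : Finset ι} {P : ι → MvPolynomial σ K}
    (h : ∀ i ∈ s, LEw w n (P i)) : LEw w n (∑ i ∈ s, P i) := by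
  classical
  induction s using Finset.induction_on with
  | empty => simpa using LEw.zero w n
  | insert a s ha ih =>
    rw [Finset.sum_insert ha]
    exact (h a (by simp)).add (ih fun i hi => h i (by simp [hi]))

lemma LEw.mul {w : σ → ℤ} {a b : ℤ} {P Q : MvPolynomial σ K} (h : LEw w a P) (h' : LEw w b Q) :
    LEw w (a + b) (P * Q) := by
  classical
  intro m hm
  rw [coeff_mul] at hm
  obtain ⟨x, hx, hne⟩ := Finset.exists_ne_zero_of_sum_ne_zero hm
  rw [Finset.HasAntidiagonal.mem_antidiagonal] at hx
  rw [← hx, map_add]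
  exact add_le_add (h _ (left_ne_zero_of_mul hne)) (h' _ (right_ne_zero_of_mul hne))

lemma LEw.of_wh {w : σ → ℤ} {n : ℤ} {P : MvPolynomial σ K} (h : IsWeightedHomogeneous w P n) :
    LEw w n P := fun _ hm => (h hm).le

lemma LEw.wh_eq_zero {w : σ → ℤ} {n n' : ℤ} {P : MvPolynomial σ K}
    (h : IsWeightedHomogeneous w P n) (h' : LEw w n' P) (hn : n' < n) : P = 0 := by
  ext m
  by_contra hm
  rw [coeff_zero] at hm
  have := h hm
  have := h' m hm
  omega

lemma LEw.C_mul {w : σ → ℤ} {n : ℤ} {P : MvPolynomial σ K} (h : LEw w n P) (c : K) :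
    LEw w n (C c * P) := by
  simpa using (LEw.of_wh (isWeightedHomogeneous_C w c)).mul h

lemma LEw.pderiv {w : σ → ℤ} {n : ℤ} {P : MvPolynomial σ K} (h : LEw w n P) (i : σ) :
    LEw w (n - w i) (pderiv i P) := by
  classical
  intro m hm
  rw [coeff_pderiv] at hm
  have := h _ (left_ne_zero_of_mul hm)
  rw [map_add, Finsupp.weight_single] at this
  simp at this
  omega

lemma wh_pderiv {w : σ → ℤ} {n : ℤ} {P : MvPolynomial σ K}
    (h : IsWeightedHomogeneous w P n) (i : σ) :
    IsWeightedHomogeneous w (pderiv i P) (n - w i) := by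
  classical
  intro m hm
  rw [coeff_pderiv] at hm
  have := h (left_ne_zero_of_mul hm)
  rw [map_add, Finsupp.weight_single] at this
  simp at this
  omega

lemma wh_cast {w : σ → ℤ} {n n' : ℤ} {P : MvPolynomial σ K}
    (h : IsWeightedHomogeneous w P n) (e : n = n') : IsWeightedHomogeneous w P n' := e ▸ h

lemma Lead.cast {w : σ → ℤ} {n n' : ℤ} {P H : MvPolynomial σ K}
    (h : Lead w n P H) (e : n = n') : Lead w n' P H := e ▸ h

lemma Lead.le {w : σ → ℤ} {n : ℤ} {P H : MvPolynomial σ K} (h : Lead w n P H) : LEw w n P := by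
  have := (LEw.of_wh h.1).add (h.2.mono (by omega : n - 1 ≤ n))
  simpa using this

lemma Lead.add {w : σ → ℤ} {n : ℤ} {P H P' H' : MvPolynomial σ K} (h : Lead w n P H)
    (h' : Lead w n P' H') : Lead w n (P + P') (H + H') := by
  refine ⟨h.1.add h'.1, ?_⟩
  have := h.2.add h'.2
  convert this using 1; ring

lemma Lead.mul {w : σ → ℤ} {a b : ℤ} {P H P' H' : MvPolynomial σ K} (h : Lead w a P H)
    (h' : Lead w b P' H') : Lead w (a + b) (P * P') (H * H') := by
  refine ⟨h.1.mul h'.1, ?_⟩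
  have e : P * P' - H * H' = (P - H) * P' + H * (P' - H') := by ring
  rw [e]
  exact ((h.2.mul h'.le).mono (by omega)).add (((LEw.of_wh h.1).mul h'.2).mono (by omega))

lemma Lead.of_wh {w : σ → ℤ} {n : ℤ} {P : MvPolynomial σ K} (h : IsWeightedHomogeneous w P n) :
    Lead w n P P := ⟨h, by simpa using LEw.zero w _⟩

lemma Lead.of_lt {w : σ → ℤ} {n n' : ℤ} {P : MvPolynomial σ K} (h : LEw w n' P) (hn : n' < n) :
    Lead w n P 0 := ⟨isWeightedHomogeneous_zero _ _ _, by
      simpa using h.mono (by omega)⟩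

lemma Lead.sum {ι : Type*} {w : σ → ℤ} {n : ℤ} {s : Finset ι} {P H : ι → MvPolynomial σ K}
    (h : ∀ i ∈ s, Lead w n (P i) (H i)) : Lead w n (∑ i ∈ s, P i) (∑ i ∈ s, H i) := by
  classical
  induction s using Finset.induction_on with
  | empty => simpa using Lead.of_wh (isWeightedHomogeneous_zero K w n)
  | insert a s ha ih =>
    rw [Finset.sum_insert ha, Finset.sum_insert ha]
    exact (h a (by simp)).add (ih fun i hi => h i (by simp [hi]))

lemma Lead.pow {w : σ → ℤ} {a : ℤ} {P H : MvPolynomial σ K} (h : Lead w a P H) (k : ℕ) :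
    Lead w (k • a) (P ^ k) (H ^ k) := by
  induction k with
  | zero => simpa using Lead.of_wh (isWeightedHomogeneous_one K w)
  | succ k ih =>
    rw [pow_succ, pow_succ, succ_nsmul]
    exact ih.mul h

lemma Lead.prod {ι : Type*} {w : σ → ℤ} {n : ι → ℤ} {s : Finset ι} {P H : ι → MvPolynomial σ K}
    (h : ∀ i ∈ s, Lead w (n i) (P i) (H i)) :
    Lead w (∑ i ∈ s, n i) (∏ i ∈ s, P i) (∏ i ∈ s, H i) := by
  classical
  induction s using Finset.induction_on with
  | empty => simpa using Lead.of_wh (isWeightedHomogeneous_one K w)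
  | insert a s ha ih =>
    rw [Finset.prod_insert ha, Finset.prod_insert ha, Finset.sum_insert ha]
    exact (h a (by simp)).mul (ih fun i hi => h i (by simp [hi]))

lemma Lead.pderiv {w : σ → ℤ} {n : ℤ} {P H : MvPolynomial σ K} (h : Lead w n P H) (i : σ) :
    Lead w (n - w i) (pderiv i P) (pderiv i H) := by
  refine ⟨wh_pderiv h.1 i, ?_⟩
  rw [← map_sub]
  exact (h.2.pderiv i).mono (by omega)

lemma Lead.unique {w : σ → ℤ} {n : ℤ} {P H H' : MvPolynomial σ K} (h : Lead w n P H)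
    (h' : Lead w n P H') : H = H' := by
  have h1 : LEw w (n - 1) (H - H') := by
    have := h'.2.sub h.2
    convert this using 1; ring
  exact sub_eq_zero.1 (LEw.wh_eq_zero (h.1.sub h'.1) h1 (by omega))

lemma LEw.exists_lead {w : σ → ℤ} {n : ℤ} {P : MvPolynomial σ K} (h : LEw w n P) :
    ∃ H, Lead w n P H := by
  classical
  refine ⟨weightedHomogeneousComponent w n P, weightedHomogeneousComponent_isWeightedHomogeneous
    _ _, ?_⟩
  intro m hm
  rw [coeff_sub, coeff_weightedHomogeneousComponent] at hm
  split_ifs at hm with h1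
  · simp at hm
  · have := h m (by simpa using hm)
    omega

lemma LEw.lead_zero {w : σ → ℤ} {n : ℤ} {P : MvPolynomial σ K} (h : Lead w n P 0) :
    LEw w (n - 1) P := by simpa using h.2

lemma lead_monomial {w : σ → ℤ} {w' : τ → ℤ} {f g : σ → MvPolynomial τ K}
    (hf : ∀ i, Lead w' (w i) (f i) (g i)) (m : σ →₀ ℕ) (c : K) :
    Lead w' (Finsupp.weight w m) (aeval f (monomial m c)) (aeval g (monomial m c)) := by
  rw [aeval_monomial, aeval_monomial]
  have h1 : Lead w' (Finsupp.weight w m) (m.prod fun i k => f i ^ k)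
      (m.prod fun i k => g i ^ k) := by
    rw [Finsupp.weight_apply]
    exact Lead.prod fun i _ => (hf i).pow _
  have := (Lead.of_wh (isWeightedHomogeneous_C w' c)).mul h1
  simpa [algebraMap_eq] using this

lemma Lead.aeval_wh {w : σ → ℤ} {w' : τ → ℤ} {f g : σ → MvPolynomial τ K}
    (hf : ∀ i, Lead w' (w i) (f i) (g i)) {n : ℤ} {P : MvPolynomial σ K}
    (hP : IsWeightedHomogeneous w P n) : Lead w' n (aeval f P) (aeval g P) := by
  rw [P.as_sum, map_sum, map_sum]
  refine Lead.sum fun m hm => ?_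
  have := lead_monomial hf m (coeff m P)
  rwa [hP (mem_support_iff.1 hm)] at this

lemma LEw.aeval {w : σ → ℤ} {w' : τ → ℤ} {f g : σ → MvPolynomial τ K}
    (hf : ∀ i, Lead w' (w i) (f i) (g i)) {n : ℤ} {P : MvPolynomial σ K}
    (hP : LEw w n P) : LEw w' n (aeval f P) := by
  rw [P.as_sum, map_sum]
  refine LEw.sum fun m hm => ?_
  exact (lead_monomial hf m (coeff m P)).le.mono (hP m (mem_support_iff.1 hm))

lemma Lead.aeval {w : σ → ℤ} {w' : τ → ℤ} {f g : σ → MvPolynomial τ K}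
    (hf : ∀ i, Lead w' (w i) (f i) (g i)) {n : ℤ} {P H : MvPolynomial σ K}
    (hP : Lead w n P H) : Lead w' n (aeval f P) (aeval g H) := by
  have h1 := Lead.aeval_wh hf hP.1
  have h2 := LEw.aeval hf hP.2
  rw [map_sub] at h2
  refine ⟨h1.1, ?_⟩
  have := h2.add h1.2
  simpa using this

lemma wh_aeval {w : σ → ℤ} {w' : τ → ℤ} {g : σ → MvPolynomial τ K}
    (hf : ∀ i, IsWeightedHomogeneous w' (g i) (w i)) {n : ℤ} {P : MvPolynomial σ K}
    (hP : IsWeightedHomogeneous w P n) : IsWeightedHomogeneous w' (aeval g P) n :=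
  (Lead.aeval_wh (fun i => Lead.of_wh (hf i)) hP).1

lemma exists_lead_ne_zero (w : σ → ℤ) {P : MvPolynomial σ K} (hP : P ≠ 0) :
    ∃ n H, H ≠ 0 ∧ Lead w n P H := by
  classical
  have hne : P.support.Nonempty := by simpa [Finset.nonempty_iff_ne_empty] using hP
  obtain ⟨m, hm, hmax⟩ := P.support.exists_max_image (fun m => Finsupp.weight w m) hne
  have hle : LEw w (Finsupp.weight w m) P := fun m' hm' => hmax m' (mem_support_iff.2 hm')
  obtain ⟨H, hH⟩ := hle.exists_lead
  refine ⟨_, H, ?_, hH⟩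
  rintro rfl
  have := (LEw.lead_zero hH) m (mem_support_iff.1 hm)
  omega

lemma weight_nonneg' {w : σ → ℤ} (hw : ∀ i, 0 < w i) (m : σ →₀ ℕ) : 0 ≤ Finsupp.weight w m := by
  rw [Finsupp.weight_apply]
  exact Finset.sum_nonneg fun i _ => nsmul_nonneg (hw i).le _

lemma weight_ge {w : σ → ℤ} (hw : ∀ i, 0 < w i) (m : σ →₀ ℕ) (i : σ) :
    (m i : ℤ) * w i ≤ Finsupp.weight w m := by
  classical
  rw [Finsupp.weight_apply]
  by_cases hi : i ∈ m.support
  · have := Finset.single_le_sum (f := fun i => (m i) • w i) (s := m.support)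
      (fun i _ => nsmul_nonneg (hw i).le _) hi
    simpa [Finsupp.sum] using this
  · have : m i = 0 := by simpa using hi
    rw [this]; simp
    exact Finset.sum_nonneg fun i _ => nsmul_nonneg (hw i).le _

lemma LEw.eq_zero {w : σ → ℤ} (hw : ∀ i, 0 < w i) {n : ℤ} (hn : n < 0) {P : MvPolynomial σ K}
    (h : LEw w n P) : P = 0 := by
  ext m
  by_contra hm
  have := h m (by simpa using hm)
  have := weight_nonneg' hw m
  omega

lemma LEw.eq_C {w : σ → ℤ} (hw : ∀ i, 0 < w i) {P : MvPolynomial σ K}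
    (h : LEw w 0 P) : P = C (coeff 0 P) := by
  classical
  ext m
  rw [coeff_C]
  split_ifs with h0
  · rw [h0]
  · by_contra hm
    have h1 := h m hm
    apply h0
    ext i
    have h2 := weight_ge hw m i
    have := hw i
    simp
    by_contra h3
    have : (1 : ℤ) ≤ m i := by omega
    nlinarith

lemma wh_of_mul {w : σ → ℤ} {A B : MvPolynomial σ K} {a n : ℤ} (hA : IsWeightedHomogeneous w A a)
    (hA0 : A ≠ 0) (h : IsWeightedHomogeneous w (A * B) n) : IsWeightedHomogeneous w B (n - a) := by
  classical
  let _ := weightedGradedAlgebra K w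
  have h1 := DirectSum.coe_decompose_mul_add_of_left_mem (weightedHomogeneousSubmodule K w)
    (j := n - a) (b := B) hA
  rw [show a + (n - a) = n by ring, DirectSum.decompose_of_mem_same _ h] at h1
  have h2 := mul_left_cancel₀ hA0 h1
  rw [h2]
  exact (DirectSum.decompose (weightedHomogeneousSubmodule K w) B (n - a)).2

end Filt


section Exp

variable {K : Type*} [Field K] [CharZero K] {σ : Type*}

/-- The exponential of a locally nilpotent derivation. -/
lemma exists_exp (δ : Derivation K (MvPolynomial σ K) (MvPolynomial σ K))
    (hN : ∀ j, ∃ N : ℕ, δ^[N] (X j) = 0) :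
    ∃ E : MvPolynomial σ K →ₐ[K] Polynomial (MvPolynomial σ K),
      (∀ P, (E P).coeff 0 = P) ∧
      (∀ (P : MvPolynomial σ K) (i : ℕ), ((i : MvPolynomial σ K) + 1) * (E P).coeff (i + 1) = δ ((E P).coeff i)) := by
  choose N hN using hN
  have hN' : ∀ j i, N j ≤ i → δ^[i] (X j) = 0 := by
    intro j i hi
    obtain ⟨k, rfl⟩ := Nat.exists_eq_add_of_le hi
    rw [add_comm, Function.iterate_add_apply, hN]
    exact iterate_map_zero δ k
  let e : σ → Polynomial (MvPolynomial σ K) := fun j =>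
    ∑ i ∈ Finset.range (N j), Polynomial.monomial i (C ((i.factorial : K)⁻¹) * δ^[i] (X j))
  have he : ∀ j i, (e j).coeff i = C ((i.factorial : K)⁻¹) * δ^[i] (X j) := by
    intro j i
    simp only [e, Polynomial.finsetSum_coeff, Polynomial.coeff_monomial]
    simp only [Finset.sum_ite_eq', Finset.mem_range]
    split_ifs with h
    · rfl
    · rw [hN' j i (by omega)]; simp
  let _ : Differential (MvPolynomial σ K) := ⟨δ.restrictScalars ℤ⟩
  have hD : ∀ P : MvPolynomial σ K, Differential.deriv P = δ P := fun _ => rfl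
  have key : ∀ P : MvPolynomial σ K, Differential.mapCoeffs (aeval e P) =
      Polynomial.derivative (aeval e P) := by
    intro P
    induction P using MvPolynomial.induction_on with
    | C a =>
      rw [algHom_C]
      have : algebraMap K (Polynomial (MvPolynomial σ K)) a = Polynomial.C (C a) := rfl
      rw [this]
      ext1 i
      simp only [Differential.coeff_mapCoeffs, Polynomial.coeff_C, Polynomial.derivative_C]
      split_ifs
      · rw [hD]; simp
      · simp
    | add p q hp hq => simp only [map_add, hp, hq]
    | mul_X p j hp =>
      rw [map_mul, Derivation.leibniz, hp, aeval_X, Polynomial.derivative_mul]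
      have : Differential.mapCoeffs (e j) = Polynomial.derivative (e j) := by
        ext1 i
        rw [Differential.coeff_mapCoeffs, Polynomial.coeff_derivative, he, he, hD,
          ← smul_eq_C_mul, Derivation.map_smul, smul_eq_C_mul, Function.iterate_succ_apply']
        have h1 : ((i.factorial : K)⁻¹) = (((i+1).factorial : K)⁻¹) * (i + 1) := by
          have : ((i.factorial : K)) ≠ 0 := by exact_mod_cast i.factorial_ne_zero
          have : (i : K) + 1 ≠ 0 := by exact_mod_cast (Nat.succ_ne_zero i)
          rw [Nat.factorial_succ]; push_cast; field_simp
        rw [h1]; simp; ring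
      rw [this, smul_eq_mul, smul_eq_mul]; ring
  refine ⟨aeval e, ?_, ?_⟩
  · intro P
    induction P using MvPolynomial.induction_on with
    | C a =>
      rw [algHom_C]
      have : algebraMap K (Polynomial (MvPolynomial σ K)) a = Polynomial.C (C a) := rfl
      rw [this]; simp
    | add p q hp hq => simp only [map_add, Polynomial.coeff_add, hp, hq]
    | mul_X p j hp =>
      rw [map_mul, Polynomial.mul_coeff_zero, hp, aeval_X, he]; simp
  · intro P i
    have := congrArg (fun p => Polynomial.coeff p i) (key P)
    simp only [Differential.coeff_mapCoeffs, Polynomial.coeff_derivative, hD] at this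
    rw [this]; ring

lemma exp_coeff {δ : Derivation K (MvPolynomial σ K) (MvPolynomial σ K)}
    {E : MvPolynomial σ K →ₐ[K] Polynomial (MvPolynomial σ K)}
    (h0 : ∀ P, (E P).coeff 0 = P)
    (h1 : ∀ (P : MvPolynomial σ K) (i : ℕ), ((i : MvPolynomial σ K) + 1) * (E P).coeff (i + 1) = δ ((E P).coeff i))
    (P : MvPolynomial σ K) (i : ℕ) :
    (i.factorial : MvPolynomial σ K) * (E P).coeff i = δ^[i] P := by
  induction i with
  | zero => simp [h0]
  | succ i ih =>
    rw [Function.iterate_succ_apply', ← ih, Nat.factorial_succ]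
    push_cast
    rw [mul_comm ((i : MvPolynomial σ K) + 1), mul_assoc, h1]
    simp

lemma natCast_ne' (n : ℕ) (h : n ≠ 0) : (n : MvPolynomial σ K) ≠ 0 := by
  exact_mod_cast h

lemma exp_deriv {δ : Derivation K (MvPolynomial σ K) (MvPolynomial σ K)}
    {E : MvPolynomial σ K →ₐ[K] Polynomial (MvPolynomial σ K)}
    (h0 : ∀ P, (E P).coeff 0 = P)
    (h1 : ∀ (P : MvPolynomial σ K) (i : ℕ), ((i : MvPolynomial σ K) + 1) * (E P).coeff (i + 1) = δ ((E P).coeff i))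
    (P : MvPolynomial σ K) : E (δ P) = Polynomial.derivative (E P) := by
  ext1 i
  apply mul_left_cancel₀ (natCast_ne' (K := K) (σ := σ) i.factorial i.factorial_ne_zero)
  rw [exp_coeff h0 h1, ← Function.iterate_succ_apply, ← exp_coeff h0 h1,
    Polynomial.coeff_derivative, Nat.factorial_succ]
  push_cast; ring

lemma lnd_eq_zero_of_dvd {δ : Derivation K (MvPolynomial σ K) (MvPolynomial σ K)}
    (hN : ∀ j, ∃ N : ℕ, δ^[N] (X j) = 0) {R : MvPolynomial σ K} (hR : R ∣ δ R) : δ R = 0 := by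
  obtain ⟨E, h0, h1⟩ := exists_exp δ hN
  have hinj : Function.Injective E := fun a b h => by rw [← h0 a, ← h0 b, h]
  by_contra hne
  obtain ⟨Q, hQ⟩ := hR
  have e1 := exp_deriv h0 h1 R
  have hd : Polynomial.derivative (E R) ≠ 0 := by
    rw [← e1]; intro h; exact hne (hinj (by simpa using h))
  rw [hQ, map_mul] at e1
  have hlt : (Polynomial.derivative (E R)).natDegree < (E R).natDegree := by
    apply Polynomial.natDegree_derivative_lt
    intro h
    apply hd
    rw [Polynomial.natDegree_eq_zero] at h
    obtain ⟨c, hc⟩ := h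
    rw [← hc]; simp
  rw [← e1] at hlt hd
  rw [Polynomial.natDegree_mul (left_ne_zero_of_mul hd) (right_ne_zero_of_mul hd)] at hlt
  omega

end Exp

set_option linter.unusedSectionVars false

section SetupSec

variable {K : Type*} [Field K] [CharZero K]

/-- The constant weight one. -/
def w1 : Fin 3 → ℤ := fun _ => 1

/-- The data extracted from the automorphism. -/
structure Setup (f g : Fin 3 → MvPolynomial (Fin 3) K) (w : Fin 3 → ℤ)
    (R : MvPolynomial (Fin 3) K) : Prop where
  bij : Function.Bijective (aeval f : MvPolynomial (Fin 3) K →ₐ[K] MvPolynomial (Fin 3) K)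
  lead : ∀ i, Lead w1 (w i) (f i) (g i)
  gne : ∀ i, g i ≠ 0
  pos : ∀ i, 0 < w i
  ker : ∀ P, aeval g P = 0 ↔ R ∣ P
  Rne : R ≠ 0

variable {f g : Fin 3 → MvPolynomial (Fin 3) K} {w : Fin 3 → ℤ} {R : MvPolynomial (Fin 3) K}

lemma Setup.prime (S : Setup f g w R) : Prime R := by
  refine ⟨S.Rne, ?_, ?_⟩
  · intro h
    have := (S.ker 1).2 h.dvd
    simp at this
  · intro a b h
    have := (S.ker _).2 h
    rw [map_mul, mul_eq_zero, S.ker, S.ker] at this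
    exact this

lemma w1_pos : ∀ i, 0 < w1 i := fun _ => by simp [w1]

lemma Setup.wh (S : Setup f g w R) : ∃ D, IsWeightedHomogeneous w R D ∧ 0 < D := by
  obtain ⟨n, H, hH0, hH⟩ := exists_lead_ne_zero w S.Rne
  have h1 := Lead.aeval (fun i => Lead.of_wh (S.lead i).1) hH
  rw [(S.ker R).2 dvd_rfl] at h1
  have h2 : aeval g H = 0 := h1.unique (Lead.of_wh (isWeightedHomogeneous_zero K w1 n))
  obtain ⟨Q, hQ⟩ := (S.ker H).1 h2
  have hQ0 : Q ≠ 0 := by rintro rfl; simp at hQ; exact hH0 hQ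
  obtain ⟨q, H', hH'0, hH'⟩ := exists_lead_ne_zero w hQ0
  have hq : q ≤ 0 := by
    by_contra hq
    push Not at hq
    have e1 := hH.mul hH'
    rw [← hQ] at e1
    have e2 : Lead w (n + q) H 0 := Lead.of_lt (LEw.of_wh hH.1) (by omega)
    exact mul_ne_zero hH0 hH'0 (e1.unique e2)
  have hQC := LEw.eq_C S.pos (hH'.le.mono hq)
  set c := coeff 0 Q
  have hc : c ≠ 0 := by intro h; rw [h] at hQC; simp at hQC; exact hQ0 hQC
  have hR : R = C c⁻¹ * H := by
    rw [hQ, hQC, mul_comm R, ← mul_assoc, ← C_mul, inv_mul_cancel₀ hc]; simp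
  have hW : IsWeightedHomogeneous w R n := by
    rw [hR]; simpa using (isWeightedHomogeneous_C w c⁻¹).mul hH.1
  refine ⟨n, hW, ?_⟩
  by_contra hn
  push Not at hn
  have hRC := LEw.eq_C S.pos ((LEw.of_wh hW).mono hn)
  apply S.prime.not_isUnit
  rw [hRC]
  apply IsUnit.map
  apply IsUnit.mk0
  intro h; rw [h] at hRC; simp at hRC; exact S.Rne hRC

lemma chain_rule {τ : Type*} (f : Fin 3 → MvPolynomial τ K) (P : MvPolynomial (Fin 3) K)
    (D : Derivation K (MvPolynomial τ K) (MvPolynomial τ K)) :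
    D (aeval f P) = ∑ j, D (f j) * aeval f (pderiv j P) := by
  induction P using MvPolynomial.induction_on with
  | C a => simp [algHom_C]
  | add p q hp hq => simp only [map_add, hp, hq, mul_add, Finset.sum_add_distrib]
  | mul_X p j hp =>
    rw [map_mul, Derivation.leibniz, hp, aeval_X]
    simp only [Derivation.leibniz, smul_eq_mul, map_add, map_mul, aeval_X, pderiv_X, mul_add,
      Finset.sum_add_distrib, Finset.mul_sum]
    congr 1
    · rw [Finset.sum_eq_single j]
      · simp; ring
      · intro b _ hb; simp [Pi.single_apply, hb.symm]
      · simp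
    · exact Finset.sum_congr rfl fun i _ => by ring

lemma LEw.det {w : Fin 3 → ℤ} {b : Fin 3 → ℤ} {M : Matrix (Fin 3) (Fin 3) (MvPolynomial (Fin 3) K)}
    (h : ∀ i j, LEw w (b j) (M i j)) : LEw w (∑ j, b j) M.det := by
  rw [Matrix.det_apply]
  refine LEw.sum fun s _ => ?_
  have : LEw w (∑ j, b j) (∏ i, M (s i) i) := by
    simp only [Fin.prod_univ_three, Fin.sum_univ_three]
    exact ((h _ _).mul (h _ _)).mul (h _ _)
  rcases Int.units_eq_one_or (Equiv.Perm.sign s) with hs | hs <;> rw [hs]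
  · simpa using this
  · simpa using this.neg

lemma Setup.cramer (S : Setup f g w R) {n : ℤ} {P : MvPolynomial (Fin 3) K}
    (h : LEw w1 n (aeval f P)) (k : Fin 3) :
    LEw w1 (n - w k + (w 0 + w 1 + w 2 - 3)) (aeval f (pderiv k P)) := by
  let J : Matrix (Fin 3) (Fin 3) (MvPolynomial (Fin 3) K) := fun i j => pderiv i (f j)
  have hch : ∀ Q : MvPolynomial (Fin 3) K, (fun i => pderiv i (aeval f Q)) = J.mulVec (fun j => aeval f (pderiv j Q)) := by
    intro Q; funext i
    rw [chain_rule]; rfl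
  have hdet : IsUnit J.det := by
    choose P hP using S.bij.2
    let M : Matrix (Fin 3) (Fin 3) (MvPolynomial (Fin 3) K) :=
      fun j k => aeval f (pderiv j (P (X k)))
    have hJM : J * M = 1 := by
      ext1 i k
      have := congrFun (hch (P (X k))) i
      rw [hP, pderiv_X] at this
      rw [Matrix.mul_apply]
      rw [Matrix.one_apply]
      simp only [Matrix.mulVec, dotProduct] at this
      rw [← this, Pi.single_apply]
      simp [eq_comm]
    have := congrArg Matrix.det hJM
    rw [Matrix.det_mul, Matrix.det_one] at this
    exact IsUnit.of_mul_eq_one _ this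
  obtain ⟨u, hu⟩ := hdet
  have hc : J.det * aeval f (pderiv k P) =
      (J.updateCol k (fun i => pderiv i (aeval f P))).det := by
    rw [← Matrix.cramer_apply, Matrix.cramer_eq_adjugate_mulVec, hch, Matrix.mulVec_mulVec,
      Matrix.adjugate_mul, Matrix.smul_mulVec, Matrix.one_mulVec]
    rfl
  have hb : LEw w1 (∑ j, Function.update (fun j => w j - 1) k (n - 1) j)
      (J.updateCol k (fun i => pderiv i (aeval f P))).det := by
    apply LEw.det
    intro i j
    by_cases hj : j = k
    · subst hj; simpa [w1] using h.pderiv i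
    · rw [Matrix.updateCol_ne hj, Function.update_of_ne hj]
      exact (S.lead j).le.pderiv i
  have hsum : (∑ j, Function.update (fun j => w j - 1) k (n - 1) j) =
      n - w k + (w 0 + w 1 + w 2 - 3) := by
    rw [Fin.sum_univ_three]
    fin_cases k <;> simp [Function.update_apply] <;> ring
  rw [hsum, ← hc] at hb
  obtain ⟨c, hc0, hcc⟩ := MvPolynomial.isUnit_iff_eq_C_of_isReduced.1 ⟨u, hu⟩
  rw [hcc] at hb
  have := hb.C_mul c⁻¹
  rwa [← mul_assoc, ← C_mul, inv_mul_cancel₀ hc0.ne_zero, C_1, one_mul] at this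

lemma Setup.exists_pderiv (S : Setup f g w R) : ∃ k, ¬ R ∣ pderiv k R := by
  obtain ⟨D, hD, hpos⟩ := S.wh
  have : ∃ k, pderiv k R ≠ 0 := by
    by_contra hall
    push Not at hall
    have h0 : R ≠ 0 := S.Rne
    obtain ⟨m, hm⟩ := MvPolynomial.ne_zero_iff.1 h0
    have hw := hD hm
    have hm0 : m ≠ 0 := by rintro rfl; simp at hw; omega
    obtain ⟨k, hk⟩ := Finsupp.ne_iff.1 hm0
    have h1 := congrArg (coeff (m - Finsupp.single k 1)) (hall k)
    rw [coeff_pderiv, tsub_add_cancel_of_le] at h1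
    · simp only [coeff_zero, mul_eq_zero, hm, false_or] at h1
      norm_cast at h1
    · rw [Finsupp.single_le_iff]
      simp at hk; omega
  obtain ⟨k, hk⟩ := this
  refine ⟨k, ?_⟩
  rintro ⟨Q, hQ⟩
  have h1 := wh_pderiv hD k
  rw [hQ] at h1
  have h2 := wh_of_mul hD S.Rne h1
  have := LEw.eq_zero S.pos (n := -w k) (by have := S.pos k; omega) ((LEw.of_wh h2).mono (by omega))
  rw [this] at hQ; simp at hQ; exact hk hQ

lemma Setup.para (S : Setup f g w R) (m : ℕ) : ∀ {n n' : ℤ} {P Q : MvPolynomial (Fin 3) K},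
    Lead w n P (R ^ m * Q) → ¬ R ∣ Q → LEw w1 n' (aeval f P) →
      n ≤ n' + m * (w 0 + w 1 + w 2 - 3) := by
  obtain ⟨k, hk⟩ := S.exists_pderiv
  induction m with
  | zero =>
    intro n n' P Q h hQ hle
    rw [pow_zero, one_mul] at h
    have h1 := Lead.aeval S.lead h
    by_contra hlt
    push Not at hlt
    have h2 := h1.unique (Lead.of_lt hle (by push_cast at hlt; omega))
    exact hQ ((S.ker Q).1 h2)
  | succ m ih =>
    intro n n' P Q h hQ hle
    have h1 := h.pderiv k
    have e : pderiv k (R ^ (m + 1) * Q) =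
        R ^ m * (((m : MvPolynomial (Fin 3) K) + 1) * pderiv k R * Q + R * pderiv k Q) := by
      rw [Derivation.leibniz, Derivation.leibniz_pow]
      simp
      ring
    rw [e] at h1
    have h2 := ih h1 ?_ (S.cramer hle k)
    · push_cast; linarith
    · rw [dvd_add_left (dvd_mul_right _ _)]
      intro hd
      rcases S.prime.dvd_or_dvd hd with hd | hd
      · rcases S.prime.dvd_or_dvd hd with hd | hd
        · apply S.prime.not_isUnit
          apply isUnit_of_dvd_unit hd
          have : ((m : MvPolynomial (Fin 3) K) + 1) = C ((m : K) + 1) := by simp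
          rw [this]
          apply IsUnit.map
          apply IsUnit.mk0
          exact_mod_cast Nat.succ_ne_zero m
        · exact hk hd
      · exact hQ hd

lemma Setup.finmul (S : Setup f g w R) {H : MvPolynomial (Fin 3) K} (hH : H ≠ 0) :
    ∃ (m : ℕ) (Q : MvPolynomial (Fin 3) K), H = R ^ m * Q ∧ ¬ R ∣ Q := by
  have := FiniteMultiplicity.of_not_isUnit S.prime.not_isUnit hH
  obtain ⟨Q, h1, h2⟩ := this.exists_eq_pow_mul_and_not_dvd
  exact ⟨_, Q, h1, h2⟩

lemma noeth_inj {A : Type*} [CommRing A] [IsNoetherianRing A] (φ : A →+* A)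
    (hs : Function.Surjective φ) : Function.Injective φ := by
  rw [injective_iff_map_eq_zero]
  intro a ha
  have key : ∀ (n : ℕ) (x : A), x ∈ RingHom.ker (φ ^ n) ↔ φ^[n] x = 0 := by
    intro n x; rw [RingHom.mem_ker, RingHom.coe_pow]
  let F : ℕ →o Ideal A := ⟨fun n => RingHom.ker (φ ^ n), by
    apply monotone_nat_of_le_succ
    intro n x hx
    rw [key] at hx ⊢
    rw [Function.iterate_succ_apply', hx, map_zero]⟩
  obtain ⟨n, hn⟩ := (monotone_stabilizes_iff_noetherian (R := A) (M := A)).2 inferInstance F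
  have h1 : RingHom.ker (φ ^ n) = RingHom.ker (φ ^ (n + 1)) := hn (n + 1) (by omega)
  obtain ⟨b, hb⟩ := hs.iterate n a
  have : b ∈ RingHom.ker (φ ^ (n + 1)) := by
    rw [key, Function.iterate_succ_apply', hb, ha]
  rw [← h1, key, hb] at this
  exact this

/-- Step B: the degree bound. -/
lemma Setup.degree_lt (S : Setup f g w R) {D : ℤ} (hD : IsWeightedHomogeneous w R D) :
    D < w 0 + w 1 + w 2 := by
  by_contra hlt
  push Not at hlt
  have hsurj : ∀ i : Fin 3, ∃ H : MvPolynomial (Fin 3) K, aeval g H = X i := by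
    intro i
    obtain ⟨P, hP⟩ := S.bij.2 (X i)
    have hP0 : P ≠ 0 := by rintro rfl; simp at hP; exact X_ne_zero i hP.symm
    obtain ⟨n, H, hH0, hH⟩ := exists_lead_ne_zero w hP0
    obtain ⟨m, Q, rfl, hQ⟩ := S.finmul hH0
    have hX : IsWeightedHomogeneous w1 (X i : MvPolynomial (Fin 3) K) 1 :=
      isWeightedHomogeneous_X K w1 i
    have hle : LEw w1 1 (aeval f P) := by rw [hP]; exact LEw.of_wh hX
    have h1 := S.para m hH hQ hle
    have h2 : 0 ≤ n - m • D := by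
      by_contra hneg
      have := wh_of_mul (hD.pow m) (pow_ne_zero m S.Rne) hH.1
      have := LEw.eq_zero S.pos (by omega) (LEw.of_wh this)
      rw [this] at hQ; simp at hQ
    have hm : m = 0 := by
      by_contra hm
      have : (1 : ℤ) ≤ m := by omega
      rw [nsmul_eq_mul] at h2
      nlinarith
    subst hm
    obtain ⟨H', hH'⟩ := (hH.le.mono (by simpa using h1)).exists_lead
    have h3 := Lead.aeval S.lead hH'
    rw [hP] at h3
    exact ⟨H', h3.unique (Lead.of_wh hX)⟩
  choose H hH using hsurj
  have hs : Function.Surjective (aeval g : MvPolynomial (Fin 3) K →ₐ[K] MvPolynomial (Fin 3) K) := by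
    intro P
    refine ⟨aeval H P, ?_⟩
    have : ((aeval g).comp (aeval H) : MvPolynomial (Fin 3) K →ₐ[K] MvPolynomial (Fin 3) K)
        = AlgHom.id K _ := by
      ext1 i; rw [AlgHom.comp_apply, aeval_X, hH]; rfl
    exact DFunLike.congr_fun this P
  have hinj := noeth_inj (aeval g :
    MvPolynomial (Fin 3) K →ₐ[K] MvPolynomial (Fin 3) K).toRingHom hs
  apply S.Rne
  apply hinj
  have := (S.ker R).2 dvd_rfl
  simpa using this

end SetupSec

set_option linter.unusedSectionVars false

section LNDSec

variable {K : Type*} [Field K] [CharZero K]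

variable {f g : Fin 3 → MvPolynomial (Fin 3) K} {w : Fin 3 → ℤ} {R : MvPolynomial (Fin 3) K}

lemma exists_pderiv_ne {σ : Type*} {w : σ → ℤ} {P : MvPolynomial σ K} {D : ℤ}
    (hD : IsWeightedHomogeneous w P D) (hpos : D ≠ 0) (h0 : P ≠ 0) : ∃ k, pderiv k P ≠ 0 := by
  by_contra hall
  push Not at hall
  obtain ⟨m, hm⟩ := MvPolynomial.ne_zero_iff.1 h0
  have hw := hD hm
  have hm0 : m ≠ 0 := by rintro rfl; simp at hw; omega
  obtain ⟨k, hk⟩ := Finsupp.ne_iff.1 hm0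
  have h1 := congrArg (coeff (m - Finsupp.single k 1)) (hall k)
  rw [coeff_pderiv, tsub_add_cancel_of_le] at h1
  · simp only [coeff_zero, mul_eq_zero, hm, false_or] at h1
    norm_cast at h1
  · rw [Finsupp.single_le_iff]
    simp at hk; omega

lemma der_formula (D : Derivation K (MvPolynomial (Fin 3) K) (MvPolynomial (Fin 3) K))
    (P : MvPolynomial (Fin 3) K) : D P = ∑ j, D (X j) * pderiv j P := by
  have := chain_rule (K := K) (X : Fin 3 → MvPolynomial (Fin 3) K) P D
  simpa using this

lemma Setup.exists_lnd (S : Setup f g w R) :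
    ∃ (δ : Derivation K (MvPolynomial (Fin 3) K) (MvPolynomial (Fin 3) K)) (e : ℤ),
      (∀ j, IsWeightedHomogeneous w (δ (X j)) (w j + e)) ∧
      (∀ j, ∃ N : ℕ, δ^[N] (X j) = 0) ∧ R ∣ δ R ∧ ∃ j, ¬ R ∣ δ (X j) := by
  obtain ⟨i, hi⟩ := exists_pderiv_ne (S.lead 0).1 (S.pos 0).ne' (S.gne 0)
  obtain ⟨DR, hDR, hDR0⟩ := S.wh
  have hex : ∀ j, ∃ P : MvPolynomial (Fin 3) K, aeval f P = pderiv i (f j) := fun j => S.bij.2 _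
  choose q hq using hex
  let D : Derivation K (MvPolynomial (Fin 3) K) (MvPolynomial (Fin 3) K) := mkDerivation K q
  have hDX : ∀ j, D (X j) = q j := fun j => mkDerivation_X _ _ _
  have hαD : ∀ P : MvPolynomial (Fin 3) K, aeval f (D P) = pderiv i (aeval f P) := by
    intro P
    rw [chain_rule, der_formula]
    simp only [hDX, hq, map_sum, map_mul]
  have hnil : ∀ (n : ℕ) (P : MvPolynomial (Fin 3) K), LEw w1 n (aeval f P) → D^[n + 1] P = 0 := by
    intro n
    induction n with
    | zero =>
      intro P hP
      apply S.bij.1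
      rw [zero_add, Function.iterate_one, hαD, map_zero]
      exact LEw.eq_zero w1_pos (n := -1) (by omega) (by simpa [w1] using hP.pderiv i)
    | succ n ih =>
      intro P hP
      rw [Function.iterate_succ_apply]
      apply ih
      rw [hαD]
      exact (hP.pderiv i).mono (by simp [w1])
  have hLN : ∀ P : MvPolynomial (Fin 3) K, ∃ N : ℕ, D^[N] P = 0 := by
    intro P
    by_cases h0 : aeval f P = 0
    · exact ⟨0, S.bij.1 (by simpa using h0)⟩
    obtain ⟨n, H, _, hH⟩ := exists_lead_ne_zero w1 h0
    exact ⟨_, hnil n.toNat P (hH.le.mono (by omega))⟩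
  have hq0 : q 0 ≠ 0 := by
    intro h
    have h1 := hq 0
    rw [h, map_zero] at h1
    have h2 := (S.lead 0).pderiv i
    rw [← h1] at h2
    exact hi (h2.unique (Lead.of_wh (isWeightedHomogeneous_zero K w1 _)))
  have hbound : ∀ j, ∃ n : ℤ, LEw w n (q j) := by
    intro j
    by_cases h0 : q j = 0
    · exact ⟨0, by rw [h0]; exact LEw.zero _ _⟩
    obtain ⟨n, H, _, hH⟩ := exists_lead_ne_zero w h0
    exact ⟨n, hH.le⟩
  choose b hb using hbound
  obtain ⟨e, he, hmin⟩ := Int.exists_least_of_bdd (P := fun e => ∀ j, LEw w (w j + e) (q j))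
    ⟨-w 0, by
      intro z hz
      by_contra hlt
      exact hq0 (LEw.eq_zero S.pos (by omega) (hz 0))⟩
    ⟨|b 0| + |b 1| + |b 2|, by
      intro j
      refine (hb j).mono ?_
      have := S.pos j
      have h0 := abs_nonneg (b 0)
      have h1 := abs_nonneg (b 1)
      have h2 := abs_nonneg (b 2)
      have h3 := le_abs_self (b j)
      clear hb hq hDX hαD hnil hLN
      fin_cases j <;> simp only [Fin.zero_eta, Fin.mk_one, Fin.reduceFinMk] at * <;> linarith⟩
  have hex2 : ∀ j, ∃ H, Lead w (w j + e) (q j) H := fun j => (he j).exists_lead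
  choose H hH using hex2
  have hHne : ∃ j, H j ≠ 0 := by
    by_contra hall
    push Not at hall
    have := hmin (e - 1) (fun j => by
      have h1 := hH j
      rw [hall] at h1
      exact (LEw.lead_zero h1).mono (by omega))
    omega
  let δ : Derivation K (MvPolynomial (Fin 3) K) (MvPolynomial (Fin 3) K) := mkDerivation K H
  have hδX : ∀ j, δ (X j) = H j := fun j => mkDerivation_X _ _ _
  have hlead : ∀ {n : ℤ} {P Q : MvPolynomial (Fin 3) K}, Lead w n P Q →
      Lead w (n + e) (D P) (δ Q) := by
    intro n P Q h
    rw [der_formula D, der_formula δ]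
    refine Lead.sum fun j _ => ?_
    rw [hDX, hδX]
    exact ((hH j).mul (h.pderiv j)).cast (by ring)
  have hlead2 : ∀ (k : ℕ) {n : ℤ} {P Q : MvPolynomial (Fin 3) K}, Lead w n P Q →
      Lead w (n + k * e) (D^[k] P) (δ^[k] Q) := by
    intro k n P Q h
    induction k with
    | zero => simpa using h
    | succ k ih =>
      rw [Function.iterate_succ_apply', Function.iterate_succ_apply']
      exact (hlead ih).cast (by push_cast; ring)
  have hδLN : ∀ j, ∃ N : ℕ, δ^[N] (X j) = 0 := by
    intro j
    obtain ⟨N, hN⟩ := hLN (X j)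
    refine ⟨N, ?_⟩
    have h1 := hlead2 N (Lead.of_wh (isWeightedHomogeneous_X K w j))
    rw [hN] at h1
    exact h1.unique (Lead.of_wh (isWeightedHomogeneous_zero K w _))
  have hm : ∃ m : ℕ, (∀ j, R ^ m ∣ H j) ∧ ¬ ∀ j, R ^ (m + 1) ∣ H j := by
    by_contra hall
    push Not at hall
    have hall' : ∀ m : ℕ, ∀ j, R ^ m ∣ H j := by
      intro m
      induction m with
      | zero => intro j; simp
      | succ m ih => exact hall m ih
    obtain ⟨j, hj⟩ := hHne
    obtain ⟨n, hn⟩ := FiniteMultiplicity.of_not_isUnit S.prime.not_isUnit hj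
    exact hn (hall' _ j)
  obtain ⟨m, hm1, hm2⟩ := hm
  choose p hp using hm1
  push Not at hm2
  obtain ⟨j1, hj1⟩ := hm2
  have hpj1 : ¬ R ∣ p j1 := by
    rintro ⟨t, ht⟩
    apply hj1
    exact ⟨t, by rw [hp, ht]; ring⟩
  let δ' : Derivation K (MvPolynomial (Fin 3) K) (MvPolynomial (Fin 3) K) := mkDerivation K p
  have hδ'X : ∀ j, δ' (X j) = p j := fun j => mkDerivation_X _ _ _
  have hδδ' : ∀ P, δ P = R ^ m * δ' P := by
    intro P
    rw [der_formula δ, der_formula δ', Finset.mul_sum]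
    refine Finset.sum_congr rfl fun j _ => ?_
    rw [hδX, hδ'X, hp]; ring
  refine ⟨δ', e - m • DR, ?_, ?_, ?_, j1, by rwa [hδ'X]⟩
  · intro j
    rw [hδ'X]
    have h1 := (hH j).1
    rw [hp] at h1
    exact wh_cast (wh_of_mul (hDR.pow m) (pow_ne_zero m S.Rne) h1) (by ring)
  · rcases Nat.eq_zero_or_pos m with rfl | hmpos
    · have : ∀ P, δ' P = δ P := fun P => by rw [hδδ']; simp
      have : (δ' : MvPolynomial (Fin 3) K → MvPolynomial (Fin 3) K) = δ := funext this
      rw [this]; exact hδLN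
    · have hR0 : δ R = 0 := by
        apply lnd_eq_zero_of_dvd hδLN
        rw [hδδ']
        exact (dvd_pow_self R (by omega)).mul_right _
      have hit : ∀ (n : ℕ) P, δ^[n] P = R ^ (m * n) * δ'^[n] P := by
        intro n P
        induction n with
        | zero => simp
        | succ n ih =>
          rw [Function.iterate_succ_apply', Function.iterate_succ_apply', ih, Derivation.leibniz,
            Derivation.leibniz_pow, hR0, hδδ']
          simp; ring
      intro j
      obtain ⟨N, hN⟩ := hδLN j
      refine ⟨N, ?_⟩
      rw [hit] at hN
      exact (mul_eq_zero.1 hN).resolve_left (pow_ne_zero _ S.Rne)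
  · rcases Nat.eq_zero_or_pos m with rfl | hmpos
    · have hpH : ∀ j, p j = H j := fun j => by rw [hp]; simp
      have hl : ∀ j, Lead w1 (w j + e) (pderiv i (f j)) (aeval g (H j)) := by
        intro j
        have := Lead.aeval S.lead (hH j)
        rwa [hq] at this
      have hl' : ∀ j, Lead w1 (w j - 1) (pderiv i (f j)) (pderiv i (g j)) := fun j =>
        (S.lead j).pderiv i
      have he1 : e ≤ -1 := by
        by_contra hlt
        apply hpj1
        rw [hpH, ← S.ker]
        exact (hl j1).unique (Lead.of_lt (hl' j1).le (by omega))
      have he2 : -1 ≤ e := by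
        by_contra hlt
        apply hi
        exact (hl' 0).unique (Lead.of_lt (hl 0).le (by omega))
      have he3 : e = -1 := by omega
      have heq : ∀ j, aeval g (H j) = pderiv i (g j) := by
        intro j
        refine ((hl j).cast ?_).unique (hl' j)
        omega
      rw [← S.ker, der_formula δ', map_sum]
      have h2 := chain_rule g R (pderiv i)
      rw [(S.ker R).2 dvd_rfl, map_zero] at h2
      rw [h2]
      refine Finset.sum_congr rfl fun j _ => ?_
      rw [map_mul, hδ'X, hpH, heq]
    · have hR0 : δ R = 0 := by
        apply lnd_eq_zero_of_dvd hδLN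
        rw [hδδ']
        exact (dvd_pow_self R (by omega)).mul_right _
      rw [hδδ'] at hR0
      rw [(mul_eq_zero.1 hR0).resolve_left (pow_ne_zero _ S.Rne)]
      exact dvd_zero _

lemma Setup.exists_psi {K : Type*} [Field K] [CharZero K]
    {f g : Fin 3 → MvPolynomial (Fin 3) K} {w : Fin 3 → ℤ} {R : MvPolynomial (Fin 3) K}
    (S : Setup f g w R) (F : Type*) [Field F] [Algebra K F]
    (ι : MvPolynomial (Fin 3) K →ₐ[K] F) (hι : Function.Injective ι)
    (δ : Derivation K (MvPolynomial (Fin 3) K) (MvPolynomial (Fin 3) K))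
    (hN : ∀ j, ∃ N : ℕ, δ^[N] (X j) = 0) (hR : R ∣ δ R) (hj : ∃ j, ¬ R ∣ δ (X j)) :
    ∃ ψ : MvPolynomial (Fin 3) K →ₐ[K] Polynomial F, (∀ P, ψ P = 0 ↔ R ∣ P) ∧
      (∃ j, (ψ (X j)).natDegree ≠ 0) ∧ (∀ P, ψ (δ P) = Polynomial.derivative (ψ P)) := by
  obtain ⟨E, h0, h1⟩ := exists_exp δ hN
  let θ : MvPolynomial (Fin 3) K →ₐ[K] F := ι.comp (aeval g)
  have hθ : ∀ P, θ P = 0 ↔ R ∣ P := by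
    intro P
    rw [← S.ker, AlgHom.comp_apply, map_eq_zero_iff ι hι]
  let ψ : MvPolynomial (Fin 3) K →ₐ[K] Polynomial F := (Polynomial.mapAlgHom θ).comp E
  have hψ : ∀ P i, (ψ P).coeff i = θ ((E P).coeff i) := by
    intro P i
    simp [ψ]
  have hdd : ∀ P, R ∣ P → R ∣ δ P := by
    rintro P ⟨Q, rfl⟩
    rw [Derivation.leibniz, smul_eq_mul, smul_eq_mul]
    exact dvd_add (dvd_mul_right _ _) (hR.mul_left _)
  refine ⟨ψ, ?_, ?_, ?_⟩
  · intro P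
    constructor
    · intro h
      have := hψ P 0
      rw [h, h0, Polynomial.coeff_zero] at this
      exact (hθ P).1 this.symm
    · intro h
      ext i
      rw [hψ, Polynomial.coeff_zero, hθ]
      have h2 : ∀ i, R ∣ δ^[i] P := by
        intro i
        induction i with
        | zero => exact h
        | succ i ih => rw [Function.iterate_succ_apply']; exact hdd _ ih
      have h3 := h2 i
      rw [← exp_coeff h0 h1] at h3
      rcases S.prime.dvd_or_dvd h3 with h4 | h4
      · exfalso
        apply S.prime.not_isUnit
        apply isUnit_of_dvd_unit h4
        have : ((i.factorial : MvPolynomial (Fin 3) K)) = C (i.factorial : K) := by simp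
        rw [this]
        apply IsUnit.map
        apply IsUnit.mk0
        exact_mod_cast Nat.factorial_ne_zero i
      · exact h4
  · obtain ⟨j, hj⟩ := hj
    refine ⟨j, ?_⟩
    intro hd
    have h2 := hψ (X j) 1
    rw [Polynomial.coeff_eq_zero_of_natDegree_lt (by omega)] at h2
    have h3 := h1 (X j) 0
    simp only [Nat.cast_zero, zero_add, one_mul, h0] at h3
    rw [h3] at h2
    exact hj ((hθ _).1 h2.symm)
  · intro P
    ext1 i
    rw [hψ, exp_deriv h0 h1, Polynomial.coeff_derivative, Polynomial.coeff_derivative, hψ]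
    simp

end LNDSec

set_option linter.unusedSectionVars false

section MainG

universe u
variable {K : Type u} [Field K] [CharZero K]

variable {f g : Fin 3 → MvPolynomial (Fin 3) K} {w : Fin 3 → ℤ} {R : MvPolynomial (Fin 3) K}

lemma wh_der {δ : Derivation K (MvPolynomial (Fin 3) K) (MvPolynomial (Fin 3) K)} {e : ℤ}
    (hδ : ∀ j, IsWeightedHomogeneous w (δ (X j)) (w j + e)) {n : ℤ} {P : MvPolynomial (Fin 3) K}
    (hP : IsWeightedHomogeneous w P n) : IsWeightedHomogeneous w (δ P) (n + e) := by
  rw [der_formula]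
  refine IsWeightedHomogeneous.sum _ _ _ fun j _ => ?_
  exact wh_cast ((hδ j).mul (wh_pderiv hP j)) (by ring)

lemma natDegree_iter_der {F : Type*} [Field F] [CharZero F] {p : Polynomial F} (hp : p ≠ 0) :
    Polynomial.derivative^[p.natDegree] p =
      Polynomial.C ((p.natDegree.factorial : F) * p.leadingCoeff) := by
  ext i
  rw [Polynomial.coeff_iterate_derivative, Polynomial.coeff_C]
  split_ifs with h
  · subst h
    rw [zero_add, Nat.descFactorial_self, nsmul_eq_mul]; rfl
  · rw [Polynomial.coeff_eq_zero_of_natDegree_lt (by omega), smul_zero]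

lemma Setup.exists_G (S : Setup f g w R) {F : Type*} [Field F] [CharZero F] [Algebra K F]
    (δ : Derivation K (MvPolynomial (Fin 3) K) (MvPolynomial (Fin 3) K)) {e : ℤ}
    (hδ : ∀ j, IsWeightedHomogeneous w (δ (X j)) (w j + e))
    (ψ : MvPolynomial (Fin 3) K →ₐ[K] Polynomial F) (h0 : ∀ P, ψ P = 0 ↔ R ∣ P)
    (hd : ∀ P, ψ (δ P) = Polynomial.derivative (ψ P))
    (hnd : ∀ (a b : ℕ) (c : K), 1 ≤ a → 1 ≤ b → c ≠ 0 → ¬ R ∣ X 0 ^ a - C c * X 1 ^ b) :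
    ∃ (G : MvPolynomial (Fin 3) K) (n : ℤ), IsWeightedHomogeneous w G n ∧ 0 < n ∧
      ∃ c : F, c ≠ 0 ∧ ψ G = Polynomial.C c := by
  by_contra hcon
  have key : ∀ (P : MvPolynomial (Fin 3) K) (n : ℤ), IsWeightedHomogeneous w P n → ¬ R ∣ P →
      n + (ψ P).natDegree * e = 0 ∧ ∃ c : K, c ≠ 0 ∧ (ψ P).leadingCoeff = algebraMap K F c := by
    intro P n hP hR
    have hψP : ψ P ≠ 0 := by rwa [Ne, h0]
    have hit : ∀ k : ℕ, ψ (δ^[k] P) = Polynomial.derivative^[k] (ψ P) ∧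
        IsWeightedHomogeneous w (δ^[k] P) (n + k * e) := by
      intro k
      induction k with
      | zero => simpa using hP
      | succ k ih =>
        rw [Function.iterate_succ_apply', Function.iterate_succ_apply', hd, ih.1]
        exact ⟨rfl, wh_cast (wh_der hδ ih.2) (by push_cast; ring)⟩
    obtain ⟨h1, h2⟩ := hit (ψ P).natDegree
    rw [natDegree_iter_der hψP] at h1
    set k := (ψ P).natDegree
    have hne : (k.factorial : F) * (ψ P).leadingCoeff ≠ 0 := by
      apply mul_ne_zero
      · exact_mod_cast k.factorial_ne_zero
      · simpa using hψP
    have hGne : δ^[k] P ≠ 0 := by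
      intro h; rw [h, map_zero] at h1
      exact hne (by simpa using h1.symm)
    have hn : n + k * e = 0 := by
      rcases lt_trichotomy (n + k * e) 0 with hlt | heq | hgt
      · exact absurd (LEw.eq_zero S.pos hlt (LEw.of_wh h2)) hGne
      · exact heq
      · exact absurd ⟨_, _, h2, hgt, _, hne, h1⟩ hcon
    refine ⟨hn, ?_⟩
    rw [hn] at h2
    have hC := LEw.eq_C S.pos (LEw.of_wh h2)
    have hc0 : coeff 0 (δ^[k] P) ≠ 0 := by
      intro h; rw [h] at hC; simp at hC; exact hGne hC
    rw [hC, algHom_C] at h1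
    have h3 : algebraMap K F (coeff 0 (δ^[k] P)) = (k.factorial : F) * (ψ P).leadingCoeff :=
      Polynomial.C_injective h1
    have hk : (k.factorial : F) ≠ 0 := by exact_mod_cast k.factorial_ne_zero
    have hk' : (k.factorial : K) ≠ 0 := by exact_mod_cast k.factorial_ne_zero
    refine ⟨(k.factorial : K)⁻¹ * coeff 0 (δ^[k] P), mul_ne_zero (inv_ne_zero hk') hc0, ?_⟩
    rw [map_mul, h3, map_inv₀, map_natCast]
    field_simp
  have hX : ∀ j, ¬ R ∣ X j := by
    intro j h
    have := (S.ker _).2 h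
    rw [aeval_X] at this
    exact S.gne j this
  obtain ⟨a1, c0, hc0, hl0⟩ := key (X 0) (w 0) (isWeightedHomogeneous_X K w 0) (hX 0)
  obtain ⟨a2, c1, hc1, hl1⟩ := key (X 1) (w 1) (isWeightedHomogeneous_X K w 1) (hX 1)
  set k0 := (ψ (X 0)).natDegree with hk0
  set k1 := (ψ (X 1)).natDegree with hk1
  have hp0 := S.pos 0
  have hp1 := S.pos 1
  have h0pos : 1 ≤ k0 := by
    by_contra h; have : k0 = 0 := by omega
    rw [this] at a1; simp at a1; omega
  have h1pos : 1 ≤ k1 := by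
    by_contra h; have : k1 = 0 := by omega
    rw [this] at a2; simp at a2; omega
  set c : K := c0 ^ k1 / c1 ^ k0
  have hc : c ≠ 0 := by simp only [c]; positivity
  have hnd' := hnd k1 k0 c h1pos h0pos hc
  have hwh : IsWeightedHomogeneous w (X 0 ^ k1 - C c * X 1 ^ k0) (k1 * w 0) := by
    apply IsWeightedHomogeneous.sub
    · exact wh_cast ((isWeightedHomogeneous_X K w 0).pow k1) (by simp)
    · refine wh_cast ((isWeightedHomogeneous_C w c).mul ((isWeightedHomogeneous_X K w 1).pow k0)) ?_
      simp
      have e1 : w 0 = - (k0 * e) := by linarith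
      have e2 : w 1 = - (k1 * e) := by linarith
      rw [e1, e2]; ring
  obtain ⟨a3, -⟩ := key _ _ hwh hnd'
  have hne : ψ (X 0 ^ k1 - C c * X 1 ^ k0) ≠ 0 := by rwa [Ne, h0]
  have hdeg : (ψ (X 0 ^ k1 - C c * X 1 ^ k0)).natDegree = k0 * k1 := by
    have he : e ≠ 0 := by rintro rfl; simp at a1; omega
    have : ((ψ (X 0 ^ k1 - C c * X 1 ^ k0)).natDegree : ℤ) * e = (k0 * k1) * e := by
      have e1 : w 0 = - (k0 * e) := by linarith
      rw [e1] at a3; linarith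
    have := mul_right_cancel₀ he this
    exact_mod_cast this
  have hlc := Polynomial.leadingCoeff_ne_zero.2 hne
  rw [Polynomial.leadingCoeff, hdeg] at hlc
  apply hlc
  have hCC : ψ (C c) = Polynomial.C (algebraMap K F c) := by rw [algHom_C]; rfl
  rw [map_sub, map_mul, map_pow, map_pow, Polynomial.coeff_sub, hCC, Polynomial.coeff_C_mul]
  have e0 : ((ψ (X 0)) ^ k1).coeff (k0 * k1) = algebraMap K F c0 ^ k1 := by
    rw [← hl0, hk0, mul_comm, ← Polynomial.leadingCoeff_pow, Polynomial.leadingCoeff, Polynomial.natDegree_pow]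
  have e1 : ((ψ (X 1)) ^ k0).coeff (k0 * k1) = algebraMap K F c1 ^ k0 := by
    rw [← hl1, hk1, ← Polynomial.leadingCoeff_pow, Polynomial.leadingCoeff, Polynomial.natDegree_pow]
  rw [e0, e1]
  simp only [c, map_div₀, map_pow]
  have : algebraMap K F c1 ≠ 0 := by simpa using hc1
  field_simp
  ring

lemma Setup.main (S : Setup f g w R) :
    ∃ (F : Type u) (_ : Field F) (_ : IsAlgClosed F) (_ : CharZero F) (_ : Algebra K F)
      (ψ : MvPolynomial (Fin 3) K →ₐ[K] Polynomial F),
      (∀ P, ψ P = 0 ↔ R ∣ P) ∧ (∃ j, (ψ (X j)).natDegree ≠ 0) ∧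
      ((∀ (a b : ℕ) (c : K), 1 ≤ a → 1 ≤ b → c ≠ 0 → ¬ R ∣ X 0 ^ a - C c * X 1 ^ b) →
        ∃ (G : MvPolynomial (Fin 3) K) (n : ℤ), IsWeightedHomogeneous w G n ∧ 0 < n ∧
        ∃ c : F, c ≠ 0 ∧ ψ G = Polynomial.C c) := by
  obtain ⟨δ, e, h1, h2, h3, h4⟩ := S.exists_lnd
  let F := AlgebraicClosure (FractionRing (MvPolynomial (Fin 3) K))
  haveI : CharZero F := charZero_of_injective_algebraMap (algebraMap K F).injective
  let ι : MvPolynomial (Fin 3) K →ₐ[K] F := IsScalarTower.toAlgHom K (MvPolynomial (Fin 3) K) F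
  have hι : Function.Injective ι := by
    have e1 : Function.Injective (algebraMap (MvPolynomial (Fin 3) K)
      (FractionRing (MvPolynomial (Fin 3) K))) := IsFractionRing.injective _ _
    have e2 : Function.Injective (algebraMap (FractionRing (MvPolynomial (Fin 3) K)) F) :=
      (algebraMap (FractionRing (MvPolynomial (Fin 3) K)) F).injective
    have := e2.comp e1
    intro a b hab
    apply this
    exact hab
  obtain ⟨ψ, p1, p2, p3⟩ := S.exists_psi F ι hι δ h2 h3 h4
  exact ⟨F, inferInstance, inferInstance, inferInstance, inferInstance, ψ, p1, p2,
    S.exists_G δ h1 ψ p1 p3⟩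

end MainG

set_option linter.unusedSectionVars false

section FtSec

variable {F : Type*} [Field F] [CharZero F]

/-- Constant polynomials. -/
noncomputable def cS (F : Type*) [Field F] : Subring (Polynomial F) :=
  (Polynomial.C : F →+* Polynomial F).range

lemma mem_cS {p : Polynomial F} : p ∈ cS F ↔ p.natDegree = 0 := by
  rw [Polynomial.natDegree_eq_zero]; rfl

lemma cS_unit {p : Polynomial F} (h : IsUnit p) : p ∈ cS F :=
  mem_cS.2 (Polynomial.natDegree_eq_zero_of_isUnit h)

lemma cS_isUnit {p : Polynomial F} (h : p ∈ cS F) (h0 : p ≠ 0) : IsUnit p := by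
  obtain ⟨c, rfl⟩ := h
  apply IsUnit.map
  apply IsUnit.mk0
  rintro rfl; simp at h0

lemma cS_of_pow {p : Polynomial F} {n : ℕ} (hn : n ≠ 0) (h : p ^ n ∈ cS F) : p ∈ cS F := by
  rw [mem_cS, Polynomial.natDegree_pow] at h
  rw [mem_cS]
  exact (Nat.mul_eq_zero.1 h).resolve_left hn

lemma cS_of_unit_mul {u p : Polynomial F} (hu : IsUnit u) (h : u * p ∈ cS F) : p ∈ cS F := by
  obtain ⟨v, hv⟩ := hu.exists_left_inv
  have h1 : v ∈ cS F := cS_unit (IsUnit.of_mul_eq_one _ hv)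
  have := (cS F).mul_mem h1 h
  rwa [← mul_assoc, hv, one_mul] at this

lemma cS_der {p : Polynomial F} (h : p ∈ cS F) : Polynomial.derivative p = 0 := by
  obtain ⟨c, rfl⟩ := h; simp

lemma der_cS {p : Polynomial F} (h : Polynomial.derivative p = 0) : p ∈ cS F :=
  mem_cS.2 (Polynomial.natDegree_eq_zero_of_derivative_eq_zero h)

lemma cop_of {a b u v s : Polynomial F} (h : a * u + b * v = s) (hs : IsUnit s) : IsCoprime u v := by
  obtain ⟨t, ht⟩ := hs.exists_left_inv
  refine ⟨t * a, t * b, ?_⟩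
  rw [mul_assoc, mul_assoc, ← mul_add, h, ht]

lemma L1_aux {a b α β γ : Polynomial F} {m n : ℕ} (hm : 2 ≤ m) (hn : 2 ≤ n) (hα : IsUnit α)
    (hβ : IsUnit β) (hγ : IsUnit γ) (h : α * a ^ m + β * b ^ n = γ) : a ∈ cS F := by
  by_contra hc
  obtain ⟨m, rfl⟩ : ∃ k, m = k + 1 := ⟨m - 1, by omega⟩
  obtain ⟨n, rfl⟩ : ∃ k, n = k + 1 := ⟨n - 1, by omega⟩
  have hd := congrArg Polynomial.derivative h
  simp only [Polynomial.derivative_add, Polynomial.derivative_mul, cS_der (cS_unit hα),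
    cS_der (cS_unit hβ), cS_der (cS_unit hγ), zero_mul, zero_add,
    Polynomial.derivative_pow_succ] at hd
  have hcop : IsCoprime a b := by
    apply cop_of (a := α * a ^ m) (b := β * b ^ n) _ hγ
    rw [← h]; ring
  have ha' : Polynomial.derivative a ≠ 0 := fun h => hc (der_cS h)
  have ha0 : a ≠ 0 := by rintro rfl; simp at ha'
  have hkm : IsUnit (Polynomial.C ((m : F) + 1)) := by
    apply IsUnit.map; apply IsUnit.mk0; exact_mod_cast Nat.succ_ne_zero m
  have hkn : IsUnit (Polynomial.C ((n : F) + 1)) := by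
    apply IsUnit.map; apply IsUnit.mk0; exact_mod_cast Nat.succ_ne_zero n
  have e1 : (α * Polynomial.C ((m : F) + 1)) * (a ^ m * Polynomial.derivative a) =
      -((β * Polynomial.C ((n : F) + 1)) * (b ^ n * Polynomial.derivative b)) := by
    rw [eq_neg_iff_add_eq_zero]
    rw [← hd]; ring
  have hu1 := hα.mul hkm
  have hu2 := hβ.mul hkn
  have d1 : a ^ m ∣ Polynomial.derivative b := by
    apply (hcop.pow (m := m) (n := n)).dvd_of_dvd_mul_left
    rw [← hu2.dvd_mul_left, ← dvd_neg, ← e1]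
    exact (dvd_mul_right _ _).mul_left _
  have d2 : b ^ n ∣ Polynomial.derivative a := by
    apply (hcop.symm.pow (m := n) (n := m)).dvd_of_dvd_mul_left
    rw [← hu1.dvd_mul_left, e1, dvd_neg]
    exact (dvd_mul_right _ _).mul_left _
  have hb' : Polynomial.derivative b ≠ 0 := by
    intro h
    rw [h, mul_zero, mul_zero, neg_zero] at e1
    have := (mul_eq_zero.1 e1).resolve_left hu1.ne_zero
    exact (mul_ne_zero (pow_ne_zero _ ha0) ha') this
  have l1 := Polynomial.natDegree_le_of_dvd d1 hb'
  have l2 := Polynomial.natDegree_le_of_dvd d2 ha'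
  rw [Polynomial.natDegree_pow] at l1 l2
  have l3 := Polynomial.natDegree_derivative_lt (p := a) (fun h => hc (mem_cS.2 h))
  have l4 := Polynomial.natDegree_derivative_lt (p := b) (fun h => hb' (cS_der (mem_cS.2 h)))
  have l5 : a.natDegree ≤ m * a.natDegree := Nat.le_mul_of_pos_left _ (by omega)
  have l6 : b.natDegree ≤ n * b.natDegree := Nat.le_mul_of_pos_left _ (by omega)
  omega

lemma L1 {a b α β γ : Polynomial F} {m n : ℕ} (hm : 2 ≤ m) (hn : 2 ≤ n) (hα : IsUnit α)
    (hβ : IsUnit β) (hγ : IsUnit γ) (h : α * a ^ m + β * b ^ n = γ) : a ∈ cS F ∧ b ∈ cS F :=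
  ⟨L1_aux hm hn hα hβ hγ h, L1_aux hn hm hβ hα hγ (by rw [add_comm]; exact h)⟩

variable [IsAlgClosed F]

lemma unit_root {u : Polynomial F} (hu : IsUnit u) {n : ℕ} (hn : 0 < n) :
    ∃ v, IsUnit v ∧ v ^ n = u := by
  obtain ⟨c, hc, rfl⟩ := Polynomial.isUnit_iff.1 hu
  obtain ⟨z, hz⟩ := IsAlgClosed.exists_pow_nat_eq c hn
  refine ⟨Polynomial.C z, ?_, by rw [← Polynomial.C_pow, hz]⟩
  apply IsUnit.map
  apply IsUnit.mk0
  rintro rfl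
  rw [zero_pow hn.ne'] at hz
  exact hc.ne_zero hz.symm

lemma L2_aux {p q u s : Polynomial F} {n : ℕ} (hn : 0 < n) (hc : IsCoprime p q) (hu : IsUnit u)
    (h : p * q = u * s ^ n) : ∃ a, p = a ^ n := by
  obtain ⟨v, hv, rfl⟩ := unit_root hu hn
  rw [← mul_pow] at h
  obtain ⟨d, hd⟩ := exists_associated_pow_of_mul_eq_pow' hc h
  obtain ⟨t, ht⟩ := hd
  obtain ⟨r, _, hr⟩ := unit_root t.isUnit hn
  exact ⟨d * r, by rw [mul_pow, hr, ht]⟩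

lemma L2 {p q u s : Polynomial F} {n : ℕ} (hn : 0 < n) (hc : IsCoprime p q) (hu : IsUnit u)
    (h : p * q = u * s ^ n) : (∃ a, p = a ^ n) ∧ ∃ b, q = b ^ n :=
  ⟨L2_aux hn hc hu h, L2_aux hn hc.symm hu (by rw [mul_comm]; exact h)⟩

/-- End of E8. -/
lemma endE8 {x y z c1 c2 : Polynomial F} (h1 : IsUnit c1) (h2 : IsUnit c2)
    (h : z ^ 2 = c1 * y ^ 3 + c2 * x ^ 5)
    (hG : IsUnit z ∨ IsUnit x ∨ IsUnit y ∨ ∃ c, IsUnit c ∧ IsUnit (x ^ 5 - c * y ^ 3)) :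
    x ∈ cS F ∧ y ∈ cS F ∧ z ∈ cS F := by
  rcases hG with hz | hx | hy | ⟨c, hc, hw⟩
  · have := L1 (by norm_num) (by norm_num) h1 h2 (hz.pow 2) h.symm
    exact ⟨this.2, this.1, cS_unit hz⟩
  · have := L1 (a := z) (b := y) (m := 2) (n := 3) (by norm_num) (by norm_num) isUnit_one h1.neg
      (h2.mul (hx.pow 5)) (by rw [h]; ring)
    exact ⟨cS_unit hx, this.2, this.1⟩
  · have := L1 (a := z) (b := x) (m := 2) (n := 5) (by norm_num) (by norm_num) isUnit_one h2.neg
      (h1.mul (hy.pow 3)) (by rw [h]; ring)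
    exact ⟨this.2, cS_unit hy, this.1⟩
  · have := L1 (a := x) (b := y) (m := 5) (n := 3) (by norm_num) (by norm_num) isUnit_one hc.neg
      hw (by ring)
    refine ⟨this.1, this.2, cS_of_pow (n := 2) (by norm_num) ?_⟩
    rw [h]
    exact add_mem (mul_mem (cS_unit h1) (pow_mem this.2 _)) (mul_mem (cS_unit h2) (pow_mem this.1 _))

/-- End of E7. -/
lemma endE7 {x y z c1 c2 : Polynomial F} (h1 : IsUnit c1) (h2 : IsUnit c2)
    (h : z ^ 2 = y * (c1 * y ^ 2 + c2 * x ^ 3))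
    (hG : IsUnit z ∨ IsUnit x ∨ IsUnit y ∨ ∃ c, IsUnit c ∧ IsUnit (x ^ 3 - c * y ^ 2)) :
    x ∈ cS F ∧ y ∈ cS F ∧ z ∈ cS F := by
  have hz' : x ∈ cS F → y ∈ cS F → z ∈ cS F := by
    intro hx hy
    apply cS_of_pow (n := 2) (by norm_num)
    rw [h]
    exact mul_mem hy (add_mem (mul_mem (cS_unit h1) (pow_mem hy _))
      (mul_mem (cS_unit h2) (pow_mem hx _)))
  rcases hG with hz | hx | hy | ⟨c, hc, hw⟩
  · have hu := hz.pow 2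
    rw [h] at hu
    have hy := isUnit_of_mul_isUnit_left hu
    have hs := isUnit_of_mul_isUnit_right hu
    refine ⟨?_, cS_unit hy, cS_unit hz⟩
    apply cS_of_pow (n := 3) (by norm_num)
    apply cS_of_unit_mul h2
    have := sub_mem (cS_unit hs) (mul_mem (cS_unit h1) (pow_mem (cS_unit hy) 2))
    convert this using 1; ring
  · have hcop : IsCoprime y (c1 * y ^ 2 + c2 * x ^ 3) := by
      apply cop_of (a := -(c1 * y)) (b := 1) (s := c2 * x ^ 3) (by ring)
      exact h2.mul (hx.pow 3)
    obtain ⟨⟨a, ha⟩, ⟨b, hb⟩⟩ := L2 (n := 2) (by norm_num) hcop isUnit_one (by rw [one_mul]; exact h.symm)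
    have := L1 (a := b) (b := a) (m := 2) (n := 4) (by norm_num) (by norm_num) isUnit_one h1.neg
      (h2.mul (hx.pow 3)) (by rw [one_mul, ← hb, ha]; ring)
    have hy : y ∈ cS F := by rw [ha]; exact pow_mem this.2 _
    exact ⟨cS_unit hx, hy, hz' (cS_unit hx) hy⟩
  · have := L1 (a := z) (b := x) (m := 2) (n := 3) (by norm_num) (by norm_num) isUnit_one
      (h2.mul hy).neg (h1.mul (hy.pow 3)) (by rw [h]; ring)
    exact ⟨this.2, cS_unit hy, this.1⟩
  · have := L1 (a := x) (b := y) (m := 3) (n := 2) (by norm_num) (by norm_num) isUnit_one hc.neg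
      hw (by ring)
    exact ⟨this.1, this.2, hz' this.1 this.2⟩

/-- Common end of E6 and of the odd case of D. -/
lemma endSplit {a b y c1 c2 : Polynomial F} {N m : ℕ} (hN : 2 ≤ N) (hm : 2 ≤ m) (h1 : IsUnit c1)
    (h2 : IsUnit c2) (h : b ^ 2 = c1 * y ^ N + c2 * a ^ (2 * m))
    (hG : IsUnit y ∨ IsUnit a ∨ IsUnit b ∨ ∃ c, IsUnit c ∧ IsUnit (a ^ m - c * b)) :
    a ∈ cS F ∧ b ∈ cS F ∧ y ∈ cS F := by
  rcases hG with hy | ha | hb | ⟨c, hc, hw⟩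
  · have := L1 (a := b) (b := a) (m := 2) (n := 2 * m) (by norm_num) (by omega) isUnit_one
      h2.neg (h1.mul (hy.pow N)) (by rw [h]; ring)
    exact ⟨this.2, this.1, cS_unit hy⟩
  · have := L1 (a := b) (b := y) (m := 2) (n := N) (by norm_num) (by omega) isUnit_one
      h1.neg (h2.mul (ha.pow (2 * m))) (by rw [h]; ring)
    exact ⟨cS_unit ha, this.1, this.2⟩
  · have := L1 (a := y) (b := a) (m := N) (n := 2 * m) (by omega) (by omega) h1 h2 (hb.pow 2) h.symm
    exact ⟨this.2, cS_unit hb, this.1⟩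
  · obtain ⟨γ, hγ, hγ2⟩ := unit_root h2 (n := 2) (by norm_num)
    set s := a ^ m - c * b with hs
    set A := (1 - c * γ) * a ^ m - s with hA
    set B := (1 + c * γ) * a ^ m - s with hB
    have h2u : IsUnit (2 : Polynomial F) := by
      have : (2 : Polynomial F) = Polynomial.C 2 := rfl
      rw [this]; apply IsUnit.map; apply IsUnit.mk0; norm_num
    have hcop : IsCoprime A B := by
      apply cop_of (a := 1 + c * γ) (b := -(1 - c * γ)) (s := -(2 * c * γ * s))
      · rw [hA, hB]; ring
      · exact (((h2u.mul hc).mul hγ).mul hw).neg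
    have hprod : A * B = (c ^ 2 * c1) * y ^ N := by
      have e1 : c1 * y ^ N = b ^ 2 - γ ^ 2 * a ^ (2 * m) := by rw [h, hγ2]; ring
      rw [mul_assoc, e1, hA, hB, hs, mul_comm 2 m, pow_mul]; ring
    obtain ⟨⟨p, hp⟩, ⟨q, hq⟩⟩ := L2 (by omega) hcop ((hc.pow 2).mul h1) hprod
    have hcγ : c * γ ∈ cS F := mul_mem (cS_unit hc) (cS_unit hγ)
    have ha : a ∈ cS F := by
      by_cases h0 : 1 - c * γ = 0
      · have h3 : IsUnit (1 + c * γ) := by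
          have : 1 + c * γ = 2 := by linear_combination -h0
          rw [this]; exact h2u
        exact (L1 (a := a) (b := q) (m := m) (n := N) hm hN h3 isUnit_one.neg hw (by
          rw [neg_mul, one_mul, ← hq, hB]; ring)).1
      · have h3 : IsUnit (1 - c * γ) := cS_isUnit (sub_mem (one_mem _) hcγ) h0
        exact (L1 (a := a) (b := p) (m := m) (n := N) hm hN h3 isUnit_one.neg hw (by
          rw [neg_mul, one_mul, ← hp, hA]; ring)).1
    have hb : b ∈ cS F := by
      apply cS_of_unit_mul hc
      have := sub_mem (pow_mem ha m) (cS_unit hw)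
      convert this using 1; rw [hs]; ring
    refine ⟨ha, hb, ?_⟩
    apply cS_of_pow (n := N) (by omega)
    apply cS_of_unit_mul h1
    have := sub_mem (pow_mem hb 2) (mul_mem (cS_unit h2) (pow_mem ha (2 * m)))
    convert this using 1; rw [h]; ring

/-- End of the even case of D. -/
lemma endDeven {u v z c κ : Polynomial F} {e : ℕ} (he : 1 ≤ e) (hc : IsUnit c) (hκ : IsUnit κ)
    (h : z ^ 2 = c * u * v * (v + κ * u ^ e))
    (hG : IsUnit z ∨ IsUnit u ∨ IsUnit v ∨ ∃ c, IsUnit c ∧ IsUnit (u ^ e - c * v)) :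
    u ∈ cS F ∧ v ∈ cS F ∧ z ∈ cS F := by
  have hz' : u ∈ cS F → v ∈ cS F → z ∈ cS F := by
    intro hx hy
    apply cS_of_pow (n := 2) (by norm_num)
    rw [h]
    exact mul_mem (mul_mem (mul_mem (cS_unit hc) hx) hy)
      (add_mem hy (mul_mem (cS_unit hκ) (pow_mem hx _)))
  obtain ⟨e', rfl⟩ : ∃ k, e = k + 1 := ⟨e - 1, by omega⟩
  rcases hG with hz | hu | hv | ⟨c', hc', hw⟩
  · have hh := hz.pow 2
    rw [h] at hh
    have h1 := isUnit_of_mul_isUnit_left hh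
    have hv := isUnit_of_mul_isUnit_right h1
    have hu := isUnit_of_mul_isUnit_right (isUnit_of_mul_isUnit_left h1)
    exact ⟨cS_unit hu, cS_unit hv, cS_unit hz⟩
  · have hcop : IsCoprime v (v + κ * u ^ (e' + 1)) := by
      apply cop_of (a := -1) (b := 1) (s := κ * u ^ (e' + 1)) (by ring)
      exact hκ.mul (hu.pow _)
    obtain ⟨t, ht⟩ := (hc.mul hu).exists_left_inv
    obtain ⟨⟨a, ha⟩, ⟨b, hb⟩⟩ := L2 (n := 2) (s := z) (u := t) (by norm_num) hcop
      (IsUnit.of_mul_eq_one _ ht) (by rw [h]; linear_combination (-v * (v + κ * u ^ (e' + 1))) * ht)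
    have := L1 (a := b) (b := a) (m := 2) (n := 2) (by norm_num) (by norm_num) isUnit_one
      isUnit_one.neg (hκ.mul (hu.pow (e' + 1))) (by rw [one_mul, neg_mul, one_mul, ← hb, ← ha]; ring)
    have hv : v ∈ cS F := by rw [ha]; exact pow_mem this.2 _
    exact ⟨cS_unit hu, hv, hz' (cS_unit hu) hv⟩
  · have hcop : IsCoprime u (v + κ * u ^ (e' + 1)) := by
      apply cop_of (a := -(κ * u ^ e')) (b := 1) (s := v) (by ring)
      exact hv
    obtain ⟨t, ht⟩ := (hc.mul hv).exists_left_inv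
    obtain ⟨⟨a, ha⟩, ⟨b, hb⟩⟩ := L2 (n := 2) (s := z) (u := t) (by norm_num) hcop
      (IsUnit.of_mul_eq_one _ ht) (by rw [h]; linear_combination (-u * (v + κ * u ^ (e' + 1))) * ht)
    have := L1 (a := b) (b := a) (m := 2) (n := 2 * (e' + 1)) (by norm_num) (by omega) isUnit_one
      hκ.neg hv (by rw [one_mul, ← hb, pow_mul, ← ha]; ring)
    have hu : u ∈ cS F := by rw [ha]; exact pow_mem this.2 _
    exact ⟨hu, cS_unit hv, hz' hu (cS_unit hv)⟩
  · have hcop1 : IsCoprime u v :=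
      cop_of (a := u ^ e') (b := -c') (s := u ^ (e' + 1) - c' * v) (by ring) hw
    have hcop2 : IsCoprime u (v + κ * u ^ (e' + 1)) := by
      have : v + κ * u ^ (e' + 1) = v + u * (κ * u ^ e') := by ring
      rw [this]
      exact IsCoprime.add_mul_left_right hcop1 _
    have hcop3 : IsCoprime v (v + κ * u ^ (e' + 1)) := by
      have : v + κ * u ^ (e' + 1) = κ * u ^ (e' + 1) + v * 1 := by ring
      rw [this]
      apply IsCoprime.add_mul_left_right
      exact (isCoprime_mul_unit_left_right hκ _ _).2 hcop1.symm.pow_right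
    obtain ⟨t, ht⟩ := hc.exists_left_inv
    obtain ⟨⟨a, ha⟩, ⟨b, hb⟩⟩ := L2 (n := 2) (s := z) (u := t) (by norm_num)
      (hcop1.mul_right hcop2) (IsUnit.of_mul_eq_one _ ht)
      (by rw [h]; linear_combination (-u * v * (v + κ * u ^ (e' + 1))) * ht)
    obtain ⟨⟨a2, ha2⟩, -⟩ := L2 (n := 2) (s := b) (u := 1) (by norm_num) hcop3 isUnit_one
      (by rw [one_mul]; exact hb)
    have := L1 (a := a) (b := a2) (m := 2 * (e' + 1)) (n := 2) (by omega) (by omega) isUnit_one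
      hc'.neg hw (by rw [one_mul, pow_mul, ← ha, ← ha2]; ring)
    have hu : u ∈ cS F := by rw [ha]; exact pow_mem this.1 _
    have hv : v ∈ cS F := by rw [ha2]; exact pow_mem this.2 _
    exact ⟨hu, hv, hz' hu hv⟩

end FtSec

set_option linter.unusedSectionVars false

section BinSec

variable {K : Type*} [Field K] [IsAlgClosed K] [CharZero K]

lemma weight2 (w : Fin 2 → ℤ) (m : Fin 2 →₀ ℕ) : Finsupp.weight w m = m 0 * w 0 + m 1 * w 1 := by
  rw [Finsupp.weight_apply, Finsupp.sum_fintype _ _ (by simp)]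
  simp

lemma weight3 (w : Fin 3 → ℤ) (m : Fin 3 →₀ ℕ) :
    Finsupp.weight w m = m 0 * w 0 + m 1 * w 1 + m 2 * w 2 := by
  rw [Finsupp.weight_apply, Finsupp.sum_fintype _ _ (by simp), Fin.sum_univ_three]
  simp

lemma exists_of_not_X_dvd {σ : Type*} {P : MvPolynomial σ K} {i : σ} (h : ¬ X i ∣ P) :
    ∃ m, coeff m P ≠ 0 ∧ m i = 0 := by
  by_contra hall
  push Not at hall
  apply h
  rw [P.as_sum]
  refine Finset.dvd_sum fun m hm => ?_
  rw [X_dvd_monomial]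
  exact Or.inr (hall m (mem_support_iff.1 hm))

lemma mono2 (m : Fin 2 →₀ ℕ) (c : K) : monomial m c = C c * X 0 ^ m 0 * X 1 ^ m 1 := by
  rw [monomial_eq, Finsupp.prod_fintype _ _ (by simp)]
  simp [mul_assoc]

lemma mono3 (m : Fin 3 →₀ ℕ) (c : K) :
    monomial m c = C c * X 0 ^ m 0 * X 1 ^ m 1 * X 2 ^ m 2 := by
  rw [monomial_eq, Finsupp.prod_fintype _ _ (by simp), Fin.prod_univ_three]
  simp [mul_assoc]

lemma ext2 {m m' : Fin 2 →₀ ℕ} (h0 : m 0 = m' 0) (h1 : m 1 = m' 1) : m = m' := by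
  ext i; fin_cases i <;> assumption

lemma binDiv {w : Fin 2 → ℤ} (hw : ∀ i, 0 < w i) {p q : ℕ} (hpq : Nat.Coprime p q) (hp : 0 < p)
    (hq : 0 < q) (hpw : (p : ℤ) * w 0 = q * w 1) {Φ : MvPolynomial (Fin 2) K} {n : ℤ} (hn : 0 < n)
    (hΦ : IsWeightedHomogeneous w Φ n) :
    X 0 ∣ Φ ∨ X 1 ∣ Φ ∨ ∃ c : K, c ≠ 0 ∧ X 0 ^ p - C c * X 1 ^ q ∣ Φ := by
  by_cases hX0 : X 0 ∣ Φ
  · exact Or.inl hX0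
  by_cases hX1 : X 1 ∣ Φ
  · exact Or.inr (Or.inl hX1)
  refine Or.inr (Or.inr ?_)
  obtain ⟨a, ha, ha0⟩ := exists_of_not_X_dvd hX0
  obtain ⟨b, hb, hb1⟩ := exists_of_not_X_dvd hX1
  have hqd : (q : ℤ) ∣ w 0 := by
    have : IsCoprime (q : ℤ) p := by exact_mod_cast Nat.isCoprime_iff_coprime.2 hpq.symm
    exact this.dvd_of_dvd_mul_left ⟨w 1, hpw⟩
  obtain ⟨s, hs⟩ := hqd
  have hs1 : w 1 = p * s := by
    have hq' : (q : ℤ) ≠ 0 := by omega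
    apply mul_left_cancel₀ hq'
    rw [← hpw, hs]; ring
  have hspos : 0 < s := by
    have := hw 0; rw [hs] at this
    exact pos_of_mul_pos_right this (by omega)
  have hkey : ∀ m, coeff m Φ ≠ 0 → (m 0 * q + m 1 * p : ℤ) * s = n := by
    intro m hm
    have := hΦ hm
    rw [weight2, hs, hs1] at this
    rw [← this]; ring
  have hall : ∀ m, coeff m Φ ≠ 0 → m 0 * q + m 1 * p = a 1 * p := by
    intro m hm
    have h1 := hkey m hm
    have h2 := hkey a ha
    rw [← h2] at h1
    have := mul_right_cancel₀ hspos.ne' h1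
    rw [ha0] at this
    zify; simpa using this
  have hdp : ∀ m, coeff m Φ ≠ 0 → ∃ k, m 0 = p * k := by
    intro m hm
    have h1 := hall m hm
    have : p ∣ m 0 * q := by
      have h2 : p ∣ m 0 * q + m 1 * p := by rw [h1]; exact dvd_mul_left _ _
      exact (Nat.dvd_add_left (dvd_mul_left _ _)).1 h2
    exact hpq.dvd_of_dvd_mul_right this
  obtain ⟨M, hM⟩ := hdp b hb
  have hbq := hall b hb
  rw [hb1, hM] at hbq
  have ha1 : a 1 = q * M := by
    have : p * a 1 = p * (q * M) := by linarith
    exact Nat.eq_of_mul_eq_mul_left hp this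
  have hk : ∀ m, coeff m Φ ≠ 0 → ∃ k, k ≤ M ∧ m 0 = p * k ∧ m 1 = q * (M - k) := by
    intro m hm
    obtain ⟨k, hk⟩ := hdp m hm
    have h1 := hall m hm
    rw [hk, ha1] at h1
    have h2 : k * q + m 1 = q * M := by
      have : p * (k * q + m 1) = p * (q * M) := by linarith
      exact Nat.eq_of_mul_eq_mul_left hp this
    have hkM : k ≤ M := by
      have : q * k ≤ q * M := by linarith
      exact Nat.le_of_mul_le_mul_left this hq
    refine ⟨k, hkM, hk, ?_⟩
    rw [Nat.mul_sub]
    have := mul_comm k q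
    omega
  choose! κ hκ1 hκ2 hκ3 using hk
  let φ : Polynomial K := ∑ m ∈ Φ.support, Polynomial.monomial (κ m) (coeff m Φ)
  have hφc : ∀ m, coeff m Φ ≠ 0 → φ.coeff (κ m) = coeff m Φ := by
    intro m hm
    simp only [φ, Polynomial.finsetSum_coeff, Polynomial.coeff_monomial]
    rw [Finset.sum_eq_single m]
    · simp
    · intro m' hm' hne
      rw [if_neg]
      intro he
      apply hne
      have hm'' := mem_support_iff.1 hm'
      exact ext2 (by rw [hκ2 _ hm, hκ2 _ hm'', he]) (by rw [hκ3 _ hm, hκ3 _ hm'', he])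
    · intro h; simp [mem_support_iff] at h; simp [h]
  have hκa : κ a = 0 := by
    have := hκ2 a ha
    rw [ha0] at this
    exact (Nat.mul_eq_zero.1 this.symm).resolve_left hp.ne'
  have hκb : κ b = M := by
    have := hκ2 b hb
    rw [hM] at this
    exact (Nat.eq_of_mul_eq_mul_left hp this).symm
  have hMpos : M ≠ 0 := by
    rintro rfl
    have := hkey b hb
    rw [hb1, hM] at this
    simp at this; omega
  have hdeg : φ.degree ≠ 0 := by
    intro h
    have h1 := hφc b hb
    rw [hκb, Polynomial.coeff_eq_zero_of_degree_lt (by rw [h]; exact_mod_cast Nat.pos_of_ne_zero hMpos)] at h1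
    exact hb h1.symm
  obtain ⟨c, hc⟩ := IsAlgClosed.exists_root φ hdeg
  have hc0 : c ≠ 0 := by
    rintro rfl
    have h1 := hφc a ha
    rw [hκa, Polynomial.coeff_zero_eq_eval_zero, hc] at h1
    exact ha h1.symm
  refine ⟨c, hc0, ?_⟩
  have hev : ∑ m ∈ Φ.support, coeff m Φ * c ^ κ m = 0 := by
    have : φ.eval c = 0 := hc
    rw [Polynomial.eval_finsetSum] at this
    simpa using this
  have hsplit : Φ = ∑ m ∈ Φ.support, (monomial m (coeff m Φ) -
      C (coeff m Φ * c ^ κ m) * (X 1 ^ q) ^ M) := by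
    rw [Finset.sum_sub_distrib, ← Finset.sum_mul, ← map_sum, hev]
    simp only [map_zero, zero_mul, sub_zero]
    exact Φ.as_sum
  rw [hsplit]
  refine Finset.dvd_sum fun m hm => ?_
  have hm' := mem_support_iff.1 hm
  have e : monomial m (coeff m Φ) - C (coeff m Φ * c ^ κ m) * (X 1 ^ q) ^ M =
      ((X 0 ^ p) ^ κ m - (C c * X 1 ^ q) ^ κ m) * (C (coeff m Φ) * (X 1 ^ q) ^ (M - κ m)) := by
    rw [mono2, hκ2 m hm', hκ3 m hm', pow_mul, pow_mul]
    have : (X 1 ^ q : MvPolynomial (Fin 2) K) ^ M = (X 1 ^ q) ^ κ m * (X 1 ^ q) ^ (M - κ m) := by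
      rw [← pow_add]; congr 1; have := hκ1 m hm'; omega
    rw [this, mul_pow]
    simp only [map_mul, map_pow]
    ring
  rw [e]
  exact (sub_dvd_pow_sub_pow _ _ _).mul_right _

variable {F : Type*} [Field F] [CharZero F] [IsAlgClosed F] [Algebra K F]

lemma unit_C {c : K} (hc : c ≠ 0) : IsUnit (algebraMap K (Polynomial F) c) :=
  (IsUnit.mk0 c hc).map _

lemma elim {w : Fin 3 → ℤ} {v : Fin 2 → ℤ} (hv : ∀ i, 0 < v i) {p q : ℕ} (hpq : Nat.Coprime p q)
    (hp : 0 < p) (hq : 0 < q) (hpw : (p : ℤ) * v 0 = q * v 1) {N : ℕ}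
    {U0 U1 Q : MvPolynomial (Fin 2) K} (hU0 : IsWeightedHomogeneous v U0 (w 0))
    (hU1 : IsWeightedHomogeneous v U1 (w 1)) (hQ : IsWeightedHomogeneous v Q (N * w 2))
    {a b : Polynomial F} {T : Fin 3 → Polynomial F} (h0 : T 0 = aeval ![a, b] U0)
    (h1 : T 1 = aeval ![a, b] U1) (hs : T 2 ^ N = aeval ![a, b] Q)
    (hcong : ∀ i j k i' j' k' : ℕ, (i * w 0 + j * w 1 + k * w 2 : ℤ) = i' * w 0 + j' * w 1 + k' * w 2 →
      k % N = k' % N)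
    {G : MvPolynomial (Fin 3) K} {n : ℤ} (hG : IsWeightedHomogeneous w G n) (hn : 0 < n)
    (hu : IsUnit (aeval T G)) :
    IsUnit (T 2) ∨ IsUnit a ∨ IsUnit b ∨ ∃ c, IsUnit c ∧ IsUnit (a ^ p - c * b ^ q) := by
  have hG0 : G ≠ 0 := by rintro rfl; simp at hu
  obtain ⟨m0, hm0⟩ := MvPolynomial.ne_zero_iff.1 hG0
  set ε := m0 2 % N with hε
  have hall : ∀ m, coeff m G ≠ 0 → m 2 % N = ε := by
    intro m hm
    have e1 := hG hm
    have e2 := hG hm0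
    rw [weight3] at e1 e2
    exact hcong _ _ _ _ _ _ (e1.trans e2.symm)
  let Φ : MvPolynomial (Fin 2) K :=
    ∑ m ∈ G.support, C (coeff m G) * U0 ^ m 0 * U1 ^ m 1 * Q ^ (m 2 / N)
  have hΦ : IsWeightedHomogeneous v Φ (n - ε * w 2) := by
    refine IsWeightedHomogeneous.sum _ _ _ fun m hm => ?_
    have hm' := mem_support_iff.1 hm
    refine wh_cast ((((isWeightedHomogeneous_C v _).mul (hU0.pow _)).mul (hU1.pow _)).mul
      (hQ.pow _)) ?_
    have e1 := hG hm'
    rw [weight3] at e1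
    have e2 := Nat.div_add_mod (m 2) N
    rw [hall m hm'] at e2
    have e3 : (m 2 : ℤ) = N * (m 2 / N : ℕ) + ε := by exact_mod_cast e2.symm
    simp only [nsmul_eq_mul]
    rw [← e1, e3]; ring
  have hev : aeval T G = T 2 ^ ε * aeval ![a, b] Φ := by
    conv_lhs => rw [G.as_sum]
    simp only [Φ, map_sum, Finset.mul_sum]
    refine Finset.sum_congr rfl fun m hm => ?_
    have hm' := mem_support_iff.1 hm
    rw [mono3]
    simp only [map_mul, map_pow, aeval_X, algHom_C]
    rw [← h0, ← h1, ← hs, ← pow_mul]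
    have e2 := Nat.div_add_mod (m 2) N
    rw [hall m hm'] at e2
    have e4 : T 2 ^ m 2 = T 2 ^ ε * T 2 ^ (N * (m 2 / N)) := by
      rw [← pow_add, add_comm, e2]
    rw [e4]; ring
  rw [hev] at hu
  rcases Nat.eq_zero_or_pos ε with hz | hz
  · right
    rw [hz, pow_zero, one_mul] at hu
    rw [hz] at hΦ
    have hdv : ∀ P, P ∣ Φ → IsUnit (aeval ![a, b] P) := by
      rintro P ⟨Q', hQ'⟩
      rw [hQ', map_mul] at hu
      exact isUnit_of_mul_isUnit_left hu
    rcases binDiv hv hpq hp hq hpw hn (wh_cast hΦ (by simp)) with h | h | ⟨c, hc, h⟩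
    · left; simpa using hdv _ h
    · right; left; simpa using hdv _ h
    · right; right
      refine ⟨algebraMap K _ c, unit_C hc, ?_⟩
      simpa [algHom_C] using hdv _ h
  · left
    have := isUnit_of_mul_isUnit_left hu
    exact (isUnit_pow_iff hz.ne').1 this

end BinSec

set_option linter.unusedSectionVars false

section ExclSec

variable {K : Type*} [Field K] [IsAlgClosed K] [CharZero K]
variable {F : Type*} [Field F] [CharZero F] [IsAlgClosed F] [Algebra K F]

lemma algebraMap_cS (c : K) : algebraMap K (Polynomial F) c ∈ cS F := ⟨algebraMap K F c, rfl⟩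

lemma aeval_cS {σ : Type*} {T : σ → Polynomial F} (h : ∀ j, T j ∈ cS F) (P : MvPolynomial σ K) :
    aeval T P ∈ cS F := by
  induction P using MvPolynomial.induction_on with
  | C a => rw [algHom_C]; exact algebraMap_cS a
  | add p q hp hq => rw [map_add]; exact add_mem hp hq
  | mul_X p i hp => rw [map_mul, aeval_X]; exact mul_mem hp (h i)

lemma dvd_aeval {w : Fin 3 → ℤ} {T : Fin 3 → Polynomial F} {π : Polynomial F} (h : ∀ j, π ∣ T j)
    {G : MvPolynomial (Fin 3) K} {n : ℤ} (hG : IsWeightedHomogeneous w G n) (hn : 0 < n) :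
    π ∣ aeval T G := by
  rw [G.as_sum, map_sum]
  refine Finset.dvd_sum fun m hm => ?_
  have hw := hG (mem_support_iff.1 hm)
  have hm0 : m ≠ 0 := by rintro rfl; simp at hw; omega
  obtain ⟨k, hk⟩ := Finsupp.ne_iff.1 hm0
  rw [aeval_monomial]
  apply Dvd.dvd.mul_left
  rw [Finsupp.prod_fintype _ _ (by simp)]
  refine ((h k).trans (dvd_pow_self _ (by simpa using hk))).trans
    (Finset.dvd_prod_of_mem (fun i => T i ^ m i) (Finset.mem_univ k))

lemma wh_X {σ : Type*} {w : σ → ℤ} (i : σ) {n : ℤ} (h : w i = n) :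
    IsWeightedHomogeneous w (X i : MvPolynomial σ K) n := h ▸ isWeightedHomogeneous_X K w i

lemma wh_CX {σ : Type*} {w : σ → ℤ} (c : K) (i : σ) (k : ℕ) {n : ℤ} (h : k * w i = n) :
    IsWeightedHomogeneous w (C c * X i ^ k : MvPolynomial σ K) n :=
  wh_cast ((isWeightedHomogeneous_C w c).mul ((isWeightedHomogeneous_X K w i).pow k))
    (by simp [h])

lemma exclE8 {w : Fin 3 → ℤ} (hw : ∀ i, 0 < w i) {T : Fin 3 → Polynomial F} {c1 c2 : K}
    (hc1 : c1 ≠ 0) (hc2 : c2 ≠ 0)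
    (hT : T 2 ^ 2 = algebraMap K _ c1 * T 1 ^ 3 + algebraMap K _ c2 * T 0 ^ 5)
    (e1 : 2 * w 2 = 3 * w 1) (e2 : 2 * w 2 = 5 * w 0)
    {G : MvPolynomial (Fin 3) K} {n : ℤ} (hG : IsWeightedHomogeneous w G n) (hn : 0 < n)
    (hu : IsUnit (aeval T G)) : ∀ j, T j ∈ cS F := by
  obtain ⟨τ, hτ⟩ : ∃ τ, w 0 = 6 * τ := ⟨w 0 / 6, by omega⟩
  have hτ0 : 0 < τ := by have := hw 0; omega
  have hτ1 : w 1 = 10 * τ := by omega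
  have hτ2 : w 2 = 15 * τ := by omega
  have := elim (v := ![w 0, w 1]) (p := 5) (q := 3) (N := 2) (U0 := X 0) (U1 := X 1)
    (Q := C c1 * X 1 ^ 3 + C c2 * X 0 ^ 5) (a := T 0) (b := T 1) (T := T) (w := w)
    (by intro i; fin_cases i <;> exact hw _) (by norm_num) (by norm_num) (by norm_num)
    (by simp; omega) (wh_X _ rfl) (wh_X _ rfl)
    ((wh_CX _ _ _ (by simp; omega)).add (wh_CX _ _ _ (by simp; omega)))
    (by simp) (by simp) (by simp [hT, algHom_C]) (by
      intro i j k i' j' k' h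
      rw [hτ, hτ1, hτ2] at h
      have : (6 * i + 10 * j + 15 * k : ℤ) = 6 * i' + 10 * j' + 15 * k' := by
        apply mul_right_cancel₀ hτ0.ne'; linarith
      omega) hG hn hu
  obtain ⟨h0, h1, h2⟩ := endE8 (unit_C hc1) (unit_C hc2) hT this
  intro j; fin_cases j <;> assumption

lemma exclE7 {w : Fin 3 → ℤ} (hw : ∀ i, 0 < w i) {T : Fin 3 → Polynomial F} {c1 c2 : K}
    (hc1 : c1 ≠ 0) (hc2 : c2 ≠ 0)
    (hT : T 2 ^ 2 = T 1 * (algebraMap K _ c1 * T 1 ^ 2 + algebraMap K _ c2 * T 0 ^ 3))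
    (e1 : 2 * w 2 = 3 * w 1) (e2 : 2 * w 2 = w 1 + 3 * w 0)
    {G : MvPolynomial (Fin 3) K} {n : ℤ} (hG : IsWeightedHomogeneous w G n) (hn : 0 < n)
    (hu : IsUnit (aeval T G)) : ∀ j, T j ∈ cS F := by
  obtain ⟨τ, hτ⟩ : ∃ τ, w 0 = 4 * τ := ⟨w 0 / 4, by omega⟩
  have hτ0 : 0 < τ := by have := hw 0; omega
  have hτ1 : w 1 = 6 * τ := by omega
  have hτ2 : w 2 = 9 * τ := by omega
  have hQ : IsWeightedHomogeneous ![w 0, w 1]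
      (X 1 * (C c1 * X 1 ^ 2 + C c2 * X 0 ^ 3) : MvPolynomial (Fin 2) K) ((2 : ℕ) * w 2) :=
    wh_cast ((wh_X (w := ![w 0, w 1]) (n := w 1) _ rfl).mul
      ((wh_CX (w := ![w 0, w 1]) (n := 2 * w 1) _ _ _ (by simp)).add
        (wh_CX (w := ![w 0, w 1]) _ _ _ (by simp; omega)))) (by
        push_cast; omega)
  have := elim (v := ![w 0, w 1]) (p := 3) (q := 2) (N := 2) (U0 := X 0) (U1 := X 1)
    (Q := X 1 * (C c1 * X 1 ^ 2 + C c2 * X 0 ^ 3)) (a := T 0) (b := T 1) (T := T) (w := w)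
    (by intro i; fin_cases i <;> exact hw _) (by norm_num) (by norm_num) (by norm_num)
    (by simp; omega) (wh_X _ rfl) (wh_X _ rfl)
    hQ
    (by simp) (by simp) (by simp [hT, algHom_C]) (by
      intro i j k i' j' k' h
      rw [hτ, hτ1, hτ2] at h
      have : (4 * i + 6 * j + 9 * k : ℤ) = 4 * i' + 6 * j' + 9 * k' := by
        apply mul_right_cancel₀ hτ0.ne'; linarith
      omega) hG hn hu
  obtain ⟨h0, h1, h2⟩ := endE7 (unit_C hc1) (unit_C hc2) hT this
  intro j; fin_cases j <;> assumption

lemma swapG {w : Fin 3 → ℤ} {T : Fin 3 → Polynomial F} {G : MvPolynomial (Fin 3) K} {n : ℤ}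
    (hG : IsWeightedHomogeneous w G n) (hu : IsUnit (aeval T G)) :
    ∃ G' : MvPolynomial (Fin 3) K, IsWeightedHomogeneous ![w 0, w 2, w 1] G' n ∧
      IsUnit (aeval ![T 0, T 2, T 1] G') := by
  refine ⟨aeval ![X 0, X 2, X 1] G, wh_aeval (w := w) ?_ hG, ?_⟩
  · intro i; fin_cases i
    · exact wh_X 0 rfl
    · exact wh_X 2 rfl
    · exact wh_X 1 rfl
  · convert hu using 1
    have : ((aeval ![T 0, T 2, T 1]).comp (aeval ![X 0, X 2, X 1]) :
        MvPolynomial (Fin 3) K →ₐ[K] Polynomial F) = aeval T := by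
      ext1 i; fin_cases i <;> simp
    exact DFunLike.congr_fun this G

lemma exclE6 {w : Fin 3 → ℤ} (hw : ∀ i, 0 < w i) {T : Fin 3 → Polynomial F} {c1 c2 : K}
    (hc1 : c1 ≠ 0) (hc2 : c2 ≠ 0)
    (hT : T 2 ^ 2 = algebraMap K _ c1 * T 1 ^ 3 + algebraMap K _ c2 * T 0 ^ 4)
    (e1 : 2 * w 2 = 3 * w 1) (e2 : 2 * w 2 = 4 * w 0)
    {G : MvPolynomial (Fin 3) K} {n : ℤ} (hG : IsWeightedHomogeneous w G n) (hn : 0 < n)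
    (hu : IsUnit (aeval T G)) : ∀ j, T j ∈ cS F := by
  obtain ⟨τ, hτ⟩ : ∃ τ, w 0 = 3 * τ := ⟨w 0 / 3, by omega⟩
  have hτ0 : 0 < τ := by have := hw 0; omega
  have hτ1 : w 1 = 4 * τ := by omega
  have hτ2 : w 2 = 6 * τ := by omega
  obtain ⟨G', hG', hu'⟩ := swapG hG hu
  have := elim (w := ![w 0, w 2, w 1]) (T := ![T 0, T 2, T 1]) (v := ![w 0, w 2]) (p := 2) (q := 1) (N := 3) (U0 := X 0) (U1 := X 1)
    (Q := C c1⁻¹ * X 1 ^ 2 + C (-(c1⁻¹ * c2)) * X 0 ^ 4) (a := T 0) (b := T 2)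
    (by intro i; fin_cases i <;> exact hw _) (by norm_num) (by norm_num) (by norm_num)
    (by simp; omega) (wh_X _ rfl) (wh_X _ rfl)
    ((wh_CX _ _ _ (by simp; omega)).add (wh_CX _ _ _ (by simp; omega)))
    (by simp) (by simp) (by
      have hi : algebraMap K (Polynomial F) c1⁻¹ * algebraMap K (Polynomial F) c1 = 1 := by
        rw [← map_mul, inv_mul_cancel₀ hc1, map_one]
      simp only [Matrix.cons_val, map_add, map_mul, map_pow, algHom_C, aeval_X, hT, map_neg,
        Matrix.cons_val_zero, Matrix.cons_val_one]
      linear_combination (-T 1 ^ 3) * hi) (by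
      intro i j k i' j' k' h
      simp only [Matrix.cons_val, Matrix.cons_val_zero, Matrix.cons_val_one] at h
      rw [hτ, hτ1, hτ2] at h
      have : (3 * i + 6 * j + 4 * k : ℤ) = 3 * i' + 6 * j' + 4 * k' := by
        apply mul_right_cancel₀ hτ0.ne'; linarith
      omega) hG' hn hu'
  obtain ⟨h0, h1, h2⟩ := endSplit (a := T 0) (b := T 2) (y := T 1) (N := 3) (m := 2) (by norm_num)
    (by norm_num) (unit_C hc1) (unit_C hc2) hT (by simpa using this)
  intro j; fin_cases j <;> assumption

lemma exclDeven {w : Fin 3 → ℤ} (hw : ∀ i, 0 < w i) {T : Fin 3 → Polynomial F} {c κ : K} {e : ℕ}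
    (he : 1 ≤ e) (hc : c ≠ 0) (hκ : κ ≠ 0)
    (hT : T 2 ^ 2 = algebraMap K _ c * T 0 * T 1 * (T 1 + algebraMap K _ κ * T 0 ^ e))
    (e1 : w 1 = e * w 0) (e2 : 2 * w 2 = w 0 + 2 * w 1)
    {G : MvPolynomial (Fin 3) K} {n : ℤ} (hG : IsWeightedHomogeneous w G n) (hn : 0 < n)
    (hu : IsUnit (aeval T G)) : ∀ j, T j ∈ cS F := by
  obtain ⟨τ, hτ⟩ : ∃ τ, w 0 = 2 * τ := ⟨w 0 / 2, by omega⟩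
  have hτ0 : 0 < τ := by have := hw 0; omega
  have hτ1 : w 1 = 2 * e * τ := by rw [e1, hτ]; ring
  have hτ2 : w 2 = (2 * e + 1) * τ := by linarith
  have hQ : IsWeightedHomogeneous ![w 0, w 1]
      (C c * X 0 ^ 1 * X 1 * (X 1 + C κ * X 0 ^ e) : MvPolynomial (Fin 2) K) ((2 : ℕ) * w 2) :=
    wh_cast (((wh_CX (w := ![w 0, w 1]) (n := w 0) _ _ _ (by simp)).mul
      (wh_X (w := ![w 0, w 1]) (n := w 1) _ rfl)).mul
      ((wh_X (w := ![w 0, w 1]) (n := w 1) _ rfl).add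
        (wh_CX (w := ![w 0, w 1]) _ _ _ (by simp [e1])))) (by
        push_cast; linarith)
  have := elim (v := ![w 0, w 1]) (p := e) (q := 1) (N := 2) (U0 := X 0) (U1 := X 1)
    (Q := C c * X 0 ^ 1 * X 1 * (X 1 + C κ * X 0 ^ e)) (a := T 0) (b := T 1) (T := T) (w := w)
    (by intro i; fin_cases i <;> exact hw _) (by simp) (by omega) (by norm_num)
    (by simp [e1]) (wh_X _ rfl) (wh_X _ rfl)
    hQ
    (by simp) (by simp) (by simp [hT, algHom_C]) (by
      intro i j k i' j' k' h
      rw [hτ, hτ1, hτ2] at h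
      have : (2 * i + 2 * (e * j) + 2 * (e * k) + k : ℤ) =
          2 * i' + 2 * (e * j') + 2 * (e * k') + k' := by
        apply mul_right_cancel₀ hτ0.ne'; linarith
      norm_cast at this
      omega) hG hn hu
  obtain ⟨h0, h1, h2⟩ := endDeven he (unit_C hc) (unit_C hκ) hT (by simpa using this)
  intro j; fin_cases j <;> assumption

lemma exclDodd {w : Fin 3 → ℤ} (hw : ∀ i, 0 < w i) {T : Fin 3 → Polynomial F} {c1 c2 : K} {l : ℕ}
    (hl : 1 ≤ l) (hc1 : c1 ≠ 0) (hc2 : c2 ≠ 0)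
    (hT : T 2 ^ 2 = T 0 * (algebraMap K _ c1 * T 1 ^ 2 + algebraMap K _ c2 * T 0 ^ (2 * l + 1)))
    (e1 : 2 * w 1 = (2 * l + 1) * w 0) (e2 : 2 * w 2 = w 0 + 2 * w 1)
    {G : MvPolynomial (Fin 3) K} {n : ℤ} (hG : IsWeightedHomogeneous w G n) (hn : 0 < n)
    (hu : IsUnit (aeval T G)) : ∀ j, T j ∈ cS F := by
  have hev : 2 * w 1 = 2 * (l * w 0) + w 0 := by linarith
  obtain ⟨τ, hτ⟩ : ∃ τ, w 0 = 2 * τ := ⟨w 0 / 2, by omega⟩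
  have hτ0 : 0 < τ := by have := hw 0; omega
  have hτ1 : w 1 = (2 * l + 1) * τ := by rw [hτ] at e1; linarith
  have hτ2 : w 2 = (2 * l + 2) * τ := by linarith
  have hcop : IsCoprime (T 0) (T 1) := by
    by_contra hnc
    obtain ⟨π, hπ, h0, h1⟩ : ∃ π, Prime π ∧ π ∣ T 0 ∧ π ∣ T 1 := by
      by_contra hno
      push Not at hno
      apply hnc
      apply isCoprime_of_prime_dvd
      · rintro ⟨h0, h1⟩
        exact hno Polynomial.X Polynomial.prime_X (by simp [h0]) (by simp [h1])
      · intro z hz h0 h1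
        exact hno z hz h0 h1
    have h2 : π ∣ T 2 := by
      apply hπ.dvd_of_dvd_pow (n := 2)
      rw [hT]; exact h0.mul_right _
    exact hπ.not_isUnit (isUnit_of_dvd_unit (dvd_aeval (by
      intro j; fin_cases j <;> assumption) hG hn) hu)
  have hcop2 : IsCoprime (T 0) (algebraMap K _ c1 * T 1 ^ 2 + algebraMap K _ c2 * T 0 ^ (2 * l + 1)) := by
    have : algebraMap K _ c1 * T 1 ^ 2 + algebraMap K _ c2 * T 0 ^ (2 * l + 1) =
      algebraMap K _ c1 * T 1 ^ 2 + T 0 * (algebraMap K _ c2 * T 0 ^ (2 * l)) := by ring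
    rw [this]
    apply IsCoprime.add_mul_left_right
    exact (isCoprime_mul_unit_left_right (unit_C hc1) _ _).2 hcop.pow_right
  obtain ⟨⟨a, ha⟩, ⟨b0, hb0⟩⟩ := L2 (n := 2) (u := 1) (s := T 2) (by norm_num) hcop2 isUnit_one
    (by rw [one_mul]; exact hT.symm)
  obtain ⟨b, hb, hz⟩ : ∃ b, algebraMap K _ c1 * T 1 ^ 2 + algebraMap K _ c2 * T 0 ^ (2 * l + 1) = b ^ 2
      ∧ T 2 = a * b := by
    rw [hb0, ha, ← mul_pow] at hT
    rcases sq_eq_sq_iff_eq_or_eq_neg.1 hT with h | h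
    · exact ⟨b0, hb0, h⟩
    · exact ⟨-b0, by rw [hb0]; ring, by rw [h]; ring⟩
  obtain ⟨G', hG', hu'⟩ := swapG hG hu
  have hrel : b ^ 2 = algebraMap K _ c1 * T 1 ^ 2 + algebraMap K _ c2 * a ^ (2 * (2 * l + 1)) := by
    rw [← hb, ha]; ring
  have := elim (w := ![w 0, w 2, w 1]) (T := ![T 0, T 2, T 1]) (v := ![τ, w 1]) (p := 2 * l + 1) (q := 1) (N := 2) (U0 := X 0 ^ 2) (U1 := X 0 * X 1)
    (Q := C c1⁻¹ * X 1 ^ 2 + C (-(c1⁻¹ * c2)) * X 0 ^ (2 * (2 * l + 1))) (a := a) (b := b)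
    (by intro i; fin_cases i; exacts [hτ0, hw 1]) (by simp) (by omega) (by norm_num)
    (by simp [hτ1]) (wh_cast ((wh_X (w := ![τ, w 1]) (n := τ) _ rfl).pow 2) (by simp [hτ]))
    (wh_cast ((wh_X (w := ![τ, w 1]) (n := τ) _ rfl).mul (wh_X (w := ![τ, w 1]) (n := w 1) _ rfl)) (by simp [hτ1, hτ2]; ring))
    ((wh_CX _ _ _ (by simp)).add (wh_CX _ _ _ (by simp [hτ1]; ring)))
    (by simp [ha]) (by simp [hz]) (by
      have hi : algebraMap K (Polynomial F) c1⁻¹ * algebraMap K (Polynomial F) c1 = 1 := by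
        rw [← map_mul, inv_mul_cancel₀ hc1, map_one]
      simp only [Matrix.cons_val, map_add, map_mul, map_pow, algHom_C, aeval_X, hrel, map_neg,
        Matrix.cons_val_zero, Matrix.cons_val_one]
      linear_combination (-T 1 ^ 2) * hi) (by
      intro i j k i' j' k' h
      simp only [Matrix.cons_val, Matrix.cons_val_zero, Matrix.cons_val_one] at h
      rw [hτ, hτ1, hτ2] at h
      have : (2 * i + 2 * (l * j) + 2 * j + 2 * (l * k) + k : ℤ) =
          2 * i' + 2 * (l * j') + 2 * j' + 2 * (l * k') + k' := by
        apply mul_right_cancel₀ hτ0.ne'; linarith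
      norm_cast at this
      omega) hG' hn hu'
  obtain ⟨h0, h1, h2⟩ := endSplit (a := a) (b := b) (y := T 1) (N := 2) (m := 2 * l + 1) (by norm_num)
    (by omega) (unit_C hc1) (unit_C hc2) hrel (by simpa using this)
  intro j; fin_cases j
  · change T 0 ∈ _
    rw [ha]; exact pow_mem h0 _
  · exact h2
  · change T 2 ∈ _
    rw [hz]; exact mul_mem h0 h1

end ExclSec

set_option linter.unusedSectionVars false


section ChangeSec
variable {K : Type u} [Field K] [IsAlgClosed K] [CharZero K]

lemma Setup.core {f g : Fin 3 → MvPolynomial (Fin 3) K} {w : Fin 3 → ℤ} {R : MvPolynomial (Fin 3) K}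
    (S : Setup f g w R)
    (hb : ∀ (a b : ℕ) (c : K), 1 ≤ a → 1 ≤ b → c ≠ 0 → ¬ R ∣ X 0 ^ a - C c * X 1 ^ b)
    {Y Z : Fin 3 → MvPolynomial (Fin 3) K} (hYZ : ∀ j, aeval (R := K) Y (Z j) = X j)
    (hZ : ∀ j, IsWeightedHomogeneous w (Z j) (w j)) :
    ∃ (F : Type u) (_ : Field F) (_ : IsAlgClosed F) (_ : CharZero F) (_ : Algebra K F)
      (T : Fin 3 → Polynomial F) (G : MvPolynomial (Fin 3) K) (n : ℤ),
      (∀ P : MvPolynomial (Fin 3) K, R ∣ aeval Y P → aeval T P = 0) ∧ IsWeightedHomogeneous w G n ∧ 0 < n ∧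
      IsUnit (aeval T G) ∧ ¬ ∀ j, T j ∈ cS F := by
  obtain ⟨F, i1, i2, i3, i4, ψ, hψ, ⟨j, hj⟩, hG⟩ := S.main
  obtain ⟨G, n, hGw, hn, c, hc, hcG⟩ := hG hb
  have hcomp : ∀ P : MvPolynomial (Fin 3) K, aeval (fun j => ψ (Y j)) P = ψ (aeval Y P) := by
    intro P
    have : (aeval (fun j => ψ (Y j)) : MvPolynomial (Fin 3) K →ₐ[K] _) = ψ.comp (aeval Y) := by
      ext1 i; rw [aeval_X, AlgHom.comp_apply, aeval_X]
    rw [this]; rfl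
  have hback : ∀ P : MvPolynomial (Fin 3) K, aeval Y (aeval Z P) = P := by
    intro P
    have : (aeval Y).comp (aeval Z) = AlgHom.id K (MvPolynomial (Fin 3) K) := by
      ext1 i; rw [AlgHom.comp_apply, aeval_X, hYZ]; rfl
    exact DFunLike.congr_fun this P
  refine ⟨F, i1, i2, i3, i4, fun j => ψ (Y j), aeval Z G, n, ?_, ?_, hn, ?_, ?_⟩
  · intro P hP
    rw [hcomp, (hψ _).2 hP]
  · exact wh_aeval (w := w) hZ hGw
  · rw [hcomp, hback, hcG]
    exact (IsUnit.mk0 c hc).map Polynomial.C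
  · intro hall
    apply hj
    rw [← hYZ j, ← hcomp]
    exact mem_cS.1 (aeval_cS hall (Z j))

lemma Setup.noE8 {f g : Fin 3 → MvPolynomial (Fin 3) K} {w : Fin 3 → ℤ} {R : MvPolynomial (Fin 3) K}
    (S : Setup f g w R)
    (hb : ∀ (a b : ℕ) (c : K), 1 ≤ a → 1 ≤ b → c ≠ 0 → ¬ R ∣ X 0 ^ a - C c * X 1 ^ b)
    {Y Z : Fin 3 → MvPolynomial (Fin 3) K} (hYZ : ∀ j, aeval (R := K) Y (Z j) = X j)
    (hZ : ∀ j, IsWeightedHomogeneous w (Z j) (w j)) {c1 c2 : K} (hc1 : c1 ≠ 0) (hc2 : c2 ≠ 0)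
    (e1 : 2 * w 2 = 3 * w 1) (e2 : 2 * w 2 = 5 * w 0)
    (h : R ∣ Y 2 ^ 2 - (C c1 * Y 1 ^ 3 + C c2 * Y 0 ^ 5)) : False := by
  obtain ⟨F, i1, i2, i3, i4, T, G, n, hT, hG, hn, hu, hnot⟩ := S.core hb hYZ hZ
  have := hT (X 2 ^ 2 - (C c1 * X 1 ^ 3 + C c2 * X 0 ^ 5))
    (by simpa only [map_sub, map_add, map_mul, map_pow, aeval_X, algHom_C, algebraMap_eq] using h)
  simp only [map_sub, map_add, map_mul, map_pow, aeval_X, algHom_C] at this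
  exact hnot (exclE8 S.pos hc1 hc2 (sub_eq_zero.1 this) e1 e2 hG hn hu)

lemma Setup.noE7 {f g : Fin 3 → MvPolynomial (Fin 3) K} {w : Fin 3 → ℤ} {R : MvPolynomial (Fin 3) K}
    (S : Setup f g w R)
    (hb : ∀ (a b : ℕ) (c : K), 1 ≤ a → 1 ≤ b → c ≠ 0 → ¬ R ∣ X 0 ^ a - C c * X 1 ^ b)
    {Y Z : Fin 3 → MvPolynomial (Fin 3) K} (hYZ : ∀ j, aeval (R := K) Y (Z j) = X j)
    (hZ : ∀ j, IsWeightedHomogeneous w (Z j) (w j)) {c1 c2 : K} (hc1 : c1 ≠ 0) (hc2 : c2 ≠ 0)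
    (e1 : 2 * w 2 = 3 * w 1) (e2 : 2 * w 2 = w 1 + 3 * w 0)
    (h : R ∣ Y 2 ^ 2 - Y 1 * (C c1 * Y 1 ^ 2 + C c2 * Y 0 ^ 3)) : False := by
  obtain ⟨F, i1, i2, i3, i4, T, G, n, hT, hG, hn, hu, hnot⟩ := S.core hb hYZ hZ
  have := hT (X 2 ^ 2 - X 1 * (C c1 * X 1 ^ 2 + C c2 * X 0 ^ 3))
    (by simpa only [map_sub, map_add, map_mul, map_pow, aeval_X, algHom_C, algebraMap_eq] using h)
  simp only [map_sub, map_add, map_mul, map_pow, aeval_X, algHom_C] at this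
  exact hnot (exclE7 S.pos hc1 hc2 (sub_eq_zero.1 this) e1 e2 hG hn hu)

lemma Setup.noE6 {f g : Fin 3 → MvPolynomial (Fin 3) K} {w : Fin 3 → ℤ} {R : MvPolynomial (Fin 3) K}
    (S : Setup f g w R)
    (hb : ∀ (a b : ℕ) (c : K), 1 ≤ a → 1 ≤ b → c ≠ 0 → ¬ R ∣ X 0 ^ a - C c * X 1 ^ b)
    {Y Z : Fin 3 → MvPolynomial (Fin 3) K} (hYZ : ∀ j, aeval (R := K) Y (Z j) = X j)
    (hZ : ∀ j, IsWeightedHomogeneous w (Z j) (w j)) {c1 c2 : K} (hc1 : c1 ≠ 0) (hc2 : c2 ≠ 0)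
    (e1 : 2 * w 2 = 3 * w 1) (e2 : 2 * w 2 = 4 * w 0)
    (h : R ∣ Y 2 ^ 2 - (C c1 * Y 1 ^ 3 + C c2 * Y 0 ^ 4)) : False := by
  obtain ⟨F, i1, i2, i3, i4, T, G, n, hT, hG, hn, hu, hnot⟩ := S.core hb hYZ hZ
  have := hT (X 2 ^ 2 - (C c1 * X 1 ^ 3 + C c2 * X 0 ^ 4))
    (by simpa only [map_sub, map_add, map_mul, map_pow, aeval_X, algHom_C, algebraMap_eq] using h)
  simp only [map_sub, map_add, map_mul, map_pow, aeval_X, algHom_C] at this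
  exact hnot (exclE6 S.pos hc1 hc2 (sub_eq_zero.1 this) e1 e2 hG hn hu)

lemma Setup.noDeven {f g : Fin 3 → MvPolynomial (Fin 3) K} {w : Fin 3 → ℤ}
    {R : MvPolynomial (Fin 3) K} (S : Setup f g w R)
    (hb : ∀ (a b : ℕ) (c : K), 1 ≤ a → 1 ≤ b → c ≠ 0 → ¬ R ∣ X 0 ^ a - C c * X 1 ^ b)
    {Y Z : Fin 3 → MvPolynomial (Fin 3) K} (hYZ : ∀ j, aeval (R := K) Y (Z j) = X j)
    (hZ : ∀ j, IsWeightedHomogeneous w (Z j) (w j)) {c κ : K} {e : ℕ}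
    (he : 1 ≤ e) (hc : c ≠ 0) (hκ : κ ≠ 0)
    (e1 : w 1 = e * w 0) (e2 : 2 * w 2 = w 0 + 2 * w 1)
    (h : R ∣ Y 2 ^ 2 - C c * Y 0 * Y 1 * (Y 1 + C κ * Y 0 ^ e)) : False := by
  obtain ⟨F, i1, i2, i3, i4, T, G, n, hT, hG, hn, hu, hnot⟩ := S.core hb hYZ hZ
  have := hT (X 2 ^ 2 - C c * X 0 * X 1 * (X 1 + C κ * X 0 ^ e))
    (by simpa only [map_sub, map_add, map_mul, map_pow, aeval_X, algHom_C, algebraMap_eq] using h)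
  simp only [map_sub, map_add, map_mul, map_pow, aeval_X, algHom_C] at this
  exact hnot (exclDeven S.pos he hc hκ (sub_eq_zero.1 this) e1 e2 hG hn hu)

lemma Setup.noDodd {f g : Fin 3 → MvPolynomial (Fin 3) K} {w : Fin 3 → ℤ}
    {R : MvPolynomial (Fin 3) K} (S : Setup f g w R)
    (hb : ∀ (a b : ℕ) (c : K), 1 ≤ a → 1 ≤ b → c ≠ 0 → ¬ R ∣ X 0 ^ a - C c * X 1 ^ b)
    {Y Z : Fin 3 → MvPolynomial (Fin 3) K} (hYZ : ∀ j, aeval (R := K) Y (Z j) = X j)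
    (hZ : ∀ j, IsWeightedHomogeneous w (Z j) (w j)) {c1 c2 : K} {l : ℕ}
    (hl : 1 ≤ l) (hc1 : c1 ≠ 0) (hc2 : c2 ≠ 0)
    (e1 : 2 * w 1 = (2 * l + 1) * w 0) (e2 : 2 * w 2 = w 0 + 2 * w 1)
    (h : R ∣ Y 2 ^ 2 - Y 0 * (C c1 * Y 1 ^ 2 + C c2 * Y 0 ^ (2 * l + 1))) : False := by
  obtain ⟨F, i1, i2, i3, i4, T, G, n, hT, hG, hn, hu, hnot⟩ := S.core hb hYZ hZ
  have := hT (X 2 ^ 2 - X 0 * (C c1 * X 1 ^ 2 + C c2 * X 0 ^ (2 * l + 1)))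
    (by simpa only [map_sub, map_add, map_mul, map_pow, aeval_X, algHom_C, algebraMap_eq] using h)
  simp only [map_sub, map_add, map_mul, map_pow, aeval_X, algHom_C] at this
  exact hnot (exclDodd S.pos hl hc1 hc2 (sub_eq_zero.1 this) e1 e2 hG hn hu)

end ChangeSec

set_option linter.unusedSectionVars false


section StructSec
variable {K : Type u} [Field K] [IsAlgClosed K] [CharZero K]

lemma inj_add (p q : MvPolynomial (Fin 2) K) : inj12 (p + q) = inj12 p + inj12 q := map_add _ _ _
lemma inj_sub (p q : MvPolynomial (Fin 2) K) : inj12 (p - q) = inj12 p - inj12 q := map_sub _ _ _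
lemma inj_neg (p : MvPolynomial (Fin 2) K) : inj12 (-p) = - inj12 p := map_neg _ _
lemma inj_mul (p q : MvPolynomial (Fin 2) K) : inj12 (p * q) = inj12 p * inj12 q := map_mul _ _ _
lemma inj_pow (p : MvPolynomial (Fin 2) K) (n : ℕ) : inj12 (p ^ n) = inj12 p ^ n := map_pow _ _ _
lemma inj_zero : inj12 (0 : MvPolynomial (Fin 2) K) = 0 := map_zero _
lemma inj_C (c : K) : inj12 (C c : MvPolynomial (Fin 2) K) = C c := rename_C _ _
lemma inj_X0 : inj12 (X 0 : MvPolynomial (Fin 2) K) = X 0 := rename_X _ _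
lemma inj_X1 : inj12 (X 1 : MvPolynomial (Fin 2) K) = X 1 := rename_X _ _
lemma inj_dvd {p q : MvPolynomial (Fin 2) K} (h : p ∣ q) : inj12 p ∣ inj12 q := by
  obtain ⟨r, rfl⟩ := h; rw [inj_mul]; exact dvd_mul_right _ _

lemma inj_eq_zero {p : MvPolynomial (Fin 2) K} (h : inj12 p = 0) : p = 0 :=
  rename_injective _ (Fin.castSucc_injective 2) (h.trans inj_zero.symm)

lemma inj_wh {w : Fin 3 → ℤ} {p : MvPolynomial (Fin 2) K} {n : ℤ}
    (h : IsWeightedHomogeneous ![w 0, w 1] p n) : IsWeightedHomogeneous w (inj12 p) n := by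
  have : inj12 p = aeval (![X 0, X 1] : Fin 2 → MvPolynomial (Fin 3) K) p := by
    unfold inj12
    have : (rename Fin.castSucc : MvPolynomial (Fin 2) K →ₐ[K] MvPolynomial (Fin 3) K)
        = aeval ![X 0, X 1] := by
      ext1 i; rw [aeval_X, rename_X]; fin_cases i <;> rfl
    rw [this]
  rw [this]
  refine wh_aeval (w := ![w 0, w 1]) ?_ h
  intro i; fin_cases i
  · exact wh_X 0 rfl
  · exact wh_X 1 rfl

lemma wh_nat {d : Fin 3 → ℕ} {p : MvPolynomial (Fin 3) K} {n : ℕ}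
    (h : IsWeightedHomogeneous (fun i => (d i : ℤ)) p (n : ℤ)) : IsWeightedHomogeneous d p n := by
  intro m hm
  have := h hm
  rw [weight3] at this
  rw [Finsupp.weight_apply, Finsupp.sum_fintype _ _ (by simp), Fin.sum_univ_three]
  simp only [smul_eq_mul]
  exact_mod_cast this

/-- Two-variable weighted homogeneous polynomials with few powers of the second variable. -/
lemma rep2 {v : Fin 2 → ℤ} (h0 : 0 < v 0) {N : ℕ} {n : ℤ} (h1 : 0 < v 1) (hN : n < N * v 1)
    {A : MvPolynomial (Fin 2) K} (hA : IsWeightedHomogeneous v A n) :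
    ∃ (c : ℕ → K) (a : ℕ → ℕ), (∀ j < N, c j ≠ 0 → (a j : ℤ) * v 0 + j * v 1 = n) ∧
      A = ∑ j ∈ Finset.range N, C (c j) * X 0 ^ a j * X 1 ^ j := by
  classical
  have key : ∀ s : Finset (Fin 2 →₀ ℕ), s ⊆ A.support →
      ∃ (c : ℕ → K) (a : ℕ → ℕ), (∀ j < N, c j ≠ 0 → (a j : ℤ) * v 0 + j * v 1 = n) ∧
      ∑ m ∈ s, monomial m (coeff m A) = ∑ j ∈ Finset.range N, C (c j) * X 0 ^ a j * X 1 ^ j := by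
    intro s
    induction s using Finset.induction_on with
    | empty => intro _; exact ⟨0, 0, by simp, by simp⟩
    | insert m s hms ih =>
      intro hs
      obtain ⟨c, a, hca, hsum⟩ := ih ((Finset.subset_insert _ _).trans hs)
      have hm := hA (mem_support_iff.1 (hs (Finset.mem_insert_self _ _)))
      rw [weight2] at hm
      have hlt : m 1 < N := by
        have h3 : (m 1 : ℤ) * v 1 < N * v 1 := by
          have : 0 ≤ (m 0 : ℤ) * v 0 := by positivity
          linarith
        exact_mod_cast lt_of_mul_lt_mul_right h3 h1.le
      refine ⟨Function.update c (m 1) (c (m 1) + coeff m A), Function.update a (m 1) (m 0), ?_, ?_⟩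
      · intro j hj hcj
        by_cases hjm : j = m 1
        · subst hjm; rw [Function.update_self]; exact hm
        · rw [Function.update_of_ne hjm] at hcj ⊢
          exact hca j hj hcj
      · rw [Finset.sum_insert hms, hsum, mono2,
          ← Finset.add_sum_erase _ _ (Finset.mem_range.2 hlt),
          ← Finset.add_sum_erase _ _ (Finset.mem_range.2 hlt), Function.update_self,
          Function.update_self, ← add_assoc]
        congr 1
        · by_cases hc : c (m 1) = 0
          · rw [hc]; simp
          · have e := hca _ hlt hc
            have : (a (m 1) : ℤ) * v 0 = m 0 * v 0 := by linarith
            have : a (m 1) = m 0 := by exact_mod_cast mul_right_cancel₀ h0.ne' this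
            rw [this, C_add]; ring
        · refine Finset.sum_congr rfl fun j hj => ?_
          rw [Function.update_of_ne (Finset.ne_of_mem_erase hj),
            Function.update_of_ne (Finset.ne_of_mem_erase hj)]
  obtain ⟨c, a, h, e⟩ := key A.support subset_rfl
  refine ⟨c, a, h, ?_⟩
  rw [← e]; exact A.as_sum

lemma rep3 {w : Fin 3 → ℤ} {N : ℕ} {n : ℤ} (hw : ∀ i, 0 < w i) (hN : n < N * w 2)
    {R : MvPolynomial (Fin 3) K} (hR : IsWeightedHomogeneous w R n) :
    ∃ A : ℕ → MvPolynomial (Fin 2) K, (∀ j, IsWeightedHomogeneous ![w 0, w 1] (A j) (n - j * w 2)) ∧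
      R = ∑ j ∈ Finset.range N, inj12 (A j) * X 2 ^ j := by
  classical
  have key : ∀ s : Finset (Fin 3 →₀ ℕ), s ⊆ R.support →
      ∃ A : ℕ → MvPolynomial (Fin 2) K,
        (∀ j, IsWeightedHomogeneous ![w 0, w 1] (A j) (n - j * w 2)) ∧
        ∑ m ∈ s, monomial m (coeff m R) = ∑ j ∈ Finset.range N, inj12 (A j) * X 2 ^ j := by
    intro s
    induction s using Finset.induction_on with
    | empty =>
      intro _
      exact ⟨0, fun j => isWeightedHomogeneous_zero _ _ _, by simp [inj_zero]⟩
    | insert m s hms ih =>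
      intro hs
      obtain ⟨A, hA, hsum⟩ := ih ((Finset.subset_insert _ _).trans hs)
      have hm := hR (mem_support_iff.1 (hs (Finset.mem_insert_self _ _)))
      rw [weight3] at hm
      have h0 := hw 0
      have h1 := hw 1
      have hlt : m 2 < N := by
        have h3 : (m 2 : ℤ) * w 2 < N * w 2 := by
          have : 0 ≤ (m 0 : ℤ) * w 0 := by positivity
          have : 0 ≤ (m 1 : ℤ) * w 1 := by positivity
          linarith
        exact_mod_cast lt_of_mul_lt_mul_right h3 (hw 2).le
      refine ⟨Function.update A (m 2) (A (m 2) + C (coeff m R) * X 0 ^ m 0 * X 1 ^ m 1), ?_, ?_⟩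
      · intro j
        by_cases hjm : j = m 2
        · subst hjm
          rw [Function.update_self]
          refine (hA _).add (wh_cast ((wh_CX (w := ![w 0, w 1]) _ _ _ rfl).mul
            ((isWeightedHomogeneous_X K ![w 0, w 1] 1).pow _)) ?_)
          simp; linarith
        · rw [Function.update_of_ne hjm]
          exact hA j
      · rw [Finset.sum_insert hms, hsum, mono3,
          ← Finset.add_sum_erase _ _ (Finset.mem_range.2 hlt),
          ← Finset.add_sum_erase _ _ (Finset.mem_range.2 hlt), Function.update_self, ← add_assoc]
        congr 1
        · simp only [inj_add, inj_mul, inj_pow, inj_C, inj_X0, inj_X1]; ring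
        · refine Finset.sum_congr rfl fun j hj => ?_
          rw [Function.update_of_ne (Finset.ne_of_mem_erase hj)]
  obtain ⟨A, h, e⟩ := key R.support subset_rfl
  refine ⟨A, h, ?_⟩
  rw [← e]; exact R.as_sum

/-- division by `y + a x^e` -/
lemma divY {v : Fin 2 → ℤ} {a : K} {e : ℕ} (hae : a = 0 ∨ (e : ℤ) * v 0 = v 1) {n : ℤ}
    (h0 : 0 < v 0)
    {A : MvPolynomial (Fin 2) K} (hA : IsWeightedHomogeneous v A n) :
    ∃ (B : MvPolynomial (Fin 2) K) (c : K) (k : ℕ), IsWeightedHomogeneous v B (n - v 1) ∧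
      (c ≠ 0 → (k : ℤ) * v 0 = n) ∧ A = (X 1 + C a * X 0 ^ e) * B + C c * X 0 ^ k := by
  classical
  have mon : ∀ (j i : ℕ) (r : K), (i : ℤ) * v 0 + j * v 1 = n →
      ∃ (B : MvPolynomial (Fin 2) K) (c : K) (k : ℕ), IsWeightedHomogeneous v B (n - v 1) ∧
      (c ≠ 0 → (k : ℤ) * v 0 = n) ∧
      C r * X 0 ^ i * X 1 ^ j = (X 1 + C a * X 0 ^ e) * B + C c * X 0 ^ k := by
    intro j
    induction j with
    | zero =>
      intro i r h
      exact ⟨0, r, i, isWeightedHomogeneous_zero _ _ _, fun _ => by simpa using h, by simp⟩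
    | succ j ih =>
      intro i r h
      have hB0 : IsWeightedHomogeneous v (C r * X 0 ^ i * X 1 ^ j : MvPolynomial (Fin 2) K)
          (n - v 1) := by
        refine wh_cast ((wh_CX (w := v) _ _ _ rfl).mul ((isWeightedHomogeneous_X K v 1).pow _)) ?_
        push_cast at h
        simp; linarith
      rcases hae with ha | he
      · refine ⟨_, 0, 0, hB0, by simp, ?_⟩
        rw [ha]; simp; ring
      · obtain ⟨B, c, k, hB, hc, hs⟩ := ih (i + e) (-(a * r)) (by
          push_cast at h ⊢; rw [← he] at h ⊢; linarith)
        refine ⟨C r * X 0 ^ i * X 1 ^ j + B, c, k, hB0.add hB, hc, ?_⟩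
        rw [C_neg, C_mul] at hs
        linear_combination hs
  have key : ∀ s : Finset (Fin 2 →₀ ℕ), s ⊆ A.support →
      ∃ (B : MvPolynomial (Fin 2) K) (c : K) (k : ℕ), IsWeightedHomogeneous v B (n - v 1) ∧
      (c ≠ 0 → (k : ℤ) * v 0 = n) ∧
      ∑ m ∈ s, monomial m (coeff m A) = (X 1 + C a * X 0 ^ e) * B + C c * X 0 ^ k := by
    intro s
    induction s using Finset.induction_on with
    | empty => intro _; exact ⟨0, 0, 0, isWeightedHomogeneous_zero _ _ _, by simp, by simp⟩
    | insert m s hms ih =>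
      intro hs
      obtain ⟨B, c, k, hB, hc, hsum⟩ := ih ((Finset.subset_insert _ _).trans hs)
      have hm := hA (mem_support_iff.1 (hs (Finset.mem_insert_self _ _)))
      rw [weight2] at hm
      obtain ⟨B', c', k', hB', hc', hsum'⟩ := mon (m 1) (m 0) (coeff m A) hm
      rw [Finset.sum_insert hms, hsum, mono2, hsum']
      by_cases h1 : c = 0
      · refine ⟨B' + B, c', k', hB'.add hB, hc', ?_⟩
        rw [h1]; simp; ring
      by_cases h2 : c' = 0
      · refine ⟨B' + B, c, k, hB'.add hB, hc, ?_⟩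
        rw [h2]; simp; ring
      have : (k : ℤ) * v 0 = k' * v 0 := by rw [hc h1, hc' h2]
      have : k = k' := by exact_mod_cast mul_right_cancel₀ h0.ne' this
      refine ⟨B' + B, c' + c, k, hB'.add hB, fun _ => hc h1, ?_⟩
      rw [← this, C_add]; ring
  obtain ⟨B, c, k, h, h', e⟩ := key A.support subset_rfl
  refine ⟨B, c, k, h, h', ?_⟩
  rw [← e]; exact A.as_sum

lemma assoc_C {R Q : MvPolynomial (Fin 3) K} (hR : Prime R) (hQ : ¬ IsUnit Q) (h : Q ∣ R) :
    ∃ c0 : K, c0 ≠ 0 ∧ R = C c0 * Q := by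
  obtain ⟨S, hS⟩ := h
  rcases hR.irreducible.isUnit_or_isUnit hS with h | h
  · exact absurd h hQ
  · obtain ⟨c, hc, rfl⟩ := MvPolynomial.isUnit_iff_eq_C_of_isReduced.1 h
    exact ⟨c, hc.ne_zero, by rw [hS, mul_comm]⟩

lemma not_unit_of_eval {Q : MvPolynomial (Fin 3) K} (h : aeval (fun _ => (0 : K)) Q = 0) :
    ¬ IsUnit Q := by
  intro hu
  have := hu.map (aeval (fun _ => (0 : K)) : MvPolynomial (Fin 3) K →ₐ[K] K)
  rw [h] at this
  exact not_isUnit_zero this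

/-- polynomials in `x₁,x₂,x₃` as polynomials in `x₃`. -/
noncomputable def toPz : MvPolynomial (Fin 3) K →ₐ[K] Polynomial (MvPolynomial (Fin 2) K) :=
  aeval ![Polynomial.C (X 0), Polynomial.C (X 1), Polynomial.X]

lemma toPz_X2 : toPz (X 2 : MvPolynomial (Fin 3) K) = Polynomial.X := by
  simp [toPz]

lemma toPz_inj (p : MvPolynomial (Fin 2) K) : toPz (inj12 p) = Polynomial.C p := by
  induction p using MvPolynomial.induction_on with
  | C a => rw [inj_C, algHom_C]; rfl
  | add p q hp hq => rw [inj_add, map_add, hp, hq, map_add]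
  | mul_X p i hp =>
    rw [inj_mul, map_mul, hp, map_mul]
    congr 1
    fin_cases i
    · change toPz (inj12 (X 0)) = Polynomial.C (X 0)
      rw [inj_X0]; simp [toPz]
    · change toPz (inj12 (X 1)) = Polynomial.C (X 1)
      rw [inj_X1]; simp [toPz]

lemma toPz_C (c : K) : toPz (C c : MvPolynomial (Fin 3) K) = Polynomial.C (C c) := by
  rw [← inj_C, toPz_inj]

/-- if `R` has degree ≥ 1 in `x₃` it divides no nonzero polynomial in `x₁,x₂`. -/
lemma nodvd0 {R : MvPolynomial (Fin 3) K} (hR : 1 ≤ (toPz R).natDegree) {B : MvPolynomial (Fin 2) K}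
    (h : R ∣ inj12 B) : B = 0 := by
  by_contra hB
  have h1 := map_dvd toPz h
  rw [toPz_inj] at h1
  have := Polynomial.natDegree_le_of_dvd h1 (by simpa using hB)
  rw [Polynomial.natDegree_C] at this
  omega

lemma nodvd1 {R : MvPolynomial (Fin 3) K} (hR : 2 ≤ (toPz R).natDegree) {B : MvPolynomial (Fin 2) K}
    (h : R ∣ X 2 + inj12 B) : False := by
  have h1 := map_dvd toPz h
  rw [map_add, toPz_inj, toPz_X2] at h1
  have := Polynomial.natDegree_le_of_dvd h1 (Polynomial.X_add_C_ne_zero _)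
  rw [Polynomial.natDegree_X_add_C] at this
  omega

lemma quad_split (c2 c1 c0 : K) (h : c2 ≠ 0) :
    ∃ α β : K, c1 = -c2 * (α + β) ∧ c0 = c2 * α * β := by
  obtain ⟨α, hα⟩ := IsAlgClosed.exists_root
    (Polynomial.C c2 * Polynomial.X ^ 2 + Polynomial.C c1 * Polynomial.X + Polynomial.C c0)
    (by rw [Polynomial.degree_quadratic h]; decide)
  simp [Polynomial.IsRoot] at hα
  refine ⟨α, -c1 / c2 - α, by field_simp; ring, ?_⟩
  field_simp
  linear_combination hα

lemma cubic_split (c3 c2 c1 c0 : K) (h : c3 ≠ 0) :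
    ∃ α β γ : K, c2 = -c3 * (α + β + γ) ∧ c1 = c3 * (α * β + α * γ + β * γ) ∧
      c0 = -c3 * α * β * γ := by
  obtain ⟨α, hα⟩ := IsAlgClosed.exists_root
    (Polynomial.C c3 * Polynomial.X ^ 3 + Polynomial.C c2 * Polynomial.X ^ 2
      + Polynomial.C c1 * Polynomial.X + Polynomial.C c0)
    (by rw [Polynomial.degree_cubic h]; decide)
  simp [Polynomial.IsRoot] at hα
  obtain ⟨β, γ, h1, h0⟩ := quad_split c3 (c2 + c3 * α) (c1 + c2 * α + c3 * α ^ 2) h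
  refine ⟨α, β, γ, by linear_combination h1, ?_, ?_⟩
  · linear_combination h0 - α * h1
  · linear_combination hα - α * h0

end StructSec

set_option linter.unusedSectionVars false


/-- The list of normal forms of the classification. -/
def Cls {K : Type*} [Field K] (d : Fin 3 → ℕ) (R : MvPolynomial (Fin 3) K)
    (h2 : MvPolynomial (Fin 2) K) : Prop :=
      (R = 0 ∨
       (∃ c0 : K, c0 ≠ 0 ∧
          R = C c0 * (X 2 + inj12 h2)) ∨
       (∃ (c0 c : K) (e1 e2 : ℕ), c0 ≠ 0 ∧ c ≠ 0 ∧ Nat.gcd e1 e2 = 1 ∧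
          R = C c0 * (X 0 ^ e1 + C c * X 1 ^ e2)) ∨
       (∃ (c0 c a : K) (k e1 : ℕ), c0 ≠ 0 ∧ c ≠ 0 ∧ 2 ≤ k ∧ 1 ≤ e1 ∧
          R = C c0 * ((X 1 + C a * X 0 ^ e1) * (X 2 + inj12 h2) + C c * X 0 ^ k)) ∨
       (∃ (c0 : K) (k : ℕ) (P : MvPolynomial (Fin 2) K) (m : ℕ), c0 ≠ 0 ∧ 1 ≤ k ∧
          IsWeightedHomogeneous d (inj12 P) m ∧
          R = C c0 * (X 0 ^ k * (X 2 + inj12 h2) + inj12 P)) ∨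
       (∃ c0 c : K, c0 ≠ 0 ∧ c ≠ 0 ∧
          R = C c0 * ((X 2 + inj12 h2) ^ 2 + C c * X 1 ^ 3)) ∨
       (∃ c0 c : K, c0 ≠ 0 ∧ c ≠ 0 ∧
          R = C c0 * ((X 2 + inj12 h2) ^ 2 + C c * X 0 * X 1 ^ 2)) ∨
       (∃ (c0 c : K) (r1 : ℕ), c0 ≠ 0 ∧ c ≠ 0 ∧ Odd r1 ∧ 3 ≤ r1 ∧
          R = C c0 * ((X 2 + inj12 h2) ^ 2 + C c * X 0 ^ r1)) ∨
       (∃ (c0 c : K) (r1 : ℕ), c0 ≠ 0 ∧ c ≠ 0 ∧ 1 ≤ r1 ∧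
          R = C c0 * ((X 2 + inj12 h2) ^ 2 + C c * X 0 ^ r1 * X 1)) ∨
       (∃ (c0 a b : K) (e1 : ℕ), c0 ≠ 0 ∧ a ≠ 0 ∧ b ≠ 0 ∧ Odd e1 ∧ 3 ≤ e1 ∧
          R = C c0 * ((X 2 + inj12 h2) ^ 2 + C a * X 0 ^ e1 + C b * X 1 ^ 2)) ∨
       (∃ (c0 a b : K) (e1 r1 : ℕ), c0 ≠ 0 ∧ a ≠ 0 ∧ b ≠ 0 ∧ 1 ≤ e1 ∧
          R = C c0 * ((X 2 + inj12 h2) ^ 2 + (C a * X 0 ^ e1 + C b * X 1) * X 0 ^ r1)) ∨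
       (∃ (c0 a1 b1 a2 b2 : K) (e1 : ℕ), c0 ≠ 0 ∧ a1 * b2 - b1 * a2 ≠ 0 ∧ 1 ≤ e1 ∧
          R = C c0 * ((X 2 + inj12 h2) ^ 2 +
            (C a1 * X 0 ^ e1 + C b1 * X 1) * (C a2 * X 0 ^ e1 + C b2 * X 1))) ∨
       (∃ c0 a1 b1 a2 b2 : K, c0 ≠ 0 ∧ (a1, b1) ≠ (0, 0) ∧ (a2, b2) ≠ (0, 0) ∧
          R = C c0 * ((X 2 + inj12 h2) ^ 2 +
            (C a1 * X 0 + C b1 * X 1) * (C a2 * X 0 + C b2 * X 1) ^ 2)) ∨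
       (∃ (c0 a b : K) (e1 : ℕ), c0 ≠ 0 ∧ a * b ≠ 0 ∧ 2 ≤ e1 ∧
          R = C c0 * ((X 2 + inj12 h2) ^ 2 + (C a * X 0 ^ e1 + C b * X 1) ^ 2 * X 0)))


section LinSec
variable {K : Type u} [Field K] [IsAlgClosed K] [CharZero K]

lemma Setup.not_dvd_X {f g : Fin 3 → MvPolynomial (Fin 3) K} {w : Fin 3 → ℤ}
    {R : MvPolynomial (Fin 3) K} (S : Setup f g w R) (i : Fin 3) : ¬ R ∣ X i := by
  intro h
  have := (S.ker _).2 h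
  rw [aeval_X] at this
  exact S.gne i this

lemma X_not_unit (i : Fin 3) : ¬ IsUnit (X i : MvPolynomial (Fin 3) K) :=
  not_unit_of_eval (by simp)

lemma Setup.not_X_dvd {f g : Fin 3 → MvPolynomial (Fin 3) K} {w : Fin 3 → ℤ}
    {R : MvPolynomial (Fin 3) K} (S : Setup f g w R) (i : Fin 3) : ¬ X i ∣ R := by
  intro h
  obtain ⟨c, hc, e⟩ := assoc_C S.prime (X_not_unit i) h
  refine S.not_dvd_X i ⟨C c⁻¹, ?_⟩
  have : (C c * C c⁻¹ : MvPolynomial (Fin 3) K) = 1 := by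
    rw [← C_mul, mul_inv_cancel₀ hc, C_1]
  rw [e]; linear_combination (-X i) * this

variable {f g : Fin 3 → MvPolynomial (Fin 3) K} {d : Fin 3 → ℕ} {R : MvPolynomial (Fin 3) K}

/-- `R` free of `x₃`. -/
lemma cls_two (S : Setup f g (fun i => (d i : ℤ)) R) {A : MvPolynomial (Fin 2) K} {n : ℤ}
    (hn : 0 < n) (hA : IsWeightedHomogeneous ![(d 0 : ℤ), d 1] A n) (hR : R = inj12 A) :
    Cls d R 0 := by
  have p0 : 0 < d 0 := by have := S.pos 0; simpa using this
  have p1 : 0 < d 1 := by have := S.pos 1; simpa using this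
  obtain ⟨r, q, p, hcop, hq, hp⟩ : ∃ r q p : ℕ, Nat.Coprime q p ∧ d 0 = q * r ∧ d 1 = p * r := by
    obtain ⟨r, q, p, -, hc, h0, h1⟩ := Nat.exists_coprime' (m := d 0) (n := d 1)
      (Nat.gcd_pos_of_pos_left _ p0)
    exact ⟨r, q, p, hc, h0, h1⟩
  have hq0 : 0 < q := Nat.pos_of_ne_zero (by rintro rfl; simp at hq; omega)
  have hp0 : 0 < p := Nat.pos_of_ne_zero (by rintro rfl; simp at hp; omega)
  rcases binDiv (w := ![(d 0 : ℤ), d 1]) (by intro i; fin_cases i; exacts [S.pos 0, S.pos 1])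
    hcop.symm hp0 hq0 (by simp [hp, hq]; ring) hn hA with h | h | ⟨c, hc, h⟩
  · have := inj_dvd h
    rw [inj_X0, ← hR] at this
    exact absurd this (S.not_X_dvd 0)
  · have := inj_dvd h
    rw [inj_X1, ← hR] at this
    exact absurd this (S.not_X_dvd 1)
  · have := inj_dvd h
    rw [← hR] at this
    simp only [inj_sub, inj_mul, inj_pow, inj_C, inj_X0, inj_X1] at this
    obtain ⟨c0, hc0, e⟩ := assoc_C S.prime (not_unit_of_eval (by
      simp [hp0.ne', hq0.ne'])) this
    right; right; left
    exact ⟨c0, -c, p, q, hc0, neg_ne_zero.2 hc, hcop.symm, by rw [e, C_neg]; ring⟩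

/-- `R` of degree one in `x₃`. -/
lemma cls_lin (S : Setup f g (fun i => (d i : ℤ)) R) {A0 A1 : MvPolynomial (Fin 2) K} {n : ℤ}
    (hd01 : d 0 ≤ d 1) (hd12 : d 1 ≤ d 2)
    (hn : 0 < n) (hlt : n < d 0 + d 1 + d 2)
    (hA0 : IsWeightedHomogeneous ![(d 0 : ℤ), d 1] A0 n)
    (hA1 : IsWeightedHomogeneous ![(d 0 : ℤ), d 1] A1 (n - d 2))
    (hA1n : A1 ≠ 0)
    (hR : R = inj12 A0 + inj12 A1 * X 2) :
    ∃ h2, IsWeightedHomogeneous d (inj12 h2) (d 2) ∧ Cls d R h2 := by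
  have p0 : 0 < d 0 := by have := S.pos 0; simpa using this
  have p1 : 0 < d 1 := by have := S.pos 1; simpa using this
  have hdeg : 1 ≤ (toPz R).natDegree := by
    rw [hR, map_add, map_mul, toPz_inj, toPz_inj, toPz_X2, add_comm,
      Polynomial.natDegree_linear hA1n]
  have inv : ∀ c : K, c ≠ 0 → (C c * C c⁻¹ : MvPolynomial (Fin 3) K) = 1 := by
    intro c hc
    rw [← C_mul, mul_inv_cancel₀ hc, C_1]
  obtain ⟨c, a, hca, hs⟩ := rep2 (v := ![(d 0 : ℤ), d 1]) (N := 2) (by simpa using p0)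
    (by simpa using p1) (by simp; omega) hA1
  rw [Finset.sum_range_succ, Finset.sum_range_one] at hs
  have k0 := hca 0 (by norm_num)
  have k1 := hca 1 (by norm_num)
  simp at k0 k1
  by_cases hc1 : c 1 = 0
  · have hc0 : c 0 ≠ 0 := by
      intro h; apply hA1n; rw [hs, h, hc1]; simp
    have e0 := k0 hc0
    have hs' : inj12 A1 = C (c 0) * X 0 ^ a 0 := by
      rw [hs, hc1]; simp [inj_mul, inj_C, inj_X0, inj_pow]
    by_cases ha : a 0 = 0
    · rw [ha] at e0 hs'
      have hn2 : n = d 2 := by simp at e0; omega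
      refine ⟨C (c 0)⁻¹ * A0, ?_, ?_⟩
      · apply wh_nat
        refine inj_wh (w := fun i => (d i : ℤ)) (wh_cast ((isWeightedHomogeneous_C _ _).mul hA0) ?_)
        simp [hn2]
      · right; left
        refine ⟨c 0, hc0, ?_⟩
        rw [hR, hs', inj_mul, inj_C]
        linear_combination (-inj12 A0) * inv _ hc0
    · refine ⟨0, by rw [inj_zero]; exact isWeightedHomogeneous_zero _ _ _, ?_⟩
      iterate 4 right
      left
      refine ⟨c 0, a 0, C (c 0)⁻¹ * A0, n.toNat, hc0, by omega, ?_, ?_⟩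
      · apply wh_nat
        refine inj_wh (w := fun i => (d i : ℤ)) (wh_cast ((isWeightedHomogeneous_C _ _).mul hA0) ?_)
        simp [hn.le]
      · rw [hR, hs', inj_mul, inj_C, inj_zero]
        linear_combination (-inj12 A0) * inv _ hc0
  · have e1 := k1 hc1
    have ha1 : a 1 = 0 := by
      by_contra h
      have : (1 : ℤ) * d 0 ≤ a 1 * d 0 := by
        apply mul_le_mul_of_nonneg_right _ (by positivity)
        exact_mod_cast Nat.one_le_iff_ne_zero.2 h
      omega
    rw [ha1] at e1 hs
    have hn2 : n = d 1 + d 2 := by simp at e1; omega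
    obtain ⟨e, b, he, hbe, hA1'⟩ : ∃ (e : ℕ) (b : K), 1 ≤ e ∧ (b = 0 ∨ (e : ℤ) * d 0 = d 1) ∧
        A1 = C (c 1) * (X 1 + C b * X 0 ^ e) := by
      by_cases hc0 : c 0 = 0
      · refine ⟨1, 0, le_rfl, Or.inl rfl, ?_⟩
        rw [hs, hc0]; simp
      · have e0 := k0 hc0
        have e0' : (a 0 : ℤ) * d 0 = d 1 := by rw [hn2] at e0; linarith
        refine ⟨a 0, (c 1)⁻¹ * c 0, ?_, Or.inr e0', ?_⟩
        · by_contra h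
          have : a 0 = 0 := by omega
          rw [this] at e0'; simp at e0'; omega
        · have : (C (c 1) * C (c 1)⁻¹ : MvPolynomial (Fin 2) K) = 1 := by
            rw [← C_mul, mul_inv_cancel₀ hc1, C_1]
          rw [hs, C_mul]
          linear_combination (-C (c 0) * X 0 ^ a 0) * this
    obtain ⟨B, r, k, hB, hr, hA0'⟩ := divY (v := ![(d 0 : ℤ), d 1]) (a := b) (e := e)
      (by simpa using hbe) (by simpa using p0) hA0
    refine ⟨C (c 1)⁻¹ * B, ?_, ?_⟩
    · apply wh_nat
      refine inj_wh (w := fun i => (d i : ℤ)) (wh_cast ((isWeightedHomogeneous_C _ _).mul hB) ?_)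
      simp [hn2]
    · have hfin : R = C (c 1) * ((X 1 + C b * X 0 ^ e) * (X 2 + inj12 (C (c 1)⁻¹ * B)) +
          C ((c 1)⁻¹ * r) * X 0 ^ k) := by
        rw [hR, hA0', hA1']
        simp only [inj_add, inj_mul, inj_pow, inj_C, inj_X0, inj_X1, C_mul]
        linear_combination (-(X 1 + C b * X 0 ^ e) * inj12 B - C r * X 0 ^ k) * inv _ hc1
      have hr0 : r ≠ 0 := by
        rintro rfl
        have hfac : R = (C (c 1) * (X 2 + inj12 (C (c 1)⁻¹ * B))) * (X 1 + C b * X 0 ^ e) := by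
          rw [hfin]; simp; ring
        have hnu : ¬ IsUnit (X 1 + C b * X 0 ^ e : MvPolynomial (Fin 3) K) :=
          not_unit_of_eval (by simp; right; omega)
        obtain ⟨s, hs0, hs⟩ := assoc_C S.prime hnu ⟨_, hfac.trans (mul_comm _ _)⟩
        have h1 : R ∣ inj12 (X 1 + C b * X 0 ^ e) := by
          refine ⟨C s⁻¹, ?_⟩
          simp only [inj_add, inj_mul, inj_pow, inj_C, inj_X0, inj_X1]
          rw [hs]
          linear_combination (-(X 1 + C b * X 0 ^ e)) * inv _ hs0
        have h2 := nodvd0 hdeg h1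
        rw [h2] at hA1'
        exact hA1n (by rw [hA1', mul_zero])
      have hk := hr hr0
      iterate 3 right
      left
      refine ⟨c 1, (c 1)⁻¹ * r, b, k, e, hc1, mul_ne_zero (inv_ne_zero hc1) hr0, ?_, he, hfin⟩
      by_contra hk2
      have hk1 : (k : ℤ) ≤ 1 := by omega
      simp at hk
      have : (k : ℤ) * d 0 ≤ 1 * d 0 := mul_le_mul_of_nonneg_right hk1 (by positivity)
      omega

end LinSec

set_option linter.unusedSectionVars false


section QuadSec
variable {K : Type u} [Field K] [IsAlgClosed K] [CharZero K]

/-- The situation where `R` is quadratic in `x₃`. -/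
structure Quad (f g : Fin 3 → MvPolynomial (Fin 3) K) (d : Fin 3 → ℕ) (R : MvPolynomial (Fin 3) K)
    (c0 : K) (h P : MvPolynomial (Fin 2) K) : Prop where
  S : Setup f g (fun i => (d i : ℤ)) R
  p0 : 0 < d 0
  d01 : d 0 ≤ d 1
  d12 : d 1 ≤ d 2
  lt : d 2 < d 0 + d 1
  hc0 : c0 ≠ 0
  hh : IsWeightedHomogeneous ![(d 0 : ℤ), d 1] h (d 2)
  hP : IsWeightedHomogeneous ![(d 0 : ℤ), d 1] P (2 * d 2)
  hR : R = C c0 * ((X 2 + inj12 h) ^ 2 + inj12 P)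

variable {f g : Fin 3 → MvPolynomial (Fin 3) K} {d : Fin 3 → ℕ} {R : MvPolynomial (Fin 3) K}
  {c0 : K} {h P : MvPolynomial (Fin 2) K}

lemma Quad.dvd (Q : Quad f g d R c0 h P) : R ∣ (X 2 + inj12 h) ^ 2 + inj12 P := by
  refine ⟨C c0⁻¹, ?_⟩
  have : (C c0 * C c0⁻¹ : MvPolynomial (Fin 3) K) = 1 := by
    rw [← C_mul, mul_inv_cancel₀ Q.hc0, C_1]
  rw [Q.hR]
  linear_combination (-((X 2 + inj12 h) ^ 2 + inj12 P)) * this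

lemma Quad.deg (Q : Quad f g d R c0 h P) : 2 ≤ (toPz R).natDegree := by
  rw [Q.hR, map_mul, toPz_C, map_add, map_pow, map_add, toPz_X2, toPz_inj, toPz_inj,
    Polynomial.natDegree_C_mul (by simpa using Q.hc0), Polynomial.natDegree_add_C,
    Polynomial.natDegree_pow, Polynomial.natDegree_X_add_C]

lemma Quad.hb (Q : Quad f g d R c0 h P) (a b : ℕ) (c : K) (_ : 1 ≤ a) (hb : 1 ≤ b) (_ : c ≠ 0) :
    ¬ R ∣ X 0 ^ a - C c * X 1 ^ b := by
  intro hd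
  have h1 : R ∣ inj12 (X 0 ^ a - C c * X 1 ^ b) := by
    simpa only [inj_sub, inj_mul, inj_pow, inj_C, inj_X0, inj_X1] using hd
  have h2 := nodvd0 (by have := Q.deg; omega) h1
  have h3 := congrArg (aeval ![(1 : K), 0]) h2
  simp [show b ≠ 0 by omega] at h3

lemma Quad.nosq (Q : Quad f g d R c0 h P) (q : MvPolynomial (Fin 2) K)
    (hq : inj12 P = -(inj12 q) ^ 2) : False := by
  have h1 : R ∣ (X 2 + inj12 (h - q)) * (X 2 + inj12 (h + q)) := by
    have := Q.dvd
    rw [hq] at this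
    convert this using 1
    rw [inj_sub, inj_add]; ring
  rcases Q.S.prime.dvd_or_dvd h1 with h2 | h2
  · exact nodvd1 Q.deg h2
  · exact nodvd1 Q.deg h2

lemma Quad.chg (Q : Quad f g d R c0 h P) {y z : Fin 2 → MvPolynomial (Fin 2) K}
    (hyz : ∀ j, aeval (R := K) y (z j) = X j)
    (hz : ∀ j, IsWeightedHomogeneous ![(d 0 : ℤ), d 1] (z j) (![(d 0 : ℤ), d 1] j)) :
    ∃ Z : Fin 3 → MvPolynomial (Fin 3) K,
      (∀ j, aeval (R := K) ![inj12 (y 0), inj12 (y 1), X 2 + inj12 h] (Z j) = X j) ∧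
      ∀ j, IsWeightedHomogeneous (fun i => (d i : ℤ)) (Z j) (d j : ℤ) := by
  have hin : ∀ p : MvPolynomial (Fin 2) K,
      aeval (R := K) ![inj12 (y 0), inj12 (y 1), X 2 + inj12 h] (inj12 p) = inj12 (aeval y p) := by
    intro p
    induction p using MvPolynomial.induction_on with
    | C a => rw [inj_C, algHom_C, algHom_C]; exact (inj_C a).symm
    | add p q hp hq => rw [inj_add, map_add, hp, hq, map_add, inj_add]
    | mul_X p i hp =>
      rw [inj_mul, map_mul, hp, map_mul, inj_mul]
      congr 1
      rw [aeval_X]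
      unfold inj12
      rw [rename_X, aeval_X]
      fin_cases i <;> rfl
  have hback : aeval (R := K) y (aeval z h) = h := by
    have : (aeval y).comp (aeval z) = AlgHom.id K (MvPolynomial (Fin 2) K) := by
      ext1 i; rw [AlgHom.comp_apply, aeval_X, hyz]; rfl
    exact DFunLike.congr_fun this h
  refine ⟨![inj12 (z 0), inj12 (z 1), X 2 - inj12 (aeval z h)], ?_, ?_⟩
  · intro j; fin_cases j
    · change aeval _ (inj12 (z 0)) = _
      rw [hin, hyz, inj_X0]; rfl
    · change aeval _ (inj12 (z 1)) = _
      rw [hin, hyz, inj_X1]; rfl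
    · change aeval _ (X 2 - inj12 (aeval z h)) = _
      rw [map_sub, hin, hback, aeval_X]
      change X 2 + inj12 h - inj12 h = _
      rw [add_sub_cancel_right]; rfl
  · intro j; fin_cases j
    · exact inj_wh (w := fun i => (d i : ℤ)) (hz 0)
    · exact inj_wh (w := fun i => (d i : ℤ)) (hz 1)
    · refine IsWeightedHomogeneous.sub (wh_X 2 rfl) ?_
      refine inj_wh (w := fun i => (d i : ℤ)) ?_
      exact wh_aeval (w := ![(d 0 : ℤ), d 1]) hz Q.hh

lemma Quad.chg0 (Q : Quad f g d R c0 h P) :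
    ∃ Z : Fin 3 → MvPolynomial (Fin 3) K,
      (∀ j, aeval (R := K) ![X 0, X 1, X 2 + inj12 h] (Z j) = X j) ∧
      ∀ j, IsWeightedHomogeneous (fun i => (d i : ℤ)) (Z j) (d j : ℤ) := by
  obtain ⟨Z, h1, h2⟩ := Q.chg (y := X) (z := X) (fun j => aeval_X _ _) (fun j => wh_X j rfl)
  refine ⟨Z, ?_, h2⟩
  rwa [inj_X0, inj_X1] at h1

lemma Quad.chg1 (Q : Quad f g d R c0 h P) (α : K) (e : ℕ) (he : e * d 0 = d 1) :
    ∃ Z : Fin 3 → MvPolynomial (Fin 3) K,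
      (∀ j, aeval (R := K) ![X 0, X 1 - C α * X 0 ^ e, X 2 + inj12 h] (Z j) = X j) ∧
      ∀ j, IsWeightedHomogeneous (fun i => (d i : ℤ)) (Z j) (d j : ℤ) := by
  obtain ⟨Z, h1, h2⟩ := Q.chg (y := ![X 0, X 1 - C α * X 0 ^ e]) (z := ![X 0, X 1 + C α * X 0 ^ e])
    (by
      intro j; fin_cases j
      · change aeval _ (X 0) = _
        rw [aeval_X]; rfl
      · change aeval _ (X 1 + C α * X 0 ^ e) = _
        simp only [map_add, map_mul, map_pow, aeval_X, algHom_C, algebraMap_eq]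
        simp)
    (by
      intro j; fin_cases j
      · exact wh_X 0 rfl
      · exact (wh_X 1 rfl).add (wh_CX _ _ _ (by simp; exact_mod_cast he)))
  refine ⟨Z, ?_, h2⟩
  simpa only [Matrix.cons_val_zero, Matrix.cons_val_one, inj_sub, inj_mul, inj_pow, inj_C, inj_X0,
    inj_X1] using h1

lemma Quad.chg2 (Q : Quad f g d R c0 h P) (α β : K) (hαβ : α ≠ β) (he : d 0 = d 1) :
    ∃ Z : Fin 3 → MvPolynomial (Fin 3) K,
      (∀ j, aeval (R := K) ![X 1 - C α * X 0, X 1 - C β * X 0, X 2 + inj12 h] (Z j) = X j) ∧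
      ∀ j, IsWeightedHomogeneous (fun i => (d i : ℤ)) (Z j) (d j : ℤ) := by
  have hne : β - α ≠ 0 := sub_ne_zero.2 hαβ.symm
  have hi : (C (β - α)⁻¹ * (C β - C α) : MvPolynomial (Fin 2) K) = 1 := by
    rw [← C_sub, ← C_mul, inv_mul_cancel₀ hne, C_1]
  have wX0 : IsWeightedHomogeneous ![(d 0 : ℤ), d 1] (X 0 : MvPolynomial (Fin 2) K) (d 0) :=
    wh_X 0 rfl
  have wX1 : IsWeightedHomogeneous ![(d 0 : ℤ), d 1] (X 1 : MvPolynomial (Fin 2) K) (d 0) :=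
    wh_X 1 (by simp [he])
  have w1 : IsWeightedHomogeneous ![(d 0 : ℤ), d 1]
      (C (β - α)⁻¹ * (X 0 - X 1) : MvPolynomial (Fin 2) K) (d 0) :=
    wh_cast ((isWeightedHomogeneous_C _ _).mul (wX0.sub wX1)) (by simp)
  obtain ⟨Z, h1, h2⟩ := Q.chg (y := ![X 1 - C α * X 0, X 1 - C β * X 0])
    (z := ![C (β - α)⁻¹ * (X 0 - X 1), X 0 + C α * (C (β - α)⁻¹ * (X 0 - X 1))])
    (by
      intro j; fin_cases j
      · change aeval _ (C (β - α)⁻¹ * (X 0 - X 1)) = _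
        simp only [map_sub, map_mul, aeval_X, algHom_C, algebraMap_eq]
        change C (β - α)⁻¹ * (X 1 - C α * X 0 - (X 1 - C β * X 0)) = X 0
        linear_combination X 0 * hi
      · change aeval _ (X 0 + C α * (C (β - α)⁻¹ * (X 0 - X 1))) = _
        simp only [map_sub, map_add, map_mul, aeval_X, algHom_C, algebraMap_eq]
        change X 1 - C α * X 0 + C α * (C (β - α)⁻¹ * (X 1 - C α * X 0 - (X 1 - C β * X 0))) = X 1
        linear_combination C α * X 0 * hi)
    (by
      intro j; fin_cases j
      · exact w1
      · exact wh_cast (wX0.add (wh_cast ((isWeightedHomogeneous_C _ α).mul w1) (by simp)))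
          (by simp [he]))
  refine ⟨Z, ?_, h2⟩
  simpa only [Matrix.cons_val_zero, Matrix.cons_val_one, inj_sub, inj_mul, inj_pow, inj_C, inj_X0,
    inj_X1] using h1

lemma split_e {q0 q1 q2 : K} (h2 : q2 ≠ 0) {a0 a1 s e : ℕ} (h1 : q1 ≠ 0 → a1 = s + e)
    (h0 : q0 ≠ 0 → a0 = s + 2 * e) :
    ∃ α β : K, (C q0 * X 0 ^ a0 + C q1 * X 0 ^ a1 * X 1 + C q2 * X 0 ^ s * X 1 ^ 2 :
      MvPolynomial (Fin 3) K) = C q2 * X 0 ^ s * (X 1 - C α * X 0 ^ e) * (X 1 - C β * X 0 ^ e) ∧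
      (α = 0 → β = 0 → q1 = 0 ∧ q0 = 0) := by
  obtain ⟨α, β, e1, e0⟩ := quad_split q2 q1 q0 h2
  refine ⟨α, β, ?_, ?_⟩
  · have t1 : (C q1 * X 0 ^ a1 : MvPolynomial (Fin 3) K) = C q1 * X 0 ^ (s + e) := by
      by_cases hq : q1 = 0
      · rw [hq]; simp
      · rw [h1 hq]
    have t0 : (C q0 * X 0 ^ a0 : MvPolynomial (Fin 3) K) = C q0 * X 0 ^ (s + 2 * e) := by
      by_cases hq : q0 = 0
      · rw [hq]; simp
      · rw [h0 hq]
    rw [t1, t0, e1, e0]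
    simp only [C_mul, C_neg, C_add]
    ring
  · rintro rfl rfl
    simp at e1 e0
    exact ⟨e1, e0⟩

lemma dich {d0 d1 : ℕ} (p0 : 0 < d0) (d01 : d0 ≤ d1) {q0 q1 : K} {a0 a1 s : ℕ}
    (h1 : q1 ≠ 0 → a1 * d0 = s * d0 + d1) (h0 : q0 ≠ 0 → a0 * d0 = s * d0 + 2 * d1)
    (hn : ¬ (q1 = 0 ∧ q0 = 0)) :
    (∃ e, 1 ≤ e ∧ e * d0 = d1 ∧ (q1 ≠ 0 → a1 = s + e) ∧ (q0 ≠ 0 → a0 = s + 2 * e)) ∨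
    (q1 = 0 ∧ q0 ≠ 0 ∧ ∃ l, 1 ≤ l ∧ a0 = s + (2 * l + 1) ∧ (2 * l + 1) * d0 = 2 * d1) := by
  by_cases hq1 : q1 = 0
  · have hq0 : q0 ≠ 0 := fun h => hn ⟨hq1, h⟩
    have e0 := h0 hq0
    have hle : s ≤ a0 := Nat.le_of_mul_le_mul_right (by omega : s * d0 ≤ a0 * d0) p0
    obtain ⟨b, rfl⟩ := Nat.exists_eq_add_of_le hle
    have eb : b * d0 = 2 * d1 := by rw [add_mul] at e0; omega
    rcases Nat.even_or_odd' b with ⟨l, rfl | rfl⟩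
    · have el : l * d0 = d1 := by rw [mul_assoc] at eb; omega
      refine Or.inl ⟨l, ?_, el, fun h => absurd hq1 h, fun _ => rfl⟩
      by_contra hl
      have : l = 0 := by omega
      subst this; simp at el; omega
    · refine Or.inr ⟨hq1, hq0, l, ?_, rfl, eb⟩
      by_contra hl
      have : l = 0 := by omega
      subst this; simp at eb; omega
  · have e1 := h1 hq1
    have hle : s ≤ a1 := Nat.le_of_mul_le_mul_right (by omega : s * d0 ≤ a1 * d0) p0
    obtain ⟨e, rfl⟩ := Nat.exists_eq_add_of_le hle
    have eb : e * d0 = d1 := by rw [add_mul] at e1; omega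
    refine Or.inl ⟨e, ?_, eb, fun _ => rfl, fun hq => ?_⟩
    · by_contra hl
      have : e = 0 := by omega
      subst this; simp at eb; omega
    · have e0 := h0 hq
      apply Nat.eq_of_mul_eq_mul_right p0
      rw [e0, ← eb]; ring

end QuadSec

set_option linter.unusedSectionVars false


section QuadClsSec
variable {K : Type u} [Field K] [IsAlgClosed K] [CharZero K]
variable {f g : Fin 3 → MvPolynomial (Fin 3) K} {d : Fin 3 → ℕ} {R : MvPolynomial (Fin 3) K}
  {c0 : K} {h P : MvPolynomial (Fin 2) K}

lemma exists_sq (a : K) : ∃ r : K, r ^ 2 = a := IsAlgClosed.exists_pow_nat_eq a (by norm_num)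

/-- degree 3 in `x₂`. -/
lemma Quad.cls3 (Q : Quad f g d R c0 h P) {q0 q1 q2 q3 : K} {a0 a1 a2 a3 : ℕ}
    (k0 : q0 ≠ 0 → a0 * d 0 = 2 * d 2) (k1 : q1 ≠ 0 → a1 * d 0 + d 1 = 2 * d 2)
    (k2 : q2 ≠ 0 → a2 * d 0 + 2 * d 1 = 2 * d 2) (k3 : a3 * d 0 + 3 * d 1 = 2 * d 2)
    (hq3 : q3 ≠ 0)
    (hs : inj12 P = C q0 * X 0 ^ a0 + C q1 * X 0 ^ a1 * X 1 + C q2 * X 0 ^ a2 * X 1 ^ 2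
      + C q3 * X 0 ^ a3 * X 1 ^ 3) : Cls d R h := by
  have p0 := Q.p0
  have d01 := Q.d01
  have hlt := Q.lt
  have hdv := Q.dvd
  have ha3 : a3 = 0 := by
    by_contra hne
    have : 1 * d 0 ≤ a3 * d 0 := Nat.mul_le_mul_right _ (by omega)
    omega
  subst ha3
  simp only [zero_mul, zero_add, pow_zero, mul_one] at k3 hs
  by_cases hd : d 0 = d 1
  · have t2 : (C q2 * X 0 ^ a2 : MvPolynomial (Fin 3) K) = C q2 * X 0 := by
      by_cases hq : q2 = 0
      · rw [hq]; simp
      · have : a2 = 1 := by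
          apply Nat.eq_of_mul_eq_mul_right p0
          have := k2 hq; omega
        rw [this, pow_one]
    have t1 : (C q1 * X 0 ^ a1 : MvPolynomial (Fin 3) K) = C q1 * X 0 ^ 2 := by
      by_cases hq : q1 = 0
      · rw [hq]; simp
      · have : a1 = 2 := by
          apply Nat.eq_of_mul_eq_mul_right p0
          have := k1 hq; omega
        rw [this]
    have t0 : (C q0 * X 0 ^ a0 : MvPolynomial (Fin 3) K) = C q0 * X 0 ^ 3 := by
      by_cases hq : q0 = 0
      · rw [hq]; simp
      · have : a0 = 3 := by
          apply Nat.eq_of_mul_eq_mul_right p0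
          have := k0 hq; omega
        rw [this]
    rw [t0, t1, t2] at hs
    obtain ⟨α, β, γ, e2, e1, e0⟩ := cubic_split q3 q2 q1 q0 hq3
    have hs' : inj12 P = C q3 * (X 1 - C α * X 0) * (X 1 - C β * X 0) * (X 1 - C γ * X 0) := by
      rw [hs, e2, e1, e0]
      simp only [C_mul, C_neg, C_add]
      ring
    have rep : ∀ u v : K, inj12 P = C q3 * (X 1 - C u * X 0) * (X 1 - C v * X 0) ^ 2 →
        Cls d R h := by
      intro u v huv
      iterate 12 right
      left
      refine ⟨c0, -(q3 * u), q3, -v, 1, Q.hc0, by simp [hq3], by simp, ?_⟩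
      rw [Q.hR, huv]
      simp only [C_mul, C_neg, C_1]
      ring
    by_cases h1 : α = β
    · exact rep γ α (by rw [hs', h1]; ring)
    by_cases h2 : α = γ
    · exact rep β α (by rw [hs', h2]; ring)
    by_cases h3 : β = γ
    · exact rep α β (by rw [hs', h3]; ring)
    exfalso
    obtain ⟨Z, hZ1, hZ2⟩ := Q.chg2 α β h1 hd
    have n1 : β - α ≠ 0 := sub_ne_zero.2 (Ne.symm h1)
    have n2 : γ - α ≠ 0 := sub_ne_zero.2 (Ne.symm h2)
    have n3 : β - γ ≠ 0 := sub_ne_zero.2 h3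
    refine Q.S.noDeven Q.hb (e := 1) hZ1 hZ2 le_rfl (c := -q3 * ((γ - α) / (β - α)))
      (κ := (β - γ) / (γ - α))
      (mul_ne_zero (neg_ne_zero.2 hq3) (div_ne_zero n2 n1)) (div_ne_zero n3 n2) (by simp [hd])
      (by omega) ?_
    rw [hs'] at hdv
    convert hdv using 1
    change (X 2 + inj12 h) ^ 2 - C (-q3 * ((γ - α) / (β - α))) * (X 1 - C α * X 0) *
      (X 1 - C β * X 0) * ((X 1 - C β * X 0) + C ((β - γ) / (γ - α)) * (X 1 - C α * X 0) ^ 1) = _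
    have i1 : ((γ - α) / (β - α)) * (1 + (β - γ) / (γ - α)) = 1 := by field_simp; ring
    have i2 : ((γ - α) / (β - α)) * (β + (β - γ) / (γ - α) * α) = γ := by field_simp; ring
    have j1 := congrArg (C : K → MvPolynomial (Fin 3) K) i1
    have j2 := congrArg (C : K → MvPolynomial (Fin 3) K) i2
    simp only [C_mul, C_add, C_neg, C_1] at j1 j2 ⊢
    linear_combination (C q3 * (X 1 - C α * X 0) * (X 1 - C β * X 0)) * (X 1 * j1 - X 0 * j2)
  · have hq2 : q2 = 0 := by
      by_contra hq
      have e := k2 hq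
      have h1 : a2 < 2 := by
        by_contra hge
        have : 2 * d 0 ≤ a2 * d 0 := Nat.mul_le_mul_right _ (by omega)
        omega
      interval_cases a2 <;> omega
    obtain ⟨Z, hZ1, hZ2⟩ := Q.chg0
    rw [hq2] at hs
    by_cases hq1 : q1 = 0
    · by_cases hq0 : q0 = 0
      · iterate 5 right
        left
        refine ⟨c0, q3, Q.hc0, hq3, ?_⟩
        rw [Q.hR, hs, hq1, hq0]; simp
      · exfalso
        have e := k0 hq0
        have hle : a0 < 6 := by
          by_contra hge
          have : 6 * d 0 ≤ a0 * d 0 := Nat.mul_le_mul_right _ (by omega)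
          omega
        have hge : 3 < a0 := by
          by_contra hge
          have : a0 * d 0 ≤ 3 * d 0 := Nat.mul_le_mul_right _ (by omega)
          omega
        rw [hs, hq1] at hdv
        obtain rfl | rfl : a0 = 4 ∨ a0 = 5 := by omega
        · refine Q.S.noE6 Q.hb hZ1 hZ2 (c1 := -q3) (c2 := -q0) (by simpa using hq3)
            (by simpa using hq0) (by omega) (by omega) ?_
          convert hdv using 1
          change (X 2 + inj12 h) ^ 2 - (C (-q3) * X 1 ^ 3 + C (-q0) * X 0 ^ 4) = _
          simp only [C_neg, C_0]; ring
        · refine Q.S.noE8 Q.hb hZ1 hZ2 (c1 := -q3) (c2 := -q0) (by simpa using hq3)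
            (by simpa using hq0) (by omega) (by omega) ?_
          convert hdv using 1
          change (X 2 + inj12 h) ^ 2 - (C (-q3) * X 1 ^ 3 + C (-q0) * X 0 ^ 5) = _
          simp only [C_neg, C_0]; ring
    · exfalso
      have e := k1 hq1
      have hle : a1 < 4 := by
        by_contra hge
        have : 4 * d 0 ≤ a1 * d 0 := Nat.mul_le_mul_right _ (by omega)
        omega
      have hge : 2 < a1 := by
        by_contra hge
        have : a1 * d 0 ≤ 2 * d 0 := Nat.mul_le_mul_right _ (by omega)
        omega
      obtain rfl : a1 = 3 := by omega
      have hq0 : q0 = 0 := by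
        by_contra hq
        have e0 := k0 hq
        have : (2 * a0) * d 0 = 9 * d 0 := by rw [mul_assoc]; omega
        have := Nat.eq_of_mul_eq_mul_right p0 this
        omega
      rw [hs, hq0] at hdv
      refine Q.S.noE7 Q.hb hZ1 hZ2 (c1 := -q3) (c2 := -q1) (by simpa using hq3)
            (by simpa using hq1) (by omega) (by omega) ?_
      convert hdv using 1
      change (X 2 + inj12 h) ^ 2 - X 1 * (C (-q3) * X 1 ^ 2 + C (-q1) * X 0 ^ 3) = _
      simp only [C_neg, C_0]; ring

/-- degree 2 in `x₂`. -/
lemma Quad.cls2 (Q : Quad f g d R c0 h P) {q0 q1 q2 : K} {a0 a1 a2 : ℕ}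
    (k0 : q0 ≠ 0 → a0 * d 0 = 2 * d 2) (k1 : q1 ≠ 0 → a1 * d 0 + d 1 = 2 * d 2)
    (k2 : a2 * d 0 + 2 * d 1 = 2 * d 2) (hq2 : q2 ≠ 0)
    (hs : inj12 P = C q0 * X 0 ^ a0 + C q1 * X 0 ^ a1 * X 1 + C q2 * X 0 ^ a2 * X 1 ^ 2) :
    Cls d R h := by
  have p0 := Q.p0
  have d01 := Q.d01
  have hlt := Q.lt
  have hdv := Q.dvd
  have ha2 : a2 < 2 := by
    by_contra hge
    have : 2 * d 0 ≤ a2 * d 0 := Nat.mul_le_mul_right _ (by omega)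
    omega
  have k1' : q1 ≠ 0 → a1 * d 0 = a2 * d 0 + d 1 := fun hq => by have := k1 hq; omega
  have k0' : q0 ≠ 0 → a0 * d 0 = a2 * d 0 + 2 * d 1 := fun hq => by have := k0 hq; omega
  by_cases hz : q1 = 0 ∧ q0 = 0
  · rw [hz.1, hz.2] at hs
    simp only [C_0, zero_mul, zero_add] at hs
    interval_cases a2
    · exfalso
      obtain ⟨r, hr⟩ := exists_sq (-q2)
      have hr' := congrArg (C : K → MvPolynomial (Fin 3) K) hr
      apply Q.nosq (C r * X 1)
      rw [hs, inj_mul, inj_C, inj_X1]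
      simp only [C_pow, C_neg] at hr'
      linear_combination (X 1 ^ 2) * hr'
    · iterate 6 right
      left
      refine ⟨c0, q2, Q.hc0, hq2, ?_⟩
      rw [Q.hR, hs, pow_one]
  rcases dich p0 d01 k1' k0' hz with ⟨e, he, hed, g1, g0⟩ | ⟨hq1, hq0, l, hl, rfl, hld⟩
  · obtain ⟨α, β, hs', hαβ⟩ := split_e hq2 g1 g0
    rw [← hs] at hs'
    interval_cases a2
    · by_cases hab : α = β
      · exfalso
        subst hab
        obtain ⟨r, hr⟩ := exists_sq (-q2)
        have hr' := congrArg (C : K → MvPolynomial (Fin 3) K) hr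
        apply Q.nosq (C r * (X 1 - C α * X 0 ^ e))
        rw [hs']
        simp only [inj_mul, inj_C, inj_X1, inj_sub, inj_pow, inj_X0]
        simp only [C_pow, C_neg] at hr'
        linear_combination ((X 1 - C α * X 0 ^ e) ^ 2) * hr'
      · iterate 11 right
        left
        refine ⟨c0, -(q2 * α), q2, -β, 1, e, Q.hc0, ?_, he, ?_⟩
        · have : -(q2 * α) * 1 - q2 * -β = q2 * (β - α) := by ring
          rw [this]
          exact mul_ne_zero hq2 (sub_ne_zero.2 (Ne.symm hab))
        · rw [Q.hR, hs']
          simp only [C_neg, C_mul, C_1]; ring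
    · by_cases hab : α = β
      · subst hab
        obtain ⟨r, hr⟩ := exists_sq q2
        have hr' := congrArg (C : K → MvPolynomial (Fin 3) K) hr
        simp only [C_pow] at hr'
        have hr0 : r ≠ 0 := by rintro rfl; simp at hr; exact hq2 hr.symm
        by_cases he1 : e = 1
        · subst he1
          iterate 12 right
          left
          refine ⟨c0, 1, 0, -(α * r), r, Q.hc0, by simp, by simp [hr0], ?_⟩
          rw [Q.hR, hs']
          simp only [C_neg, C_mul, C_1, C_0]
          linear_combination (-C c0 * X 0 * (X 1 - C α * X 0) ^ 2) * hr'
        · iterate 13 right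
          refine ⟨c0, -(α * r), r, e, Q.hc0, ?_, by omega, ?_⟩
          · have hα : α ≠ 0 := fun h => hz (hαβ h h)
            exact mul_ne_zero (neg_ne_zero.2 (mul_ne_zero hα hr0)) hr0
          · rw [Q.hR, hs']
            simp only [C_neg, C_mul, C_1, C_0]
            linear_combination (-C c0 * X 0 * (X 1 - C α * X 0 ^ e) ^ 2) * hr'
      · exfalso
        obtain ⟨Z, hZ1, hZ2⟩ := Q.chg1 α e hed
        refine Q.S.noDeven Q.hb (e := e) hZ1 hZ2 he (c := -q2) (κ := α - β)
          (neg_ne_zero.2 hq2) (sub_ne_zero.2 hab) (by exact_mod_cast hed.symm)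
          (by omega) ?_
        rw [hs'] at hdv
        convert hdv using 1
        change (X 2 + inj12 h) ^ 2 - C (-q2) * X 0 * (X 1 - C α * X 0 ^ e) *
          ((X 1 - C α * X 0 ^ e) + C (α - β) * X 0 ^ e) = _
        simp only [C_neg, C_sub]; ring
  · rw [hq1] at hs
    interval_cases a2
    · iterate 9 right
      left
      refine ⟨c0, q0, q2, 2 * l + 1, Q.hc0, hq0, hq2, ⟨l, rfl⟩, by omega, ?_⟩
      rw [Q.hR, hs, Nat.zero_add]; simp only [C_0, zero_mul, pow_zero, mul_one]; ring
    · exfalso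
      obtain ⟨Z, hZ1, hZ2⟩ := Q.chg0
      refine Q.S.noDodd Q.hb (l := l) hZ1 hZ2 hl (c1 := -q2) (c2 := -q0)
          (neg_ne_zero.2 hq2) (neg_ne_zero.2 hq0) (by exact_mod_cast hld.symm)
          (by omega) ?_
      rw [hs] at hdv
      convert hdv using 1
      change (X 2 + inj12 h) ^ 2 - X 0 * (C (-q2) * X 1 ^ 2 + C (-q0) * X 0 ^ (2 * l + 1)) = _
      simp only [C_neg, C_0]; ring

/-- degree at most 1 in `x₂`. -/
lemma Quad.cls1 (Q : Quad f g d R c0 h P) {q0 q1 : K} {a0 a1 : ℕ}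
    (k0 : q0 ≠ 0 → a0 * d 0 = 2 * d 2) (k1 : q1 ≠ 0 → a1 * d 0 + d 1 = 2 * d 2)
    (hs : inj12 P = C q0 * X 0 ^ a0 + C q1 * X 0 ^ a1 * X 1) :
    Cls d R h := by
  have p0 := Q.p0
  have d01 := Q.d01
  have d12 := Q.d12
  by_cases hq1 : q1 = 0
  · rw [hq1] at hs
    simp only [C_0, zero_mul, add_zero] at hs
    obtain ⟨r, hr⟩ := exists_sq (-q0)
    have hr' := congrArg (C : K → MvPolynomial (Fin 3) K) hr
    simp only [C_pow, C_neg] at hr'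
    by_cases hq0 : q0 = 0
    · exfalso
      apply Q.nosq 0
      rw [hs, hq0, inj_zero]; simp
    have e0 := k0 hq0
    rcases Nat.even_or_odd' a0 with ⟨l, rfl | rfl⟩
    · exfalso
      apply Q.nosq (C r * X 0 ^ l)
      rw [hs, inj_mul, inj_C, inj_pow, inj_X0]
      linear_combination (X 0 ^ (2 * l)) * hr'
    · iterate 7 right
      left
      refine ⟨c0, q0, 2 * l + 1, Q.hc0, hq0, ⟨l, rfl⟩, ?_, ?_⟩
      · by_contra hl
        have : l = 0 := by omega
        subst this; simp at e0; omega
      · rw [Q.hR, hs]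
  · have e1 := k1 hq1
    have ha1 : 1 ≤ a1 := by
      by_contra hl
      have : a1 = 0 := by omega
      subst this; simp at e1; omega
    by_cases hq0 : q0 = 0
    · iterate 8 right
      left
      refine ⟨c0, q1, a1, Q.hc0, hq1, ha1, ?_⟩
      rw [Q.hR, hs, hq0]; simp
    · have e0 := k0 hq0
      have hlt : a1 < a0 := by
        by_contra hge
        have : a0 * d 0 ≤ a1 * d 0 := Nat.mul_le_mul_right _ (by omega)
        omega
      obtain ⟨e, rfl⟩ := Nat.exists_eq_add_of_lt hlt
      iterate 10 right
      left
      refine ⟨c0, q0, q1, e + 1, a1, Q.hc0, hq0, hq1, by omega, ?_⟩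
      rw [Q.hR, hs]; ring

lemma Quad.cls (Q : Quad f g d R c0 h P) : Cls d R h := by
  have p0 := Q.p0
  have d01 := Q.d01
  have d12 := Q.d12
  have hlt := Q.lt
  obtain ⟨c, a, hca, hs⟩ := rep2 (v := ![(d 0 : ℤ), d 1]) (N := 4) (by simpa using p0)
    (by simp; omega) (by simp; omega) Q.hP
  have hs' : inj12 P = C (c 0) * X 0 ^ a 0 + C (c 1) * X 0 ^ a 1 * X 1
      + C (c 2) * X 0 ^ a 2 * X 1 ^ 2 + C (c 3) * X 0 ^ a 3 * X 1 ^ 3 := by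
    rw [hs]
    simp only [Finset.sum_range_succ, Finset.sum_range_zero, inj_add, inj_mul, inj_pow, inj_C,
      inj_X0, inj_X1, inj_zero]
    ring
  have k0 := hca 0 (by norm_num)
  have k1 := hca 1 (by norm_num)
  have k2 := hca 2 (by norm_num)
  have k3 := hca 3 (by norm_num)
  simp only [Matrix.cons_val_zero, Matrix.cons_val_one, Nat.cast_zero, zero_mul, add_zero,
    Nat.cast_one, one_mul] at k0 k1 k2 k3
  norm_cast at k0 k1 k2 k3
  by_cases h3 : c 3 = 0
  · by_cases h2 : c 2 = 0
    · exact Q.cls1 k0 k1 (by rw [hs', h3, h2]; simp)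
    · exact Q.cls2 k0 k1 (k2 h2) h2 (by rw [hs', h3]; simp)
  · exact Q.cls3 k0 k1 k2 (k3 h3) h3 hs'

end QuadClsSec

set_option linter.unusedSectionVars false


section FinalSec
variable {K : Type u} [Field K] [IsAlgClosed K] [CharZero K]

lemma weight_w1 (m : Fin 3 →₀ ℕ) : Finsupp.weight w1 m = (m.degree : ℤ) := by
  rw [weight3, Finsupp.degree_eq_sum, Fin.sum_univ_three]
  simp [w1]

lemma degree_le_td {p : MvPolynomial (Fin 3) K} {m : Fin 3 →₀ ℕ} (hm : coeff m p ≠ 0) :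
    m.degree ≤ p.totalDegree := by
  have := le_totalDegree (mem_support_iff.2 hm)
  rwa [Finsupp.sum_fintype _ _ (by simp), ← Finsupp.degree_eq_sum] at this

lemma lead_ltStd (p : MvPolynomial (Fin 3) K) : Lead w1 (p.totalDegree : ℤ) p (ltStd p) := by
  constructor
  · intro m hm
    unfold ltStd at hm
    rw [coeff_homogeneousComponent] at hm
    rw [weight_w1]
    by_contra hne
    exact hm (if_neg (by exact_mod_cast hne))
  · intro m hm
    unfold ltStd at hm
    rw [coeff_sub, coeff_homogeneousComponent] at hm
    rw [weight_w1]
    split_ifs at hm with hd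
    · simp at hm
    · rw [sub_zero] at hm
      have := degree_le_td hm
      omega

lemma ltStd_ne {p : MvPolynomial (Fin 3) K} (hp : p ≠ 0) : ltStd p ≠ 0 := by
  intro h
  obtain ⟨m, hm, e⟩ := Finset.exists_mem_eq_sup p.support (support_nonempty.2 hp)
    (fun s => s.sum fun _ e => e)
  have e' : m.degree = p.totalDegree := by
    rw [totalDegree, e, Finsupp.sum_fintype _ _ (by simp), ← Finsupp.degree_eq_sum]
  have := congrArg (coeff m) h
  unfold ltStd at this
  rw [coeff_homogeneousComponent, if_pos e', coeff_zero] at this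
  exact mem_support_iff.1 hm this

lemma td_pos {f : Fin 3 → MvPolynomial (Fin 3) K}
    (hf : Function.Bijective
      ⇑(aeval f : MvPolynomial (Fin 3) K →ₐ[K] MvPolynomial (Fin 3) K)) (i : Fin 3) :
    0 < (f i).totalDegree := by
  by_contra h
  have h0 : (f i).totalDegree = 0 := by omega
  have e := totalDegree_eq_zero_iff_eq_C.1 h0
  have : (X i : MvPolynomial (Fin 3) K) = C (coeff 0 (f i)) := by
    apply hf.1
    rw [aeval_X, algHom_C]
    exact e
  have h1 := congrArg totalDegree this
  rw [totalDegree_X, totalDegree_C] at h1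
  omega

lemma cls_all (f : Fin 3 → MvPolynomial (Fin 3) K)
    (hf : Function.Bijective
      ⇑(aeval f : MvPolynomial (Fin 3) K →ₐ[K] MvPolynomial (Fin 3) K))
    (d : Fin 3 → ℕ) (hd : ∀ i, d i = (f i).totalDegree)
    (hd01 : d 0 ≤ d 1) (hd12 : d 1 ≤ d 2)
    (R : MvPolynomial (Fin 3) K)
    (hI : relIdealStd f = Ideal.span {R}) :
    ∃ h2 : MvPolynomial (Fin 2) K,
      IsWeightedHomogeneous d (inj12 h2) (d 2) ∧ Cls d R h2 := by
  have hz : IsWeightedHomogeneous d (inj12 (0 : MvPolynomial (Fin 2) K)) (d 2) := by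
    rw [inj_zero]; exact isWeightedHomogeneous_zero _ _ _
  by_cases hR0 : R = 0
  · exact ⟨0, hz, Or.inl hR0⟩
  have S : Setup f (fun i => ltStd (f i)) (fun i => (d i : ℤ)) R :=
    { bij := hf
      lead := fun i => by rw [hd i]; exact lead_ltStd (f i)
      gne := fun i => ltStd_ne (by
        intro h
        have := td_pos hf i
        rw [h] at this; simp at this)
      pos := fun i => by
        have := td_pos hf i
        rw [← hd i] at this
        exact_mod_cast this
      ker := fun P => by
        rw [← Ideal.mem_span_singleton, ← hI]; rfl
      Rne := hR0 }
  have p0 : 0 < d 0 := by have := S.pos 0; simpa using this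
  obtain ⟨n, hn, hnpos⟩ := S.wh
  have hlt : n < d 0 + d 1 + d 2 := S.degree_lt hn
  obtain ⟨A, hA, hs⟩ := rep3 (N := 3) S.pos (by push_cast; omega) hn
  simp only [Finset.sum_range_succ, Finset.sum_range_zero, zero_add, pow_zero, mul_one,
    pow_one] at hs
  have hA0 := hA 0
  have hA1 := hA 1
  have hA2 := hA 2
  simp only [Nat.cast_zero, zero_mul, sub_zero, Nat.cast_one, one_mul, Nat.cast_ofNat] at hA0 hA1 hA2
  by_cases h2 : A 2 = 0
  · rw [h2, inj_zero, zero_mul, add_zero] at hs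
    by_cases h1 : A 1 = 0
    · rw [h1, inj_zero, zero_mul, add_zero] at hs
      exact ⟨0, hz, cls_two S hnpos hA0 hs⟩
    · exact cls_lin S hd01 hd12 hnpos hlt hA0 hA1 h1 hs
  · obtain ⟨c, a, hca, hs2⟩ := rep2 (v := ![(d 0 : ℤ), d 1]) (N := 1) (by simpa using p0)
      (by simp; omega) (by simp; omega) hA2
    rw [Finset.sum_range_one] at hs2
    have hc : c 0 ≠ 0 := by
      intro h; apply h2; rw [hs2, h]; simp
    have e := hca 0 (by norm_num) hc
    simp at e
    have ha : a 0 = 0 := by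
      by_contra hne
      have : (1 : ℤ) * d 0 ≤ a 0 * d 0 := by
        apply mul_le_mul_of_nonneg_right _ (by positivity)
        exact_mod_cast Nat.one_le_iff_ne_zero.2 hne
      omega
    rw [ha] at e hs2
    simp at e hs2
    have hn2 : n = 2 * d 2 := by omega
    subst hn2
    have hA1' : IsWeightedHomogeneous ![(d 0 : ℤ), d 1] (A 1) (d 2 : ℤ) := wh_cast hA1 (by ring)
    have hh : IsWeightedHomogeneous ![(d 0 : ℤ), d 1] (C ((2 * c 0)⁻¹) * A 1) (d 2 : ℤ) :=
      wh_cast ((isWeightedHomogeneous_C _ _).mul hA1') (by simp)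
    have hP : IsWeightedHomogeneous ![(d 0 : ℤ), d 1]
        (C (c 0)⁻¹ * A 0 - (C ((2 * c 0)⁻¹) * A 1) ^ 2) (2 * d 2 : ℤ) :=
      IsWeightedHomogeneous.sub (wh_cast ((isWeightedHomogeneous_C _ _).mul hA0) (by simp))
        (wh_cast (hh.pow 2) (by simp))
    have Q : Quad f (fun i => ltStd (f i)) d R (c 0) (C ((2 * c 0)⁻¹) * A 1)
        (C (c 0)⁻¹ * A 0 - (C ((2 * c 0)⁻¹) * A 1) ^ 2) :=
      { S := S, p0 := p0, d01 := hd01, d12 := hd12, lt := by omega, hc0 := hc, hh := hh, hP := hP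
        hR := by
          have i1 : c 0 * (c 0)⁻¹ = 1 := mul_inv_cancel₀ hc
          have i2 : c 0 * (2 * (2 * c 0)⁻¹) = 1 := by field_simp
          have j1 := congrArg (C : K → MvPolynomial (Fin 3) K) i1
          have j2 := congrArg (C : K → MvPolynomial (Fin 3) K) i2
          simp only [C_mul, C_1] at j1 j2
          have t : (C 2 : MvPolynomial (Fin 3) K) = 2 := map_ofNat C 2
          rw [t] at j2
          rw [hs, hs2]
          simp only [inj_sub, inj_mul, inj_C, inj_pow]
          linear_combination (-inj12 (A 0)) * j1 - inj12 (A 1) * X 2 * j2 }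
    exact ⟨_, wh_nat (inj_wh (w := fun i => (d i : ℤ)) hh), Q.cls⟩

end FinalSec

/-- Theorem 3: classification of the possible principal ideals of relations for an
automorphism of `K³`. -/
theorem stmt2 {K : Type*} [Field K] [IsAlgClosed K] [CharZero K]
    (f : Fin 3 → MvPolynomial (Fin 3) K)
    (hf : Function.Bijective
      ⇑(aeval f : MvPolynomial (Fin 3) K →ₐ[K] MvPolynomial (Fin 3) K))
    (d : Fin 3 → ℕ) (hd : ∀ i, d i = (f i).totalDegree)
    (hd01 : d 0 ≤ d 1) (hd12 : d 1 ≤ d 2)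
    (R : MvPolynomial (Fin 3) K)
    (hI : relIdealStd f = Ideal.span {R}) :
    ∃ h2 : MvPolynomial (Fin 2) K,
      IsWeightedHomogeneous d (inj12 h2) (d 2) ∧
      (R = 0 ∨
       (∃ c0 : K, c0 ≠ 0 ∧
          R = C c0 * (X 2 + inj12 h2)) ∨
       (∃ (c0 c : K) (e1 e2 : ℕ), c0 ≠ 0 ∧ c ≠ 0 ∧ Nat.gcd e1 e2 = 1 ∧
          R = C c0 * (X 0 ^ e1 + C c * X 1 ^ e2)) ∨
       (∃ (c0 c a : K) (k e1 : ℕ), c0 ≠ 0 ∧ c ≠ 0 ∧ 2 ≤ k ∧ 1 ≤ e1 ∧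
          R = C c0 * ((X 1 + C a * X 0 ^ e1) * (X 2 + inj12 h2) + C c * X 0 ^ k)) ∨
       (∃ (c0 : K) (k : ℕ) (P : MvPolynomial (Fin 2) K) (m : ℕ), c0 ≠ 0 ∧ 1 ≤ k ∧
          IsWeightedHomogeneous d (inj12 P) m ∧
          R = C c0 * (X 0 ^ k * (X 2 + inj12 h2) + inj12 P)) ∨
       (∃ c0 c : K, c0 ≠ 0 ∧ c ≠ 0 ∧
          R = C c0 * ((X 2 + inj12 h2) ^ 2 + C c * X 1 ^ 3)) ∨
       (∃ c0 c : K, c0 ≠ 0 ∧ c ≠ 0 ∧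
          R = C c0 * ((X 2 + inj12 h2) ^ 2 + C c * X 0 * X 1 ^ 2)) ∨
       (∃ (c0 c : K) (r1 : ℕ), c0 ≠ 0 ∧ c ≠ 0 ∧ Odd r1 ∧ 3 ≤ r1 ∧
          R = C c0 * ((X 2 + inj12 h2) ^ 2 + C c * X 0 ^ r1)) ∨
       (∃ (c0 c : K) (r1 : ℕ), c0 ≠ 0 ∧ c ≠ 0 ∧ 1 ≤ r1 ∧
          R = C c0 * ((X 2 + inj12 h2) ^ 2 + C c * X 0 ^ r1 * X 1)) ∨
       (∃ (c0 a b : K) (e1 : ℕ), c0 ≠ 0 ∧ a ≠ 0 ∧ b ≠ 0 ∧ Odd e1 ∧ 3 ≤ e1 ∧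
          R = C c0 * ((X 2 + inj12 h2) ^ 2 + C a * X 0 ^ e1 + C b * X 1 ^ 2)) ∨
       (∃ (c0 a b : K) (e1 r1 : ℕ), c0 ≠ 0 ∧ a ≠ 0 ∧ b ≠ 0 ∧ 1 ≤ e1 ∧
          R = C c0 * ((X 2 + inj12 h2) ^ 2 + (C a * X 0 ^ e1 + C b * X 1) * X 0 ^ r1)) ∨
       (∃ (c0 a1 b1 a2 b2 : K) (e1 : ℕ), c0 ≠ 0 ∧ a1 * b2 - b1 * a2 ≠ 0 ∧ 1 ≤ e1 ∧
          R = C c0 * ((X 2 + inj12 h2) ^ 2 +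
            (C a1 * X 0 ^ e1 + C b1 * X 1) * (C a2 * X 0 ^ e1 + C b2 * X 1))) ∨
       (∃ c0 a1 b1 a2 b2 : K, c0 ≠ 0 ∧ (a1, b1) ≠ (0, 0) ∧ (a2, b2) ≠ (0, 0) ∧
          R = C c0 * ((X 2 + inj12 h2) ^ 2 +
            (C a1 * X 0 + C b1 * X 1) * (C a2 * X 0 + C b2 * X 1) ^ 2)) ∨
       (∃ (c0 a b : K) (e1 : ℕ), c0 ≠ 0 ∧ a * b ≠ 0 ∧ 2 ≤ e1 ∧
          R = C c0 * ((X 2 + inj12 h2) ^ 2 + (C a * X 0 ^ e1 + C b * X 1) ^ 2 * X 0))) := by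
  exact cls_all f hf d hd hd01 hd12 R hI
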